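/- Let p be a prime, g a fixed primitive root modulo p, and for m not divisible by p let ind m denote the base-g index (discrete logarithm) of m, i.e., the residue class h modulo p−1 with g^h ≡ m (mod p). Let f ∈ Z_p[x] with deg(f) ≥ 1, r ∈ Z, s ∈ N with s < p, and define R = { n : 0 ≤ n ≤ p−1 and there exists h ∈ {r, r+1, …, r+s−1} with ind f(n) ≡ h }. Then |R| = s + O( deg(f)·p^{1/2}·log p ). Moreover, if at least one of the following holds: (i) f is irreducible over Z_p; (ii) in the factorization f = f_1^{α_1}⋯f_u^{α_u} into powers of distinct irreducible polynomials over Z_p there exists β such that exactly one or two of the f_i have degree β; (iii) k ≤ 2; (iv) (4k)^{deg(f)} < p or (4 deg(f))^{k} < p; then there is an absolute constant c > 0 such that for every ε > 0 there exists p_0(ε) with: for all primes p ≥ p_0(ε) (under the above hypotheses), C_k(R, p) ≤ c·(1+ε)^k·deg(f)·k·2^k·p^{1/2}·(log p)^{k+1}. -/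

import Mathlib

open Finset Filter

/-- The function `f_R` from the paper: `1 - |R|/q` on `R`, `-|R|/q` off `R`. -/
noncomputable def fsub (q : ℕ) (R : Finset ℕ) (n : ℕ) : ℝ :=
  if n % q ∈ R then 1 - (R.card : ℝ) / q else -((R.card : ℝ) / q)

/-- The correlation measure `C_k(R,q)` of order `k` of a subset `R ⊆ Z_q`. -/
noncomputable def corrK (R : Finset ℕ) (q k : ℕ) : ℝ :=
  sSup {x : ℝ | ∃ (M : ℕ) (d : Fin k → ℕ), 1 ≤ M ∧ M ≤ q ∧ StrictMono d ∧
    (∀ i, d i ≤ q - 1) ∧ x = |∑ n ∈ Finset.range M, ∏ i, fsub q R (n + d i)|}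

/-- `C(R,q,s) = max_{1 ≤ k ≤ s} C_k(R,q)`. -/
noncomputable def corrMeasure (R : Finset ℕ) (q s : ℕ) : ℝ :=
  sSup {x : ℝ | ∃ k, 1 ≤ k ∧ k ≤ s ∧ x = corrK R q k}

-- The subset defined via the index (discrete logarithm) to the base of a primitive
-- root `g` modulo `p`: `R = {n : 0 ≤ n ≤ p−1, ∃ h ∈ {r,…,r+s−1}, ind f(n) ≡ h (mod p−1)}`.
open scoped Classical in
noncomputable def indexSet (p : ℕ) (g : (ZMod p)ˣ) (f : Polynomial (ZMod p))
    (r : ℤ) (s : ℕ) : Finset ℕ :=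
  (Finset.range p).filter (fun n => ∃ h : ℤ, r ≤ h ∧ h < r + s ∧
    ((g ^ h : (ZMod p)ˣ) : ZMod p) = f.eval (n : ZMod p))

namespace WeilBound

open Polynomial

section Nonvanishing

variable {F : Type*} [Field F]

/-- The specialization `u ↦ X ^ P`, `T ↦ t` on `F[u][T]`. -/
noncomputable def specialize (P : ℕ) (t : F[X]) : F[X][X] →+* F[X] :=
  eval₂RingHom (expand F P : F[X] →+* F[X]) t

theorem specialize_ne_zero {P : ℕ} (hP : 0 < P) {t : F[X]} (ht0 : t.coeff 0 = 0)
    (ht1 : t.coeff 1 ≠ 0) {b : F[X][X]} (hb : b ≠ 0) (hdeg : b.natDegree < P) :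
    specialize P t b ≠ 0 := by
  have hnu : ¬ IsUnit (C X : F[X][X]) := by
    rw [isUnit_C]; exact not_isUnit_X
  obtain ⟨b', hb', hnd⟩ := (FiniteMultiplicity.of_not_isUnit hnu
    hb).exists_eq_pow_mul_and_not_dvd
  generalize multiplicity (C X : F[X][X]) b = i at hb'
  have hb'0 : b' ≠ 0 := by rintro rfl; simp at hnd
  have hdeg' : b'.natDegree < P := by
    refine lt_of_le_of_lt ?_ hdeg
    rw [hb', natDegree_mul (pow_ne_zero _ (by simp)) hb'0]
    omega
  have hex : ∃ c, ¬ X ∣ b'.coeff c := by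
    by_contra! h
    exact hnd ((C_dvd_iff_dvd_coeff _ _).2 h)
  classical
  let v := Nat.find hex
  have hv : ¬ X ∣ b'.coeff v := Nat.find_spec hex
  have hlt : ∀ c < v, X ∣ b'.coeff c := fun c hc => by
    have := Nat.find_min hex hc; push Not at this; exact this
  have hvP : v < P := by
    refine lt_of_le_of_lt (le_natDegree_of_ne_zero ?_) hdeg'
    intro h; rw [h] at hv; simp at hv
  obtain ⟨w, rfl⟩ : X ∣ t := X_dvd_iff.2 ht0
  have hw : w.coeff 0 ≠ 0 := by simpa using ht1
  rw [hb', map_mul, map_pow]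
  refine mul_ne_zero (pow_ne_zero _ ?_) ?_
  · simp [specialize, hP.ne']
  · intro h0
    have hsum : specialize P (X * w) b' =
        ∑ c ∈ range (b'.natDegree + 1), expand F P (b'.coeff c) * (X * w) ^ c := by
      simp [specialize, eval₂_eq_sum_range]
    have hmem : v ∈ range (b'.natDegree + 1) := by
      rw [mem_range, Nat.lt_succ_iff]
      refine le_natDegree_of_ne_zero ?_
      intro h; rw [h] at hv; simp at hv
    have hd : X ^ (v + 1) ∣ expand F P (b'.coeff v) * (X * w) ^ v := by
      have h1 : X ^ (v + 1) ∣ ∑ c ∈ (range (b'.natDegree + 1)).erase v,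
          expand F P (b'.coeff c) * (X * w) ^ c := by
        refine dvd_sum fun c hc => ?_
        rcases lt_or_gt_of_ne (ne_of_mem_erase hc) with h | h
        · obtain ⟨q, hq⟩ := hlt c h
          rw [hq, map_mul, expand_X, mul_assoc]
          exact Dvd.dvd.mul_right (pow_dvd_pow _ hvP) _
        · rw [mul_pow]
          exact Dvd.dvd.mul_left (Dvd.dvd.mul_right (pow_dvd_pow _ h) _) _
      have h2 := hsum
      rw [h0, ← add_sum_erase _ _ hmem] at h2
      exact (dvd_add_left h1).1 (h2 ▸ dvd_zero _)
    rw [mul_pow, mul_left_comm, pow_succ] at hd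
    have h3 := (mul_dvd_mul_iff_left (pow_ne_zero v (X_ne_zero (R := F)))).1 hd
    rw [X_dvd_iff] at h3 hv
    rw [mul_coeff_zero, coeff_zero_eq_eval_zero (w ^ v), eval_pow, ← coeff_zero_eq_eval_zero] at h3
    have h4 : (expand F P (b'.coeff v)).coeff 0 = (b'.coeff v).coeff 0 := by
      rw [coeff_zero_eq_eval_zero, expand_eval, zero_pow hP.ne', ← coeff_zero_eq_eval_zero]
    rw [h4] at h3
    exact mul_ne_zero hv (pow_ne_zero _ hw) h3

/-- The element `Y = u + T - T ^ p` of `F[u][T]`. -/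
noncomputable def artinY (F : Type*) [Field F] (p : ℕ) : F[X][X] := C X + X - X ^ p

theorem artinY_natDegree {p : ℕ} (hp : 2 ≤ p) : (artinY F p).natDegree = p := by
  unfold artinY
  rw [natDegree_sub_eq_right_of_natDegree_lt] <;> rw [natDegree_X_pow]
  rw [add_comm, natDegree_X_add_C]
  omega

theorem sum_C_mul_X_pow_eq_zero {R : Type*} [CommRing R] {p : ℕ} (k : ℕ → R)
    (h : ∑ l ∈ range p, C (k l) * X ^ l = 0) : ∀ l < p, k l = 0 := by
  intro l hl
  have := congrArg (fun s => s.coeff l) h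
  simpa [finsetSum_coeff, coeff_C_mul, coeff_X_pow, hl] using this

theorem degree_sum_C_mul_X_pow_lt {R : Type*} [CommRing R] (p : ℕ) (k : ℕ → R) :
    (∑ l ∈ range p, C (k l) * X ^ l).degree < (p : WithBot ℕ) := by
  refine lt_of_le_of_lt (degree_sum_le _ _) ?_
  rw [Finset.sup_lt_iff (by exact_mod_cast WithBot.bot_lt_coe p)]
  intro l hl
  exact lt_of_le_of_lt (degree_C_mul_X_pow_le _ _) (by exact_mod_cast mem_range.1 hl)

theorem eq_zero_of_mul_add_eq_zero {R : Type*} [CommRing R] [IsDomain R] {Y q r : R[X]}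
    (hY : Y ≠ 0) (hr : r.degree < Y.natDegree) (h : Y * q + r = 0) : q = 0 := by
  by_contra hne
  have h2 : r = -(Y * q) := by linear_combination h
  rw [h2, degree_neg, degree_mul, degree_eq_natDegree hY, degree_eq_natDegree hne] at hr
  have : Y.natDegree + q.natDegree < Y.natDegree := by exact_mod_cast hr
  omega

theorem artinY_combination_eq_zero {p : ℕ} (hp : 2 ≤ p) (A : ℕ) (k : ℕ → ℕ → F[X])
    (h : ∑ a ∈ range A, ∑ l ∈ range p, C (k a l) * artinY F p ^ a * X ^ l = 0) :
    ∀ a < A, ∀ l < p, k a l = 0 := by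
  induction A generalizing k with
  | zero => intro a ha; omega
  | succ A ih =>
    rw [sum_range_succ'] at h
    have h1 : ∑ a ∈ range A, ∑ l ∈ range p, C (k (a + 1) l) * artinY F p ^ (a + 1) * X ^ l
        = artinY F p *
          ∑ a ∈ range A, ∑ l ∈ range p, C (k (a + 1) l) * artinY F p ^ a * X ^ l := by
      rw [mul_sum]
      refine sum_congr rfl fun a _ => ?_
      rw [mul_sum]
      exact sum_congr rfl fun l _ => by ring
    rw [h1] at h
    simp only [pow_zero, mul_one] at h
    have hY0 : artinY F p ≠ 0 := by
      intro h0; have := artinY_natDegree (F := F) hp; rw [h0] at this; simp at this; omega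
    have hq0 := eq_zero_of_mul_add_eq_zero hY0
      (by rw [artinY_natDegree hp]; exact degree_sum_C_mul_X_pow_lt p (k 0)) h
    have hr0 : ∑ l ∈ range p, C (k 0 l) * (X : F[X][X]) ^ l = 0 := by
      rw [hq0] at h; simpa using h
    intro a ha l hl
    rcases a with _ | a
    · exact sum_C_mul_X_pow_eq_zero _ hr0 l hl
    · exact ih (fun a l => k (a + 1) l) hq0 a (by omega) l hl

theorem natDegree_combination_lt {p : ℕ} (hp : 2 ≤ p) (A : ℕ) (hA : 0 < A) (k : ℕ → ℕ → F[X]) :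
    (∑ a ∈ range A, ∑ l ∈ range p, C (k a l) * artinY F p ^ a * X ^ l).natDegree < p * A := by
  have : (∑ a ∈ range A, ∑ l ∈ range p, C (k a l) * artinY F p ^ a * X ^ l).natDegree
      ≤ p * A - 1 := by
    refine natDegree_sum_le_of_forall_le _ _ fun a ha => ?_
    refine natDegree_sum_le_of_forall_le _ _ fun l hl => ?_
    rw [mem_range] at ha hl
    refine natDegree_mul_le.trans ?_
    rw [natDegree_X_pow]
    have h1 := natDegree_C_mul_le (k a l) (artinY F p ^ a)
    have h2 := natDegree_pow_le (p := artinY F p) (n := a)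
    rw [artinY_natDegree hp] at h2
    have h3 : p * (a + 1) ≤ p * A := Nat.mul_le_mul_left _ ha
    rw [mul_add, mul_comm p a] at h3
    omega
  have : 0 < p * A := by positivity
  omega

end Nonvanishing

section Resultant

theorem natDegree_det_le {n R : Type*} [Fintype n] [DecidableEq n] [CommRing R]
    (M : Matrix n n R[X]) (D : ℕ) (h : ∀ i j, (M i j).natDegree ≤ D) :
    M.det.natDegree ≤ Fintype.card n * D := by
  rw [Matrix.det_apply]
  refine natDegree_sum_le_of_forall_le _ _ fun σ _ => ?_
  refine (natDegree_smul_le _ _).trans ?_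
  refine (natDegree_prod_le _ _).trans ?_
  refine (Finset.sum_le_card_nsmul _ _ D fun i _ => h _ _).trans ?_
  simp

theorem natDegree_resultant_le {R : Type*} [CommRing R] (f g : R[X][X]) (m n D : ℕ)
    (hf : ∀ i, (f.coeff i).natDegree ≤ D) (hg : ∀ i, (g.coeff i).natDegree ≤ D) :
    (resultant f g m n).natDegree ≤ (m + n) * D := by
  unfold resultant
  refine (natDegree_det_le _ D fun i j => ?_).trans (by simp)
  unfold sylvester
  simp only [Matrix.of_apply]
  refine Fin.addCases (fun j₁ => ?_) (fun j₁ => ?_) j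
  · simp only [Fin.addCases_left]
    split_ifs
    · exact hg _
    · simp
  · simp only [Fin.addCases_right]
    split_ifs
    · exact hf _
    · simp

theorem isCoprime_X_pow_sub_C {L : Type*} [Field L] {d : ℕ} (hd : 0 < d) {w : L}
    (hw : ∀ (e : ℕ) (c : L), c ^ d = w ^ e → d ∣ e) {Θ : L[X]} (hΘ : Θ ≠ 0)
    (hdeg : Θ.natDegree < d) : IsCoprime Θ (X ^ d - C w) := by
  classical
  by_contra hnc
  have hg0 : (X ^ d - C w : L[X]) ≠ 0 := X_pow_sub_C_ne_zero hd w
  obtain ⟨G, hG1, hG2, hGu⟩ : ∃ G : L[X], G ∣ Θ ∧ G ∣ X ^ d - C w ∧ ¬ IsUnit G :=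
    ⟨EuclideanDomain.gcd Θ (X ^ d - C w), EuclideanDomain.gcd_dvd_left _ _,
      EuclideanDomain.gcd_dvd_right _ _, fun h => hnc (EuclideanDomain.gcd_isUnit_iff.1 h)⟩
  have hG0 : G ≠ 0 := by rintro rfl; exact hΘ (zero_dvd_iff.1 hG1)
  have hGd : G.natDegree < d := (natDegree_le_of_dvd hG1 hΘ).trans_lt hdeg
  have hGpos : 0 < G.natDegree := by
    rcases Nat.eq_zero_or_pos G.natDegree with h | h
    · exact absurd (isUnit_iff_degree_eq_zero.2 (by rw [degree_eq_natDegree hG0, h]; rfl)) hGu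
    · exact h
  let E := AlgebraicClosure L
  let φ : L →+* E := algebraMap L E
  have hsp : (G.map φ).Splits := IsAlgClosed.splits _
  have hlc : (G.map φ).leadingCoeff = φ G.leadingCoeff := by simp
  have h1 := hsp.coeff_zero_eq_leadingCoeff_mul_prod_roots
  have hroot : ∀ r ∈ (G.map φ).roots, r ^ d = φ w := by
    intro r hr
    have h2 : (G.map φ).eval r = 0 := (mem_roots'.1 hr).2
    obtain ⟨q, hq⟩ := hG2
    have h3 := congrArg (fun s => (s.map φ).eval r) hq
    simp only [Polynomial.map_mul, eval_mul, h2, zero_mul] at h3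
    simpa [sub_eq_zero] using h3
  have hcard : (G.map φ).roots.card = G.natDegree := by
    rw [← hsp.natDegree_eq_card_roots, natDegree_map]
  have hprod : ((G.map φ).roots.prod) ^ d = φ w ^ G.natDegree := by
    have h := Multiset.prod_map_pow (m := (G.map φ).roots) (f := fun x => x) (n := d)
    rw [Multiset.map_id'] at h
    rw [← h, Multiset.map_congr rfl hroot, Multiset.map_const',
      Multiset.prod_replicate, hcard]
  have h5 : φ ((-1) ^ G.natDegree * (G.coeff 0 / G.leadingCoeff)) = (G.map φ).roots.prod := by
    rw [coeff_map, hlc, natDegree_map] at h1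
    have : φ G.leadingCoeff ≠ 0 := by simpa using hG0
    rw [map_mul, map_div₀, h1, map_pow, map_neg, map_one, mul_right_comm,
      mul_div_cancel_right₀ _ this,
      ← mul_assoc, ← mul_pow, neg_mul_neg, one_mul, one_pow, one_mul]
  have h6 := hw G.natDegree ((-1) ^ G.natDegree * (G.coeff 0 / G.leadingCoeff)) (by
    apply φ.injective
    rw [map_pow, h5, hprod, map_pow])
  exact absurd (Nat.le_of_dvd hGpos h6) (by omega)

end Resultant

section Nonvanishing

variable {F : Type*} [Field F]

theorem artinY_comp_ne_zero {p : ℕ} (hp : 2 ≤ p) {f : F[X]} (hf : f ≠ 0) (r : F) :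
    ¬ (C (X - C r) : F[X][X]) ∣ aeval (artinY F p) f := by
  rintro ⟨q, hq⟩
  have h1 := congrArg (mapAlgHom (aeval r : F[X] →ₐ[F] F)) hq
  rw [map_mul, ← aeval_algHom_apply] at h1
  have h2 : mapAlgHom (aeval r : F[X] →ₐ[F] F) (C (X - C r)) = 0 := by simp
  have h3 : mapAlgHom (aeval r : F[X] →ₐ[F] F) (artinY F p) = C r + X - X ^ p := by
    simp [artinY]
  rw [h2, h3, zero_mul] at h1
  have hdeg : (C r + X - X ^ p : F[X]).natDegree = p := by
    rw [natDegree_sub_eq_right_of_natDegree_lt] <;> rw [natDegree_X_pow]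
    rw [add_comm, natDegree_X_add_C]; omega
  have h4 : f.comp (C r + X - X ^ p) = 0 := h1
  rcases comp_eq_zero_iff.1 h4 with h | ⟨-, h⟩
  · exact hf h
  · rw [h, natDegree_C] at hdeg; omega

theorem dvd_of_pow_eq_pow {p : ℕ} (hp : 2 ≤ p) {d : ℕ} (hd : 0 < d) {f : F[X]} (hf : f ≠ 0)
    (hgcd : ∀ e, (∀ r, f.IsRoot r → d ∣ e * f.rootMultiplicity r) → d ∣ e)
    (e : ℕ) (c : FractionRing F[X][X])
    (hc : c ^ d = (algebraMap F[X][X] (FractionRing F[X][X])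
      (aeval (artinY F p) f ^ (d - 1) * C f)) ^ e) : d ∣ e := by
  refine hgcd e fun r _ => ?_
  obtain ⟨N, D, hD, rfl⟩ := IsFractionRing.div_surjective (A := F[X][X]) c
  have hD0 : D ≠ 0 := nonZeroDivisors.ne_zero hD
  have hDm : algebraMap F[X][X] (FractionRing F[X][X]) D ≠ 0 := by
    simpa using hD0
  rw [div_pow, div_eq_iff (pow_ne_zero _ hDm),
    ← (algebraMap F[X][X] (FractionRing F[X][X])).map_pow N,
    ← (algebraMap F[X][X] (FractionRing F[X][X])).map_pow D,
    ← (algebraMap F[X][X] (FractionRing F[X][X])).map_pow _ e,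
    ← (algebraMap F[X][X] (FractionRing F[X][X])).map_mul] at hc
  have hc' := IsFractionRing.injective F[X][X] (FractionRing F[X][X]) hc
  have hq : Prime (C (X - C r) : F[X][X]) := prime_C_iff.2 (prime_X_sub_C r)
  obtain ⟨g, hg, hnd⟩ := exists_eq_pow_rootMultiplicity_mul_and_not_dvd f hf r
  have hgC : ¬ (C (X - C r) : F[X][X]) ∣ C g := by
    intro h
    exact hnd (by simpa using (C_dvd_iff_dvd_coeff _ _).1 h 0)
  have hY := artinY_comp_ne_zero hp hf r
  have hw : emultiplicity (C (X - C r) : F[X][X]) (aeval (artinY F p) f ^ (d - 1) * C f) =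
      (f.rootMultiplicity r : ℕ) := by
    have h1 : aeval (artinY F p) f ^ (d - 1) * C f =
        C (X - C r) ^ f.rootMultiplicity r * (aeval (artinY F p) f ^ (d - 1) * C g) := by
      conv_lhs => rw [show (C f : F[X][X]) = C ((X - C r) ^ f.rootMultiplicity r * g) from
        congrArg C hg]
      rw [C_mul, C_pow]; ring
    rw [h1, emultiplicity_mul hq, emultiplicity_pow_self_of_prime hq,
      emultiplicity_eq_zero.2, add_zero]
    intro h
    rcases hq.dvd_or_dvd h with h | h
    · exact hY (hq.dvd_of_dvd_pow h)
    · exact hgC h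
  have hN0 : N ≠ 0 := by
    rintro rfl
    have hw0 : aeval (artinY F p) f ^ (d - 1) * C f ≠ 0 := by
      intro h
      rw [h, emultiplicity_zero] at hw
      exact absurd hw.symm (ENat.natCast_ne_top _)
    have h3 := mul_ne_zero (pow_ne_zero e hw0) (pow_ne_zero d hD0)
    rw [← hc'] at h3
    exact h3 (zero_pow hd.ne')
  have hfN := FiniteMultiplicity.of_prime_left hq hN0
  have hfD := FiniteMultiplicity.of_prime_left hq hD0
  have h2 := congrArg (emultiplicity (C (X - C r) : F[X][X])) hc'
  rw [emultiplicity_mul hq, emultiplicity_pow hq, emultiplicity_pow hq, emultiplicity_pow hq, hw,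
    hfN.emultiplicity_eq_multiplicity, hfD.emultiplicity_eq_multiplicity] at h2
  have h3 : d * multiplicity (C (X - C r)) N =
      e * f.rootMultiplicity r + d * multiplicity (C (X - C r)) D := by exact_mod_cast h2
  exact (Nat.dvd_add_left (dvd_mul_right d _)).1 (h3 ▸ dvd_mul_right d _)

theorem specialize_artinY {P p : ℕ} {t : F[X]} (ht : t ^ p = t - X + X ^ P) :
    specialize P t (artinY F p) = X := by
  simp only [specialize, artinY, map_sub, map_add, map_pow, coe_eval₂RingHom, eval₂_C, eval₂_X,
    RingHom.coe_coe, expand_X, ht]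
  ring

theorem specialize_aeval_artinY {P p : ℕ} {t : F[X]} (ht : t ^ p = t - X + X ^ P) (f : F[X]) :
    specialize P t (aeval (artinY F p) f) = f := by
  have : (specialize P t).comp (algebraMap F F[X][X]) = C := by
    ext a; simp [specialize, Polynomial.algebraMap_apply]
  rw [aeval_def, hom_eval₂, specialize_artinY ht, this, eval₂_C_X]

theorem natDegree_aeval_artinY_le {p : ℕ} (hp : 2 ≤ p) (f : F[X]) :
    (aeval (artinY F p) f).natDegree ≤ f.natDegree * p := by
  rw [aeval_eq_sum_range]
  refine natDegree_sum_le_of_forall_le _ _ fun i hi => ?_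
  refine (natDegree_smul_le _ _).trans (natDegree_pow_le.trans ?_)
  rw [artinY_natDegree hp]
  exact Nat.mul_le_mul_right _ (by simpa [Nat.lt_succ_iff] using hi)

/-- Nonvanishing of the Stepanov auxiliary polynomial. -/
theorem stepanov_eq_zero {p P d e : ℕ} (hp : 2 ≤ p) (hP : 0 < P) (hd : 0 < d) {t f : F[X]}
    (ht0 : t.coeff 0 = 0) (ht1 : t.coeff 1 ≠ 0) (ht : t ^ p = t - X + X ^ P)
    (hf : f ≠ 0) (hfP : expand F P f = f ^ P)
    (hgcd : ∀ e, (∀ r, f.IsRoot r → d ∣ e * f.rootMultiplicity r) → d ∣ e)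
    (he : e * d + 1 = P + d) {A I : ℕ} (k : ℕ → ℕ → ℕ → ℕ → F)
    (hsize : 2 * d * (p * A + d * (f.natDegree * p)) < P)
    (h : ∑ j ∈ range d, ∑ a ∈ range A, ∑ l ∈ range p, ∑ i ∈ range I,
      C (k a i j l) * X ^ a * X ^ (P * i) * f ^ (e * j) * t ^ l = 0) :
    ∀ a < A, ∀ i < I, ∀ j < d, ∀ l < p, k a i j l = 0 := by
  let K : ℕ → ℕ → ℕ → F[X] := fun j a l => ∑ i ∈ range I, C (k a i j l) * X ^ i
  let b : ℕ → F[X][X] := fun j =>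
    ∑ a ∈ range A, ∑ l ∈ range p, C (K j a l) * artinY F p ^ a * X ^ l
  let Θ : F[X][X][X] := ∑ j ∈ range d, C (b j) * X ^ j
  let w : F[X][X] := aeval (artinY F p) f ^ (d - 1) * C f
  have hΘ : Θ = 0 := by
    by_contra hne
    have hΘdeg : Θ.natDegree < d := by
      have := degree_sum_C_mul_X_pow_lt d b
      rw [← natDegree_lt_iff_degree_lt hne] at this
      exact this
    have hw0 : w.natDegree ≤ p * A + d * (f.natDegree * p) := by
      refine natDegree_mul_le.trans ?_
      rw [natDegree_C, add_zero]
      refine natDegree_pow_le.trans ?_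
      have := Nat.mul_le_mul (Nat.sub_le d 1) (natDegree_aeval_artinY_le hp f)
      omega
    have hb : ∀ j, (b j).natDegree ≤ p * A + d * (f.natDegree * p) := by
      intro j
      rcases Nat.eq_zero_or_pos A with hA | hA
      · simp [b, hA]
      · exact ((natDegree_combination_lt hp A hA (K j)).le).trans (Nat.le_add_right _ _)
    have hsubdeg : (X ^ d - C w : F[X][X][X]).natDegree = d := natDegree_X_pow_sub_C
    have hRdeg : (resultant Θ (X ^ d - C w)).natDegree < P := by
      refine lt_of_le_of_lt (natDegree_resultant_le _ _ _ _ _ (fun j => ?_) (fun j => ?_))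
        (lt_of_le_of_lt (Nat.mul_le_mul_right _ (?_ : _ ≤ 2 * d)) hsize)
      · simp only [Θ, finsetSum_coeff, coeff_C_mul, coeff_X_pow, mul_ite, mul_one, mul_zero]
        rw [Finset.sum_ite_eq]
        split_ifs
        · exact hb j
        · simp
      · rw [coeff_sub, coeff_X_pow, coeff_C]
        refine (natDegree_sub_le _ _).trans (max_le ?_ ?_)
        · split_ifs <;> simp
        · split_ifs
          · exact hw0
          · simp
      · rw [hsubdeg]; omega
    have hRne : resultant Θ (X ^ d - C w) ≠ 0 := by
      intro h0
      have hinj := IsFractionRing.injective F[X][X] (FractionRing F[X][X])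
      have h1 := resultant_map_map Θ (X ^ d - C w) Θ.natDegree (X ^ d - C w).natDegree
        (algebraMap F[X][X] (FractionRing F[X][X]))
      rw [h0, map_zero] at h1
      have h2 := resultant_eq_zero_iff (f := Θ.map (algebraMap F[X][X] (FractionRing F[X][X])))
        (g := (X ^ d - C w).map (algebraMap F[X][X] (FractionRing F[X][X])))
      rw [natDegree_map_eq_of_injective hinj, natDegree_map_eq_of_injective hinj] at h2
      refine (h2.1 h1).2 ?_
      rw [Polynomial.map_sub, Polynomial.map_pow, map_X, map_C]
      refine isCoprime_X_pow_sub_C hd (dvd_of_pow_eq_pow hp hd hf hgcd) ?_ ?_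
      · rwa [Ne, Polynomial.map_eq_zero_iff hinj]
      · rwa [natDegree_map_eq_of_injective hinj]
    refine specialize_ne_zero hP ht0 ht1 hRne hRdeg ?_
    obtain ⟨q₁, q₂, -, -, hq⟩ := exists_mul_add_mul_eq_C_resultant Θ (X ^ d - C w) le_rfl le_rfl
      (Or.inr (by rw [hsubdeg]; exact hd.ne'))
    have h1 := congrArg (eval₂RingHom (specialize P t) (f ^ e)) hq
    have h2 : eval₂RingHom (specialize P t) (f ^ e) Θ = 0 := by
      rw [← h]
      simp only [Θ, b, K, map_sum, map_mul, map_pow, coe_eval₂RingHom, eval₂_C, eval₂_X,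
        specialize_artinY ht, sum_mul]
      refine sum_congr rfl fun j _ => sum_congr rfl fun a _ => sum_congr rfl fun l _ =>
        sum_congr rfl fun i _ => ?_
      simp [specialize, ← pow_mul]
      ring
    have h3 : eval₂RingHom (specialize P t) (f ^ e) (X ^ d - C w) = 0 := by
      have : specialize P t (C f) = f ^ P := by simp [specialize, hfP]
      rw [coe_eval₂RingHom, eval₂_sub, eval₂_pow, eval₂_C, eval₂_X, map_mul, map_pow,
        specialize_aeval_artinY ht, this, ← pow_mul, ← pow_add, sub_eq_zero]
      congr 1; omega
    rw [map_add, map_mul, map_mul, h2, h3, coe_eval₂RingHom, eval₂_C] at h1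
    simpa using h1.symm
  intro a ha i hi j hj l hl
  have h1 := artinY_combination_eq_zero hp A (K j) (sum_C_mul_X_pow_eq_zero b hΘ j hj) a ha l hl
  exact sum_C_mul_X_pow_eq_zero (fun i => k a i j l) h1 i hi

end Nonvanishing

section Count

variable {F : Type*} [Field F]

theorem exists_linear_relation {ι : Type*} [DecidableEq ι] (s : Finset ι) (g : ι → F[X]) (E : ℕ)
    (hg : ∀ i ∈ s, (g i).natDegree < E) (hs : E < s.card) :
    ∃ κ : ι → F, (∃ i ∈ s, κ i ≠ 0) ∧ ∑ i ∈ s, C (κ i) * g i = 0 := by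
  let M : Matrix (Fin E) s F := Matrix.of fun n i => (g i).coeff n
  have hker : LinearMap.ker M.mulVecLin ≠ ⊥ := by
    apply LinearMap.ker_ne_bot_of_finrank_lt
    simpa using hs
  obtain ⟨v, hv, hv0⟩ := (Submodule.ne_bot_iff _).1 hker
  obtain ⟨i, hi⟩ := Function.ne_iff.1 hv0
  refine ⟨fun i => if h : i ∈ s then v ⟨i, h⟩ else 0, ⟨i, i.2, by simpa using hi⟩, ?_⟩
  ext n
  rw [coeff_zero, finsetSum_coeff, ← sum_attach]
  simp only [coeff_C_mul, coe_mem, dite_true, Subtype.coe_eta]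
  by_cases hn : n < E
  · have := congrFun (LinearMap.mem_ker.1 hv) ⟨n, hn⟩
    simpa [M, Matrix.mulVec, dotProduct, mul_comm] using this
  · refine sum_eq_zero fun i _ => ?_
    rw [coeff_eq_zero_of_natDegree_lt ((hg i i.2).trans_le (not_lt.1 hn)), mul_zero]

/-- The truncated trace polynomial `∑_{s < M} X ^ (p ^ s)`. -/
noncomputable def tracePoly (F : Type*) [Field F] (p M : ℕ) : F[X] := ∑ s ∈ range M, X ^ p ^ s

theorem tracePoly_coeff_zero {p : ℕ} (hp : 2 ≤ p) (M : ℕ) : (tracePoly F p M).coeff 0 = 0 := by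
  rw [tracePoly, finsetSum_coeff]
  refine sum_eq_zero fun s _ => ?_
  rw [coeff_X_pow, if_neg]
  exact (pow_pos (by omega) s).ne

theorem tracePoly_coeff_one {p : ℕ} (hp : 2 ≤ p) {M : ℕ} (hM : 0 < M) :
    (tracePoly F p M).coeff 1 = 1 := by
  rw [tracePoly, finsetSum_coeff, sum_eq_single_of_mem 0 (mem_range.2 hM)]
  · simp
  · intro s _ hs
    rw [coeff_X_pow, if_neg]
    exact (Nat.one_lt_pow hs (by omega)).ne

theorem tracePoly_pow {p : ℕ} [Fact p.Prime] [CharP F p] (M : ℕ) :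
    tracePoly F p M ^ p = tracePoly F p M - X + X ^ p ^ M := by
  rw [tracePoly, sum_pow_char]
  have h1 := sum_range_succ (fun s => (X : F[X]) ^ p ^ s) M
  have h2 := sum_range_succ' (fun s => (X : F[X]) ^ p ^ s) M
  simp only [← pow_mul, ← pow_succ]
  rw [h1] at h2
  simp only [pow_zero, pow_one] at h2
  linear_combination -h2

theorem natDegree_tracePoly_mul_le {p : ℕ} (hp : 2 ≤ p) (M : ℕ) :
    (tracePoly F p M).natDegree * p ≤ p ^ M := by
  rcases M with _ | M
  · simp [tracePoly]
  · rw [pow_succ]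
    refine Nat.mul_le_mul_right _ (natDegree_sum_le_of_forall_le _ _ fun s hs => ?_)
    rw [natDegree_X_pow]
    exact Nat.pow_le_pow_right (by omega) (by simpa [Nat.lt_succ_iff] using hs)

theorem tracePoly_eval_pow {p : ℕ} [Fact p.Prime] [CharP F p] (M : ℕ) (x : F) :
    (tracePoly F p M).eval x ^ p ^ M =
      ∑ s ∈ range (M + M), x ^ p ^ s - (tracePoly F p M).eval x := by
  rw [sum_range_add, tracePoly, eval_finsetSum, sum_pow_char_pow]
  simp only [eval_pow, eval_X, ← pow_mul, ← pow_add]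
  rw [add_sub_cancel_left]
  exact sum_congr rfl fun s _ => by rw [add_comm]

theorem natDegree_sub_pow_le (t : F) (q : F[X]) (l : ℕ) :
    ((C t - q) ^ l).natDegree ≤ l * q.natDegree := by
  refine natDegree_pow_le.trans (Nat.mul_le_mul_left _ ?_)
  refine (natDegree_sub_le _ _).trans ?_
  simp

theorem stepanov_count_aux [IsAlgClosed F] {p : ℕ} [Fact p.Prime] [CharP F p] {d g' M : ℕ}
    (hd : 0 < d) (hM : 0 < M) (hg' : g' * d + 1 = p ^ M) {f : F[X]}
    (hf : f ≠ 0) (hfP : expand F (p ^ M) f = f ^ p ^ M)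
    (hgcd : ∀ e, (∀ r, f.IsRoot r → d ∣ e * f.rootMultiplicity r) → d ∣ e)
    {A I : ℕ} (hsize : 2 * d * (p * A + d * (f.natDegree * p)) < p ^ M)
    (hcount : p ^ M * (A + d * f.natDegree + 1) + I < A * I * d * p)
    (ζ t : F) (G : Finset F)
    (hG : ∀ x ∈ G, x ^ (p ^ M) ^ 2 = x ∧ f.eval x ^ (g' * (p ^ M + 1)) = ζ ∧
      ∑ s ∈ range (M + M), x ^ p ^ s = t) :
    G.card ≤ p ^ M * I + p ^ M * (2 * f.natDegree + 2) := by
  classical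
  have hp : 2 ≤ p := (Fact.out : p.Prime).two_le
  have hPpos : 0 < p ^ M := pow_pos (by omega) _
  set P := p ^ M with hPdef
  have hTd := natDegree_tracePoly_mul_le (F := F) hp M
  rw [← hPdef] at hTd
  have hlT : ∀ l < p, l * (tracePoly F p M).natDegree ≤ P := fun l hl =>
    (Nat.mul_le_mul_right _ hl.le).trans (by rwa [mul_comm])
  have hg'P : g' ≤ P := by nlinarith
  obtain ⟨κ, ⟨⟨a₀, i₀, j₀, l₀⟩, hmem₀, hne₀⟩, hκ⟩ := exists_linear_relation
    (range A ×ˢ range I ×ˢ range d ×ˢ range p)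
    (fun q => X ^ (P * q.1) * X ^ q.2.1 * (C ζ ^ q.2.2.1 * f ^ ((P - g') * q.2.2.1)) *
      (C t - tracePoly F p M) ^ q.2.2.2)
    (P * (A + d * f.natDegree + 1) + I) (by
      rintro ⟨a, i, j, l⟩ hq
      simp only [mem_product, mem_range] at hq
      obtain ⟨ha, hi, hj, hl⟩ := hq
      dsimp only
      have h1 := natDegree_sub_pow_le t (tracePoly F p M) l
      have h2 := hlT l hl
      have h3 : (C ζ ^ j * f ^ ((P - g') * j)).natDegree ≤ P * (d * f.natDegree) := by
        rw [← C_pow]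
        refine (natDegree_C_mul_le _ _).trans (natDegree_pow_le.trans ?_)
        rw [← mul_assoc]
        exact Nat.mul_le_mul_right _ (Nat.mul_le_mul (Nat.sub_le _ _) hj.le)
      have h4 : P * a ≤ P * A := Nat.mul_le_mul_left _ ha.le
      refine lt_of_le_of_lt (natDegree_mul_le_of_le (natDegree_mul_le_of_le
        (natDegree_mul_le_of_le (natDegree_X_pow_le _) (natDegree_X_pow_le _)) h3) (h1.trans h2)) ?_
      ring_nf at h4 ⊢
      omega)
    (by simpa [mul_assoc] using hcount)
  choose k hk using fun a i j l => IsAlgClosed.exists_pow_nat_eq (κ (a, i, j, l)) hPpos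
  let e := g' + 1
  let θ : F[X] := ∑ j ∈ range d, ∑ a ∈ range A, ∑ l ∈ range p, ∑ i ∈ range I,
      C (k a i j l) * X ^ a * X ^ (P * i) * f ^ (e * j) * tracePoly F p M ^ l
  have hθ0 : θ ≠ 0 := by
    intro h0
    simp only [mem_product, mem_range] at hmem₀
    have := stepanov_eq_zero hp hPpos hd (tracePoly_coeff_zero hp M)
      (by rw [tracePoly_coeff_one hp hM]; exact one_ne_zero) (tracePoly_pow M) hf hfP hgcd
      (e := e) (by simp only [e]; linarith) k hsize h0 a₀ hmem₀.1 i₀ hmem₀.2.1 j₀ hmem₀.2.2.1 l₀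
      hmem₀.2.2.2
    have h1 := hk a₀ i₀ j₀ l₀
    rw [this, zero_pow hPpos.ne'] at h1
    exact hne₀ h1.symm
  have hroot : ∀ x ∈ G, θ.eval x = 0 := by
    intro x hx
    obtain ⟨hx1, hx2, hx3⟩ := hG x hx
    have hT := tracePoly_eval_pow (p := p) M x
    rw [hx3] at hT
    have hV : (f.eval x ^ e) ^ P = ζ * f.eval x ^ (P - g') := by
      rw [← hx2, ← pow_mul, ← pow_add]
      congr 1
      simp only [e]
      zify [hg'P]; ring
    refine pow_eq_zero_iff hPpos.ne' |>.1 ?_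
    have h1 := congrArg (eval x) hκ
    rw [eval_zero, eval_finsetSum] at h1
    simp only [sum_product] at h1
    rw [← h1]
    simp only [θ, eval_finsetSum, hPdef, sum_pow_char_pow]
    rw [sum_comm]
    refine sum_congr rfl fun a _ => ?_
    have : ∀ j, ∑ l ∈ range p, ∑ i ∈ range I, eval x (C (k a i j l) * X ^ a * X ^ (p ^ M * i) *
        f ^ (e * j) * tracePoly F p M ^ l) ^ p ^ M = ∑ i ∈ range I, ∑ l ∈ range p,
        eval x (C (k a i j l) * X ^ a * X ^ (p ^ M * i) *
        f ^ (e * j) * tracePoly F p M ^ l) ^ p ^ M := fun j => sum_comm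
    rw [sum_congr rfl fun j _ => this j, sum_comm]
    refine sum_congr rfl fun i _ => sum_congr rfl fun j _ => sum_congr rfl fun l _ => ?_
    rw [← hPdef]
    simp only [eval_mul, eval_C, eval_pow, eval_X, eval_sub, mul_pow]
    rw [hk]
    have e1 : (x ^ a) ^ P = x ^ (P * a) := by rw [← pow_mul, mul_comm]
    have e2 : (x ^ (P * i)) ^ P = x ^ i := by
      rw [← pow_mul, show P * i * P = P ^ 2 * i by ring, pow_mul, hx1]
    have e3 : (f.eval x ^ (e * j)) ^ P = ζ ^ j * f.eval x ^ ((P - g') * j) := by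
      rw [pow_mul, ← pow_mul _ j, mul_comm j, pow_mul, hV, mul_pow, ← pow_mul]
    have e4 : ((tracePoly F p M).eval x ^ l) ^ P = (t - (tracePoly F p M).eval x) ^ l := by
      rw [← pow_mul, mul_comm, pow_mul, hT]
    rw [e1, e2, e3, e4]
    ring
  have hsub : G ⊆ θ.roots.toFinset := fun x hx => by
    rw [Multiset.mem_toFinset, mem_roots hθ0]
    exact hroot x hx
  refine (card_le_card hsub).trans ((Multiset.toFinset_card_le _).trans ((card_roots' θ).trans ?_))
  refine natDegree_sum_le_of_forall_le _ _ fun j hj => natDegree_sum_le_of_forall_le _ _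
    fun a ha => natDegree_sum_le_of_forall_le _ _ fun l hl => natDegree_sum_le_of_forall_le _ _
    fun i hi => ?_
  rw [mem_range] at hj ha hl hi
  have h1 : (f ^ (e * j)).natDegree ≤ 2 * P * f.natDegree := by
    refine natDegree_pow_le.trans (Nat.mul_le_mul_right _ ?_)
    have h2 : e * j ≤ e * d := Nat.mul_le_mul_left _ hj.le
    have h3 : d ≤ P := by
      have h5 : 0 < g' := by
        rcases Nat.eq_zero_or_pos g' with h | h
        · rw [h, zero_mul] at hg'
          have := Nat.one_lt_pow hM.ne' (by omega : 1 < p)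
          omega
        · exact h
      nlinarith
    have h4 : e * d = g' * d + d := by simp only [e]; ring
    omega
  have h2 : (tracePoly F p M ^ l).natDegree ≤ P := natDegree_pow_le.trans (hlT l hl)
  have h3 : A ≤ P := by
    refine le_trans ?_ hsize.le
    refine (Nat.le_mul_of_pos_left A (by positivity : 0 < 2 * d * p)).trans ?_
    rw [mul_assoc (2 * d) p A]
    exact Nat.mul_le_mul_left _ (Nat.le_add_right _ _)
  have h4 : P * i ≤ P * I := Nat.mul_le_mul_left _ hi.le
  refine (natDegree_mul_le_of_le (natDegree_mul_le_of_le (natDegree_mul_le_of_le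
    (natDegree_C_mul_X_pow_le _ _) (natDegree_X_pow_le _)) h1) h2).trans ?_
  ring_nf at h1 h2 h4 ⊢
  omega

/-- Stepanov's upper bound for the level sets of `f ^ ((Q - 1) / d)` and of the trace. -/
theorem stepanov_count [IsAlgClosed F] {p : ℕ} [Fact p.Prime] [CharP F p] {d : ℕ}
    (hd : 0 < d) (D : ℕ) : ∃ K P₀ : ℕ, ∀ (M g' : ℕ), P₀ ≤ p ^ M → g' * d + 1 = p ^ M →
    ∀ f : F[X], f ≠ 0 → f.natDegree ≤ D → expand F (p ^ M) f = f ^ p ^ M →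
    (∀ e, (∀ r, f.IsRoot r → d ∣ e * f.rootMultiplicity r) → d ∣ e) →
    ∀ (ζ t : F) (G : Finset F),
    (∀ x ∈ G, x ^ (p ^ M) ^ 2 = x ∧ f.eval x ^ (g' * (p ^ M + 1)) = ζ ∧
      ∑ s ∈ range (M + M), x ^ p ^ s = t) →
    G.card * (d * p) ≤ (p ^ M) ^ 2 + K * p ^ M := by
  have hp : 2 ≤ p := (Fact.out : p.Prime).two_le
  let c := 8 * (d * D + 4)
  refine ⟨d * p * (c + 1 + (2 * D + 2)), 8 * d ^ 2 * (D + 1) * p + c + 4 + 8 * d * p, ?_⟩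
  intro M g' hP₀ hg' f hf hfD hfP hgcd ζ t G hG
  have hM : 0 < M := by
    rcases Nat.eq_zero_or_pos M with h | h
    · rw [h, pow_zero] at hP₀; omega
    · exact h
  generalize hP : p ^ M = P at *
  have hdp : 0 < d * p := by positivity
  have hA1 := Nat.div_mul_le_self P (4 * (d * p))
  have hA2 := Nat.lt_div_mul_add (a := P) (b := 4 * (d * p)) (by positivity)
  have hI1 := Nat.div_mul_le_self P (d * p)
  have hI2 := Nat.lt_div_mul_add (a := P) (b := d * p) hdp
  generalize P / (4 * (d * p)) = A at *
  generalize P / (d * p) = I' at *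
  have hAD : d ^ 2 * f.natDegree * p ≤ d ^ 2 * D * p := by gcongr
  have hd2 : 0 < d ^ 2 * p := by positivity
  have hdD : d * f.natDegree ≤ d * D := by gcongr
  have hI'P : I' ≤ P := le_trans (Nat.le_mul_of_pos_right _ hdp) hI1
  have key := stepanov_count_aux hd hM (by rw [hP]; exact hg') hf (by rw [hP]; exact hfP) hgcd
    (A := A) (I := I' + 1 + c) (by rw [hP]; nlinarith)
    (by
      rw [hP]
      have h1 : P * (A + d * f.natDegree + 1) + (I' + 1 + c) ≤ A * P + P * (d * D + 3) := by
        nlinarith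
      have h2 : A * (P + c * (d * p)) ≤ A * (I' + 1 + c) * d * p := by
        have : A * (I' + 1 + c) * d * p = A * ((I' * (d * p) + d * p) + c * (d * p)) := by ring
        rw [this]
        gcongr
      have h3 : P ≤ 8 * (A * (d * p)) := by nlinarith
      have h4 : P * (d * D + 4) ≤ A * (c * (d * p)) := by
        have : A * (c * (d * p)) = 8 * (A * (d * p)) * (d * D + 4) := by simp only [c]; ring
        rw [this]; gcongr
      nlinarith)
    ζ t G (by rw [hP]; exact hG)
  rw [hP] at key
  have h5 : P * (I' + 1 + c) + P * (2 * f.natDegree + 2) ≤ P * I' + P * (c + 1 + (2 * D + 2)) := by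
    have : P * f.natDegree ≤ P * D := by gcongr
    nlinarith
  calc G.card * (d * p) ≤ (P * I' + P * (c + 1 + (2 * D + 2))) * (d * p) := by
        gcongr; exact key.trans h5
    _ = P * (I' * (d * p)) + d * p * (c + 1 + (2 * D + 2)) * P := by ring
    _ ≤ P ^ 2 + d * p * (c + 1 + (2 * D + 2)) * P := by rw [sq]; gcongr

end Count

section Frobenius

variable {p : ℕ} [Fact p.Prime]

/-- An algebraic closure of the prime field. -/
abbrev Kbar (p : ℕ) [Fact p.Prime] := AlgebraicClosure (ZMod p)

instance charP_Kbar : CharP (Kbar p) p := charP_of_injective_algebraMap' (ZMod p) p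

noncomputable instance decidableEq_Kbar : DecidableEq (Kbar p) := Classical.decEq _

theorem exists_algebraMap_eq {x : Kbar p} (hx : x ^ p = x) :
    ∃ a : ZMod p, algebraMap (ZMod p) (Kbar p) a = x := by
  have h := (Subfield.mem_bot_iff_pow_eq_self (F := Kbar p) (p := p)).2 hx
  rw [← ZMod.fieldRange_castHom_eq_bot p] at h
  obtain ⟨a, ha⟩ := h
  refine ⟨a, ?_⟩
  rw [← ha]
  exact congrFun (congrArg _ (Subsingleton.elim _ _)) a

theorem aeval_pow_char (f : (ZMod p)[X]) (x : Kbar p) (i : ℕ) :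
    aeval (x ^ p ^ i) f = aeval x f ^ p ^ i := by
  induction i with
  | zero => simp
  | succ i ih =>
    rw [pow_succ, pow_mul, pow_mul, ← ih, ← map_pow, ← ZMod.expand_card, expand_aeval]

theorem eq_pow_of_roots {m : (ZMod p)[X]} (hm : m.Monic) (hirr : Irreducible m) (n : ℕ) :
    ∀ c : (ZMod p)[X], c.natDegree ≤ n → c.Monic →
    (∀ y : Kbar p, aeval y c = 0 → aeval y m = 0) → ∃ k, c = m ^ k := by
  induction n with
  | zero =>
    intro c hc hcm _
    exact ⟨0, by rw [pow_zero]; exact hcm.natDegree_eq_zero.1 (by omega)⟩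
  | succ n ih =>
    intro c hc hcm hroot
    rcases Nat.eq_zero_or_pos c.natDegree with h0 | h0
    · exact ⟨0, by rw [pow_zero]; exact hcm.natDegree_eq_zero.1 h0⟩
    obtain ⟨y, hy⟩ := IsAlgClosed.exists_aeval_eq_zero (Kbar p) c
      (by rw [degree_eq_natDegree hcm.ne_zero]; exact_mod_cast h0.ne')
    have hdvd : m ∣ c := by
      rw [minpoly.eq_of_irreducible_of_monic hirr (hroot y hy) hm]
      exact minpoly.dvd _ _ hy
    obtain ⟨c', rfl⟩ := hdvd
    have hc'm : c'.Monic := hm.of_mul_monic_left hcm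
    rw [hm.natDegree_mul hc'm] at hc
    have := hirr.natDegree_pos
    obtain ⟨k, hk⟩ := ih c' (by omega) hc'm (fun y hy => hroot y (by rw [map_mul, hy, mul_zero]))
    exact ⟨k + 1, by rw [hk]; ring⟩

theorem exists_lift_conj {n : ℕ} {x : Kbar p} (hx : x ^ p ^ n = x) :
    ∃ g : (ZMod p)[X], g.Monic ∧
      g.map (algebraMap (ZMod p) (Kbar p)) = ∏ i ∈ range n, (X - C (x ^ p ^ i)) := by
  set q : (Kbar p)[X] := ∏ i ∈ range n, (X - C (x ^ p ^ i)) with hq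
  have hqm : q.Monic := monic_prod_of_monic _ _ fun i _ => monic_X_sub_C _
  have hfrob : q.map (frobenius (Kbar p) p) = q := by
    rw [hq, Polynomial.map_prod]
    have h1 := prod_range_succ (fun i => (X - C (x ^ p ^ i) : (Kbar p)[X])) n
    have h2 := prod_range_succ' (fun i => (X - C (x ^ p ^ i) : (Kbar p)[X])) n
    rw [h1, hx] at h2
    simp only [pow_zero, pow_one] at h2
    have h3 := mul_right_cancel₀ (X_sub_C_ne_zero x) h2
    rw [h3]
    refine prod_congr rfl fun i _ => ?_
    rw [Polynomial.map_sub, map_X, map_C, frobenius_def, ← pow_mul, ← pow_succ]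
  have hl : q ∈ lifts (algebraMap (ZMod p) (Kbar p)) := by
    rw [lifts_iff_coeff_lifts]
    intro j
    have h := congrArg (fun s => s.coeff j) hfrob
    simp only [coeff_map, frobenius_def] at h
    obtain ⟨a, ha⟩ := exists_algebraMap_eq h
    exact ⟨a, ha⟩
  obtain ⟨g, hg1, -, hg3⟩ := lifts_and_natDegree_eq_and_monic hl hqm
  exact ⟨g, hg3, hg1⟩

theorem minpoly_pow_spec {n : ℕ} {x : Kbar p} (hx : x ^ p ^ n = x) :
    (minpoly (ZMod p) x).natDegree ∣ n ∧
    (minpoly (ZMod p) x ^ (n / (minpoly (ZMod p) x).natDegree)).map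
      (algebraMap (ZMod p) (Kbar p)) = ∏ i ∈ range n, (X - C (x ^ p ^ i)) := by
  have hint : IsIntegral (ZMod p) x := Algebra.IsIntegral.isIntegral x
  have hirr := minpoly.irreducible hint
  obtain ⟨g, hg, hgm⟩ := exists_lift_conj hx
  obtain ⟨k, hk⟩ := eq_pow_of_roots (minpoly.monic hint) hirr g.natDegree g le_rfl hg (by
    intro y hy
    rw [← eval_map_algebraMap, hgm, eval_prod, prod_eq_zero_iff] at hy
    obtain ⟨i, -, hi⟩ := hy
    have : y = x ^ p ^ i := by simpa [sub_eq_zero] using hi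
    rw [this, aeval_pow_char, minpoly.aeval, zero_pow (pow_pos (Fact.out : p.Prime).pos i).ne'])
  have hdeg : g.natDegree = n := by
    rw [← natDegree_map (algebraMap (ZMod p) (Kbar p)), hgm, natDegree_prod_of_monic _ _
      (fun i _ => monic_X_sub_C _)]
    simp only [natDegree_X_sub_C, sum_const, card_range, smul_eq_mul, mul_one]
  have hkn : k * (minpoly (ZMod p) x).natDegree = n := by rw [← hdeg, hk, natDegree_pow]
  refine ⟨⟨k, by rw [← hkn, mul_comm]⟩, ?_⟩
  rw [← hgm, hk, ← hkn, Nat.mul_div_cancel _ hirr.natDegree_pos]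

theorem pow_char_eq_self_of_natDegree_dvd {n : ℕ} {x : Kbar p}
    (h : (minpoly (ZMod p) x).natDegree ∣ n) : x ^ p ^ n = x := by
  have hint : IsIntegral (ZMod p) x := Algebra.IsIntegral.isIntegral x
  have h1 := (Irreducible.natDegree_dvd_iff_dvd_X_pow_card_pow_sub_X (minpoly.irreducible hint)).1 h
  obtain ⟨q, hq⟩ := h1
  have h2 := congrArg (aeval x) hq
  simpa [sub_eq_zero] using h2

theorem separable_minpoly (x : Kbar p) : (minpoly (ZMod p) x).Separable :=
  PerfectField.separable_of_irreducible (minpoly.irreducible (Algebra.IsIntegral.isIntegral x))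

variable (p) in
/-- The subfield with `p ^ n` elements, as a finite set. -/
noncomputable def fixedSet (n : ℕ) : Finset (Kbar p) :=
  (X ^ p ^ n - X : (Kbar p)[X]).roots.toFinset

theorem mem_fixedSet {n : ℕ} (hn : n ≠ 0) {x : Kbar p} : x ∈ fixedSet p n ↔ x ^ p ^ n = x := by
  have h0 := FiniteField.X_pow_card_pow_sub_X_ne_zero (Kbar p) hn (Fact.out : p.Prime).one_lt
  rw [fixedSet, Multiset.mem_toFinset, mem_roots h0]
  simp [sub_eq_zero]

theorem card_fixedSet {n : ℕ} (hn : n ≠ 0) : (fixedSet p n).card = p ^ n := by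
  have hsep : (X ^ p ^ n - X : (Kbar p)[X]).Separable :=
    galois_poly_separable p _ (dvd_pow_self p hn)
  rw [fixedSet, Multiset.toFinset_card_of_nodup (nodup_roots hsep),
    ← (IsAlgClosed.splits _).natDegree_eq_card_roots,
    FiniteField.X_pow_card_pow_sub_X_natDegree_eq _ hn (Fact.out : p.Prime).one_lt]

/-- The norm of `b` modulo the monic polynomial `f`. -/
noncomputable def nrm (f b : (ZMod p)[X]) : ZMod p := resultant f b

theorem algebraMap_nrm {f : (ZMod p)[X]} (hf : f.Monic) (b : (ZMod p)[X]) :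
    algebraMap (ZMod p) (Kbar p) (nrm f b) = ((f.aroots (Kbar p)).map fun r => aeval r b).prod := by
  have hinj := (algebraMap (ZMod p) (Kbar p)).injective
  have h1 := resultant_map_map f b f.natDegree b.natDegree (algebraMap (ZMod p) (Kbar p))
  have h2 := resultant_eq_prod_eval (f.map (algebraMap (ZMod p) (Kbar p)))
    (b.map (algebraMap (ZMod p) (Kbar p))) b.natDegree (by simp) (IsAlgClosed.splits _)
  rw [natDegree_map, h1] at h2
  rw [nrm, h2, (hf.map _).leadingCoeff, one_pow, one_mul, aroots_def]
  congr 1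
  refine Multiset.map_congr rfl fun r _ => ?_
  rw [eval_map_algebraMap]

theorem nrm_mul {f : (ZMod p)[X]} (hf : f.Monic) (b c : (ZMod p)[X]) :
    nrm f (b * c) = nrm f b * nrm f c := by
  apply (algebraMap (ZMod p) (Kbar p)).injective
  rw [map_mul, algebraMap_nrm hf, algebraMap_nrm hf, algebraMap_nrm hf, ← Multiset.prod_map_mul]
  simp

theorem nrm_congr {f : (ZMod p)[X]} (hf : f.Monic) {b c : (ZMod p)[X]}
    (h : ∀ r : Kbar p, aeval r f = 0 → aeval r b = aeval r c) : nrm f b = nrm f c := by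
  apply (algebraMap (ZMod p) (Kbar p)).injective
  rw [algebraMap_nrm hf, algebraMap_nrm hf]
  congr 1
  refine Multiset.map_congr rfl fun r hr => h r ?_
  exact (mem_aroots.1 hr).2

theorem nrm_one {f : (ZMod p)[X]} (hf : f.Monic) : nrm f 1 = 1 := by
  apply (algebraMap (ZMod p) (Kbar p)).injective
  rw [algebraMap_nrm hf]; simp

end Frobenius

section Averaging

theorem norm_sum_le_of_card_le {α ι : Type*} [DecidableEq ι] (s : Finset α) (w : α → ι)
    (c : ι → ℂ) (hc : ∀ i, ‖c i‖ ≤ 1) (W : Finset ι) {B E D : ℝ} (hE : 0 ≤ E)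
    (hW0 : ∀ x ∈ s, w x ∉ W → c (w x) = 0) (hsum : ∑ i ∈ W, c i = 0)
    (hcard : ∀ i ∈ W, (#{x ∈ s | w x = i} : ℝ) ≤ B + E) (hB : #W * B ≤ #s)
    (hD : (#{x ∈ s | w x ∉ W} : ℝ) ≤ D) :
    ‖∑ x ∈ s, c (w x)‖ ≤ 2 * #W * E + D := by
  have h1 : ∑ x ∈ s, c (w x) = ∑ i ∈ W, ((#{x ∈ s | w x = i} : ℝ) : ℂ) * c i := by
    rw [← sum_filter_of_ne (p := fun x => w x ∈ W)
      (fun x hx hne => by by_contra h; exact hne (hW0 x hx h)),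
      ← sum_fiberwise_of_maps_to (s := {x ∈ s | w x ∈ W}) (t := W) (g := w)
        (fun x hx => (mem_filter.1 hx).2)]
    refine sum_congr rfl fun i hi => ?_
    have h2 : {x ∈ {x ∈ s | w x ∈ W} | w x = i} = {x ∈ s | w x = i} := by
      ext x
      simp only [mem_filter]
      constructor
      · rintro ⟨⟨h, -⟩, h'⟩; exact ⟨h, h'⟩
      · rintro ⟨h, rfl⟩; exact ⟨⟨h, hi⟩, rfl⟩
    rw [h2, sum_congr rfl (g := fun _ => c i) (fun x hx => by rw [(mem_filter.1 hx).2])]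
    simp
  have h2 : ∑ x ∈ s, c (w x) = ∑ i ∈ W, ((#{x ∈ s | w x = i} - B : ℝ) : ℂ) * c i := by
    rw [h1]
    simp only [Complex.ofReal_sub, sub_mul, sum_sub_distrib, ← mul_sum, hsum, mul_zero, sub_zero]
  have h3 : (#s : ℝ) = ∑ i ∈ W, (#{x ∈ s | w x = i} : ℝ) + #{x ∈ s | w x ∉ W} := by
    rw [← card_filter_add_card_filter_not (s := s) (fun x => w x ∈ W),
      card_eq_sum_card_fiberwise (s := {x ∈ s | w x ∈ W}) (t := W) (f := w)
        (fun x hx => (mem_filter.1 hx).2)]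
    push_cast
    congr 1
    refine sum_congr rfl fun i hi => ?_
    congr 2
    ext x
    simp only [mem_filter]
    constructor
    · rintro ⟨⟨h, -⟩, h'⟩; exact ⟨h, h'⟩
    · rintro ⟨h, rfl⟩; exact ⟨⟨h, hi⟩, rfl⟩
  rw [h2]
  refine (norm_sum_le _ _).trans ?_
  have h4 : ∀ i ∈ W, ‖((#{x ∈ s | w x = i} - B : ℝ) : ℂ) * c i‖
      ≤ 2 * E - ((#{x ∈ s | w x = i} : ℝ) - B) := by
    intro i hi
    rw [norm_mul, Complex.norm_real, Real.norm_eq_abs]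
    have h5 : |(#{x ∈ s | w x = i} : ℝ) - B| ≤ 2 * E - ((#{x ∈ s | w x = i} : ℝ) - B) := by
      have := hcard i hi
      rw [abs_le]; constructor <;> linarith
    calc _ ≤ |(#{x ∈ s | w x = i} : ℝ) - B| * 1 := by gcongr; exact hc i
      _ ≤ _ := by rwa [mul_one]
  refine (sum_le_sum h4).trans ?_
  simp only [sum_sub_distrib, sum_const, nsmul_eq_mul]
  nlinarith

end Averaging

section SumBound

variable {p : ℕ} [Fact p.Prime]

/-- The completely multiplicative function on monic polynomials attached to `χ`, `ψ`, `f`. -/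
noncomputable def lam (χ : MulChar (ZMod p) ℂ) (ψ : AddChar (ZMod p) ℂ) (f g : (ZMod p)[X]) : ℂ :=
  χ (nrm f g) * ψ (-g.nextCoeff)

theorem lam_one (χ : MulChar (ZMod p) ℂ) (ψ : AddChar (ZMod p) ℂ) {f : (ZMod p)[X]}
    (hf : f.Monic) : lam χ ψ f 1 = 1 := by
  simp [lam, nrm_one hf, nextCoeff]

theorem lam_mul (χ : MulChar (ZMod p) ℂ) (ψ : AddChar (ZMod p) ℂ) {f g h : (ZMod p)[X]}
    (hf : f.Monic) (hg : g.Monic) (hh : h.Monic) :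
    lam χ ψ f (g * h) = lam χ ψ f g * lam χ ψ f h := by
  rw [lam, lam, lam, nrm_mul hf, Monic.nextCoeff_mul hg hh, neg_add, AddChar.map_add_eq_mul,
    map_mul]
  ring

theorem lam_pow (χ : MulChar (ZMod p) ℂ) (ψ : AddChar (ZMod p) ℂ) {f g : (ZMod p)[X]}
    (hf : f.Monic) (hg : g.Monic) (k : ℕ) :
    lam χ ψ f (g ^ k) = lam χ ψ f g ^ k := by
  induction k with
  | zero => simp [lam_one χ ψ hf]
  | succ k ih => rw [pow_succ, lam_mul χ ψ hf (hg.pow k) hg, ih, pow_succ]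

/-- The character sum over the field with `p ^ n` elements. -/
noncomputable def fieldSum (χ : MulChar (ZMod p) ℂ) (ψ : AddChar (ZMod p) ℂ) (f : (ZMod p)[X])
    (n : ℕ) : ℂ :=
  ∑ x ∈ fixedSet p n,
    lam χ ψ f (minpoly (ZMod p) x) ^ (n / (minpoly (ZMod p) x).natDegree)

/-- The power of the minimal polynomial of `x` which has degree `n`. -/
noncomputable def conjPoly (n : ℕ) (x : Kbar p) : (ZMod p)[X] :=
  minpoly (ZMod p) x ^ (n / (minpoly (ZMod p) x).natDegree)

theorem monic_minpoly (x : Kbar p) : (minpoly (ZMod p) x).Monic :=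
  minpoly.monic (Algebra.IsIntegral.isIntegral x)

theorem fieldSum_eq (χ : MulChar (ZMod p) ℂ) (ψ : AddChar (ZMod p) ℂ) {f : (ZMod p)[X]}
    (hf : f.Monic) (n : ℕ) : fieldSum χ ψ f n =
      ∑ x ∈ fixedSet p n, χ (nrm f (conjPoly n x)) * ψ (-(conjPoly n x).nextCoeff) := by
  refine sum_congr rfl fun x _ => ?_
  rw [← lam_pow χ ψ hf (monic_minpoly x)]
  rfl

theorem algebraMap_neg_nextCoeff_conjPoly {n : ℕ} {x : Kbar p} (hx : x ^ p ^ n = x) :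
    algebraMap (ZMod p) (Kbar p) (-(conjPoly n x).nextCoeff) = ∑ i ∈ range n, x ^ p ^ i := by
  rw [map_neg, ← nextCoeff_map_eq, conjPoly, (minpoly_pow_spec hx).2, prod_X_sub_C_nextCoeff,
    neg_neg]

theorem prod_root_sub {f : (ZMod p)[X]} (hf : f.Monic) (y : Kbar p) :
    ((f.aroots (Kbar p)).map fun r => r - y).prod = (-1) ^ f.natDegree * aeval y f := by
  have h := (IsAlgClosed.splits (f.map (algebraMap (ZMod p) (Kbar p)))).eq_prod_roots_of_monic
    (hf.map _)
  have hc := (IsAlgClosed.splits (f.map (algebraMap (ZMod p) (Kbar p)))).natDegree_eq_card_roots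
  rw [natDegree_map, ← aroots_def] at hc
  rw [← eval_map_algebraMap, h, eval_multiset_prod, Multiset.map_map, ← aroots_def, hc]
  generalize f.aroots (Kbar p) = s
  induction s using Multiset.induction_on with
  | empty => simp
  | cons a s ih =>
    simp only [Multiset.map_cons, Multiset.prod_cons, Multiset.card_cons, ih, Function.comp,
      eval_sub, eval_X, eval_C]
    ring

theorem algebraMap_nrm_conjPoly {f : (ZMod p)[X]} (hf : f.Monic) {M : ℕ} {x : Kbar p}
    (hx : x ^ p ^ (M + M) = x) :
    algebraMap (ZMod p) (Kbar p) (nrm f (conjPoly (M + M) x)) =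
      aeval x f ^ ∑ i ∈ range (M + M), p ^ i := by
  rw [algebraMap_nrm hf]
  have h1 : ∀ r : Kbar p, aeval r (conjPoly (M + M) x) =
      ∏ i ∈ range (M + M), (r - x ^ p ^ i) := fun r => by
    rw [← eval_map_algebraMap, conjPoly, (minpoly_pow_spec hx).2, eval_prod]
    simp
  simp only [h1]
  rw [Multiset.prod_map_prod]
  simp only [prod_root_sub hf, prod_mul_distrib, prod_const, card_range, aeval_pow_char,
    prod_pow_eq_pow_sum]
  rw [← two_mul, ← pow_mul, mul_left_comm, pow_mul]
  simp

theorem exists_root_factor {f : (ZMod p)[X]} (hf : f.Monic) {δ : ℕ} (hδ : 0 < δ)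
    (h : ∀ r, δ ∣ (f.aroots (Kbar p)).count r) :
    ∃ F : (Kbar p)[X], F ≠ 0 ∧ F.natDegree ≤ f.natDegree ∧
      F ^ δ = f.map (algebraMap (ZMod p) (Kbar p)) ∧
      (∀ r, δ * F.rootMultiplicity r = (f.aroots (Kbar p)).count r) ∧
      ∀ N, (∀ r : Kbar p, aeval r f = 0 → r ^ p ^ N = r) →
        expand (Kbar p) (p ^ N) F = F ^ p ^ N := by
  set s := f.aroots (Kbar p) with hs
  set F : (Kbar p)[X] := ∏ r ∈ s.toFinset, (X - C r) ^ (s.count r / δ) with hF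
  have hF0 : F ≠ 0 := prod_ne_zero_iff.2 fun r _ => pow_ne_zero _ (X_sub_C_ne_zero r)
  have hpow : F ^ δ = f.map (algebraMap (ZMod p) (Kbar p)) := by
    rw [(IsAlgClosed.splits (f.map (algebraMap (ZMod p) (Kbar p)))).eq_prod_roots_of_monic
      (hf.map _), ← aroots_def, ← hs, prod_multiset_map_count, hF, ← prod_pow]
    refine prod_congr rfl fun r _ => ?_
    rw [← pow_mul, Nat.div_mul_cancel (h r)]
  refine ⟨F, hF0, ?_, hpow, fun r => ?_, fun N hN => ?_⟩
  · rw [← natDegree_map (algebraMap (ZMod p) (Kbar p)) (p := f), ← hpow, natDegree_pow]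
    exact Nat.le_mul_of_pos_left _ hδ
  · rw [hs, aroots_def, ← hpow, roots_pow, Multiset.count_nsmul, count_roots]
  · rw [hF, map_prod, ← prod_pow]
    refine prod_congr rfl fun r hr => ?_
    have hr' : r ^ p ^ N = r := hN r (mem_aroots.1 (Multiset.mem_toFinset.1 hr)).2
    rw [map_pow, map_sub, expand_X, expand_C, ← pow_mul, mul_comm, pow_mul, sub_pow_char_pow,
      ← C_pow, hr']

theorem exists_pow_char_eq_self (f : (ZMod p)[X]) (hf : f ≠ 0) :
    ∃ M₀, 0 < M₀ ∧ ∀ j, ∀ r : Kbar p, aeval r f = 0 → r ^ p ^ (M₀ * j) = r := by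
  refine ⟨∏ r ∈ (f.aroots (Kbar p)).toFinset, (minpoly (ZMod p) r).natDegree,
    prod_pos fun r _ => minpoly.natDegree_pos (Algebra.IsIntegral.isIntegral r),
    fun j r hr => pow_char_eq_self_of_natDegree_dvd (Dvd.dvd.mul_right ?_ j)⟩
  exact dvd_prod_of_mem _ (Multiset.mem_toFinset.2 (mem_aroots.2 ⟨hf, hr⟩))

theorem sum_mulChar_eq_zero (χ : MulChar (ZMod p) ℂ) {d δ : ℕ} (hd : δ * d = p - 1)
    (hχ : χ ^ δ ≠ 1) : ∑ a : ZMod p with a ^ d = 1, χ a = 0 := by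
  obtain ⟨y, hy⟩ : ∃ y : (ZMod p)ˣ, χ ((y : ZMod p) ^ δ) ≠ 1 := by
    by_contra! h
    refine hχ (MulChar.ext fun y => ?_)
    rw [MulChar.pow_apply_coe, ← map_pow, h y, MulChar.one_apply_coe]
  have hb : ((y : ZMod p) ^ δ) ^ d = 1 := by
    rw [← pow_mul, hd]; exact ZMod.pow_card_sub_one_eq_one y.ne_zero
  have h : χ ((y : ZMod p) ^ δ) * ∑ a : ZMod p with a ^ d = 1, χ a =
      ∑ a : ZMod p with a ^ d = 1, χ a := by
    rw [mul_sum]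
    refine sum_bij (fun a _ => (y : ZMod p) ^ δ * a) ?_ ?_ ?_ ?_
    · intro a ha
      simp only [mem_filter, mem_univ, true_and] at ha ⊢
      rw [mul_pow, hb, ha, one_mul]
    · intro a _ b _ hab
      exact mul_left_cancel₀ (pow_ne_zero _ y.ne_zero) hab
    · intro b hb'
      simp only [mem_filter, mem_univ, true_and] at hb'
      refine ⟨((y : ZMod p) ^ δ)⁻¹ * b, ?_, ?_⟩
      · simp only [mem_filter, mem_univ, true_and]
        rw [mul_pow, inv_pow, hb, hb', inv_one, one_mul]
      · exact mul_inv_cancel_left₀ (pow_ne_zero _ y.ne_zero) b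
    · intro a _
      rw [map_mul]
  have h2 : (χ ((y : ZMod p) ^ δ) - 1) * ∑ a : ZMod p with a ^ d = 1, χ a = 0 := by
    rw [sub_mul, h, one_mul, sub_self]
  exact (mul_eq_zero.1 h2).resolve_left (sub_ne_zero.2 hy)

theorem fieldSum_bound (χ : MulChar (ZMod p) ℂ) (ψ : AddChar (ZMod p) ℂ) {f : (ZMod p)[X]}
    (hf : f.Monic) (hχ : ∃ r : Kbar p, χ ^ (f.aroots (Kbar p)).count r ≠ 1) :
    ∃ C : ℝ, ∃ M₀ N₀ : ℕ, 0 < M₀ ∧ ∀ j ≥ N₀,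
      ‖fieldSum χ ψ f (M₀ * j + M₀ * j)‖ ≤ C * (p : ℝ) ^ (M₀ * j) := by
  have hp := (Fact.out : p.Prime)
  set s := f.aroots (Kbar p) with hs
  set δ := Nat.gcd (p - 1) (s.toFinset.gcd fun r => s.count r) with hδ
  have hp1 : 0 < p - 1 := Nat.sub_pos_of_lt hp.one_lt
  have hδ0 : 0 < δ := Nat.gcd_pos_of_pos_left _ hp1
  have hδdvd : ∀ r, δ ∣ s.count r := by
    intro r
    by_cases hr : r ∈ s
    · exact (Nat.gcd_dvd_right _ _).trans (Finset.gcd_dvd (Multiset.mem_toFinset.2 hr))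
    · rw [Multiset.count_eq_zero_of_notMem hr]; exact dvd_zero _
  obtain ⟨d, hd⟩ : δ ∣ p - 1 := Nat.gcd_dvd_left _ _
  have hd0 : 0 < d := Nat.pos_of_ne_zero fun h => by rw [h, mul_zero] at hd; omega
  obtain ⟨F, hF0, hFdeg, hFpow, hFmult, hFexp⟩ := exists_root_factor hf hδ0 hδdvd
  obtain ⟨M₀, hM₀, hfix⟩ := exists_pow_char_eq_self f hf.ne_zero
  obtain ⟨K, P₀, hst⟩ := stepanov_count (F := Kbar p) (p := p) hd0 f.natDegree
  refine ⟨2 * K + f.natDegree, M₀, P₀ + 1, hM₀, fun j hj => ?_⟩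
  set M := M₀ * j with hM
  have hMj : j ≤ M := Nat.le_mul_of_pos_left _ hM₀
  have hMne : M + M ≠ 0 := by omega
  have hP₀ : P₀ ≤ p ^ M := by
    have : M < p ^ M := Nat.lt_pow_self hp.one_lt
    omega
  have hPpos : 0 < p ^ M := pow_pos hp.pos _
  obtain ⟨g', hg'⟩ : d ∣ p ^ M - 1 :=
    (Dvd.intro_left δ hd.symm).trans (by simpa using Nat.sub_dvd_pow_sub_pow p 1 M)
  have hgP : g' * d + 1 = p ^ M := by rw [mul_comm, ← hg']; omega
  have hstep := hst M g' hP₀ hgP F hF0 hFdeg (hFexp M (fun r hr => hfix j r hr)) (by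
    intro e he
    have h1 : ∀ r ∈ s.toFinset, (p - 1) ∣ e * s.count r := by
      intro r hr
      have hr' := (mem_aroots.1 (Multiset.mem_toFinset.1 hr)).2
      have hroot : F.IsRoot r := by
        have h := congrArg (eval r) hFpow
        rw [eval_map_algebraMap, hr', eval_pow] at h
        exact eq_zero_of_pow_eq_zero h
      rw [← hFmult r, hd, mul_left_comm]
      exact Nat.mul_dvd_mul_left _ (he r hroot)
    have h2 : (p - 1) ∣ e * s.toFinset.gcd fun r => s.count r := by
      have := Finset.dvd_gcd h1
      rwa [Finset.gcd_mul_left, normalize_eq] at this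
    have h3 : (p - 1) ∣ e * δ := by
      rw [hδ, ← Nat.gcd_mul_left]
      exact Nat.dvd_gcd (dvd_mul_left _ _) h2
    rw [hd, mul_comm e] at h3
    exact Nat.dvd_of_mul_dvd_mul_left hδ0 h3)
  have hexp : δ * ∑ i ∈ range (M + M), p ^ i = g' * (p ^ M + 1) := by
    have h1 := Nat.geomSum_eq hp.two_le (M + M)
    have h2 : (p - 1) ∣ p ^ (M + M) - 1 := by simpa using Nat.sub_dvd_pow_sub_pow p 1 (M + M)
    have h3 : (p - 1) * ∑ i ∈ range (M + M), p ^ i = p ^ (M + M) - 1 := by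
      rw [h1, Nat.mul_div_cancel' h2]
    have h4 : p ^ (M + M) - 1 = d * (g' * (p ^ M + 1)) := by
      rw [pow_add, ← hgP]
      have h5 : 0 < (g' * d + 1) * (g' * d + 1) := by positivity
      rw [Nat.sub_eq_iff_eq_add h5]
      ring
    rw [h4, hd, mul_comm δ, mul_assoc] at h3
    exact Nat.eq_of_mul_eq_mul_left hd0 h3
  have haev : ∀ x : Kbar p, aeval x f = F.eval x ^ δ := fun x => by
    rw [← eval_pow, hFpow, eval_map_algebraMap]
  have hnrm : ∀ x ∈ fixedSet p (M + M), algebraMap (ZMod p) (Kbar p)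
      (nrm f (conjPoly (M + M) x)) = F.eval x ^ (g' * (p ^ M + 1)) := fun x hx => by
    rw [algebraMap_nrm_conjPoly hf ((mem_fixedSet hMne).1 hx), haev, ← pow_mul, hexp]
  set w : Kbar p → ZMod p × ZMod p := fun x =>
    (nrm f (conjPoly (M + M) x), -(conjPoly (M + M) x).nextCoeff) with hw
  set W : Finset (ZMod p × ZMod p) := ({a : ZMod p | a ^ d = 1} : Finset (ZMod p)) ×ˢ univ with hW
  have hzero : ∀ x ∈ fixedSet p (M + M), w x ∉ W → nrm f (conjPoly (M + M) x) = 0 := by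
    intro x hx hxW
    by_contra hne
    refine hxW ?_
    rw [hW, mem_product]
    refine ⟨?_, mem_univ _⟩
    simp only [hw, mem_filter, mem_univ, true_and]
    have hne' : F.eval x ≠ 0 := by
      intro h0
      apply hne
      apply (algebraMap (ZMod p) (Kbar p)).injective
      rw [hnrm x hx, h0, map_zero, zero_pow]
      rw [← hexp]
      refine mul_ne_zero hδ0.ne' (ne_of_gt ?_)
      exact sum_pos (fun i _ => pow_pos hp.pos i) ⟨0, by simp; omega⟩
    apply (algebraMap (ZMod p) (Kbar p)).injective
    rw [map_pow, hnrm x hx, map_one, ← pow_mul]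
    have hfr : ∀ y : Kbar p, F.eval y ^ p ^ M = F.eval (y ^ p ^ M) := fun y => by
      rw [← eval_pow, ← hFexp M (fun r hr => hfix j r hr), expand_eval]
    have h5 : F.eval x ^ (p ^ M * p ^ M) = F.eval x := by
      rw [pow_mul, hfr, hfr, ← pow_mul, ← pow_add, (mem_fixedSet hMne).1 hx]
    have h6 : p ^ M * p ^ M = g' * (p ^ M + 1) * d + 1 := by rw [← hgP]; ring
    rw [h6, pow_succ] at h5
    exact mul_right_cancel₀ hne' (by rw [h5, one_mul])
  have hcardW : (#W : ℝ) ≤ d * p := by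
    rw [hW, card_product, card_univ, ZMod.card]
    push_cast
    gcongr
    have : ({a : ZMod p | a ^ d = 1} : Finset (ZMod p)) ⊆ (nthRoots d (1 : ZMod p)).toFinset := by
      intro a ha
      rw [Multiset.mem_toFinset, mem_nthRoots hd0]
      exact (mem_filter.1 ha).2
    exact_mod_cast (card_le_card this).trans
      ((Multiset.toFinset_card_le _).trans (card_nthRoots d _))
  have hdp : (0 : ℝ) < d * p := by have := hp.pos; positivity
  have hQ : (#(fixedSet p (M + M)) : ℝ) = ((p : ℝ) ^ M) ^ 2 := by
    rw [card_fixedSet hMne]; push_cast; ring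
  rw [fieldSum_eq χ ψ hf]
  have hmain := norm_sum_le_of_card_le (fixedSet p (M + M)) w (fun i => χ i.1 * ψ i.2)
    (fun i => by
      rw [norm_mul, AddChar.norm_apply, mul_one]
      exact DirichletCharacter.norm_le_one χ i.1) W
    (B := ((p : ℝ) ^ M) ^ 2 / (d * p)) (E := K * (p : ℝ) ^ M / (d * p)) (D := f.natDegree)
    (by positivity)
    (fun x hx hxW => by
      show χ (nrm f (conjPoly (M + M) x)) * _ = 0
      rw [hzero x hx hxW, MulChar.map_zero, zero_mul])
    (by
      rw [hW, sum_product]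
      simp only [← mul_sum, ← sum_mul]
      rw [sum_mulChar_eq_zero χ hd.symm, zero_mul]
      intro h1
      obtain ⟨r, hr⟩ := hχ
      obtain ⟨e, he⟩ := hδdvd r
      exact hr (by rw [he, pow_mul, h1, one_pow]))
    (by
      intro i hi
      have h := hstep (algebraMap _ _ i.1) (algebraMap _ _ i.2)
        {x ∈ fixedSet p (M + M) | w x = i} (by
          intro x hx
          obtain ⟨hx1, hx2⟩ := mem_filter.1 hx
          have hxf := (mem_fixedSet hMne).1 hx1
          refine ⟨by rw [← pow_mul, mul_two]; exact hxf, ?_, ?_⟩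
          · rw [← hnrm x hx1, ← hx2]
          · rw [← algebraMap_neg_nextCoeff_conjPoly hxf, ← hx2])
      rw [← add_div, le_div_iff₀ hdp]
      exact_mod_cast h)
    (by
      rw [hQ, mul_div_assoc', div_le_iff₀ hdp, mul_comm (((p : ℝ) ^ M) ^ 2)]
      gcongr)
    (by
      have : {x ∈ fixedSet p (M + M) | w x ∉ W} ⊆ s.toFinset := by
        intro x hx
        obtain ⟨hx1, hx2⟩ := mem_filter.1 hx
        have h := hzero x hx1 hx2
        have h' := algebraMap_nrm_conjPoly hf ((mem_fixedSet hMne).1 hx1)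
        rw [h, map_zero] at h'
        exact Multiset.mem_toFinset.2 (mem_aroots.2 ⟨hf.ne_zero, eq_zero_of_pow_eq_zero h'.symm⟩)
      have h2 : s.card ≤ f.natDegree := by
        rw [hs, aroots_def]
        exact (card_roots' _).trans natDegree_map_le
      exact_mod_cast (card_le_card this).trans ((Multiset.toFinset_card_le _).trans h2))
  refine hmain.trans ?_
  have hP1 : (1 : ℝ) ≤ (p : ℝ) ^ M := one_le_pow₀ (by exact_mod_cast hp.one_lt.le)
  have h1 : 2 * (#W : ℝ) * (K * (p : ℝ) ^ M / (d * p)) ≤ 2 * K * (p : ℝ) ^ M := by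
    calc 2 * (#W : ℝ) * (K * (p : ℝ) ^ M / (d * p))
        ≤ 2 * (d * p) * (K * (p : ℝ) ^ M / (d * p)) := by gcongr
      _ = _ := by rw [mul_assoc, mul_div_cancel₀ _ hdp.ne', ← mul_assoc]
  have h2 : (f.natDegree : ℝ) ≤ f.natDegree * (p : ℝ) ^ M :=
    le_mul_of_one_le_right (Nat.cast_nonneg _) hP1
  linarith

end SumBound

section PowerSums

theorem norm_le_of_power_sum_le {ι : Type*} [Fintype ι] (w : ι → ℂ) {B A : ℝ} (hB : 0 < B)
    {N : ℕ} (h : ∀ j ≥ N, ‖∑ i, w i ^ j‖ ≤ A * B ^ j) (i₀ : ι) : ‖w i₀‖ ≤ B := by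
  classical
  set v := w i₀ with hv
  set q : ℂ[X] := ∏ y ∈ (univ.image w).erase v, (X - C y) with hq
  have hq0 : q.eval v ≠ 0 := by
    rw [hq, eval_prod, prod_ne_zero_iff]
    intro y hy
    simpa [sub_eq_zero] using (ne_of_mem_erase hy).symm
  have hqw : ∀ i, w i ≠ v → q.eval (w i) = 0 := by
    intro i hi
    rw [hq, eval_prod, prod_eq_zero_iff]
    exact ⟨w i, mem_erase.2 ⟨hi, mem_image_of_mem _ (mem_univ i)⟩, by simp⟩
  set c := #{i | w i = v} with hc
  have hc0 : 0 < c := card_pos.2 ⟨i₀, by simp [hv]⟩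
  have hkey : ∀ j, ∑ k ∈ range (q.natDegree + 1), q.coeff k * ∑ i, w i ^ (j + k) =
      c * (q.eval v * v ^ j) := by
    intro j
    simp only [mul_sum]
    rw [sum_comm]
    have h1 : ∀ i, ∑ k ∈ range (q.natDegree + 1), q.coeff k * w i ^ (j + k) =
        q.eval (w i) * w i ^ j := fun i => by
      rw [eval_eq_sum_range, sum_mul]
      refine sum_congr rfl fun k _ => ?_
      ring
    simp only [h1]
    rw [← sum_filter_of_ne (p := fun i => w i = v) (fun i _ hi => by
      by_contra hne; exact hi (by rw [hqw i hne, zero_mul])),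
      sum_congr rfl (g := fun _ => q.eval v * v ^ j) (fun i hi => by rw [(mem_filter.1 hi).2])]
    simp [hc]
  set A' : ℝ := ∑ k ∈ range (q.natDegree + 1), ‖q.coeff k‖ * (A * B ^ k) with hA'
  have hbd : ∀ j ≥ N, ‖q.eval v‖ * ‖v‖ ^ j ≤ A' * B ^ j := by
    intro j hj
    have h1 : (c : ℝ) * (‖q.eval v‖ * ‖v‖ ^ j) ≤ A' * B ^ j := by
      have h2 : (c : ℝ) * (‖q.eval v‖ * ‖v‖ ^ j) =
          ‖∑ k ∈ range (q.natDegree + 1), q.coeff k * ∑ i, w i ^ (j + k)‖ := by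
        rw [hkey j]; simp
      rw [h2, hA', sum_mul]
      refine (norm_sum_le _ _).trans (sum_le_sum fun k _ => ?_)
      rw [norm_mul, mul_assoc]
      gcongr
      refine (h (j + k) (by omega)).trans (le_of_eq ?_)
      ring
    refine le_trans ?_ h1
    exact le_mul_of_one_le_left (by positivity) (by exact_mod_cast hc0)
  by_contra! hlt
  have hratio : 1 < ‖v‖ / B := (one_lt_div hB).2 hlt
  have hq0' : 0 < ‖q.eval v‖ := norm_pos_iff.2 hq0
  obtain ⟨j, hj⟩ := pow_unbounded_of_one_lt (A' / ‖q.eval v‖) hratio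
  have h1 := hbd (max j N) (le_max_right _ _)
  have h2 : A' / ‖q.eval v‖ < (‖v‖ / B) ^ max j N :=
    hj.trans_le (pow_le_pow_right₀ hratio.le (le_max_left _ _))
  rw [div_pow, div_lt_div_iff₀ hq0' (by positivity)] at h2
  linarith [mul_comm (‖q.eval v‖) (‖v‖ ^ max j N)]

theorem exists_power_sum (a S : ℕ → ℂ) (m : ℕ) (ha0 : a 0 = 1) (ham : ∀ n, m < n → a n = 0)
    (hrec : ∀ n, 0 < n → n * a n = ∑ x ∈ antidiagonal n with x.1 < n, a x.1 * S x.2) :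
    ∃ w : Fin m → ℂ, ∀ n, 0 < n → S n = -∑ i, w i ^ n := by
  set Q : ℂ[X] := X ^ m + ∑ i ∈ range m, C (a (m - i)) * X ^ i with hQ
  have hlow : (∑ i ∈ range m, C (a (m - i)) * X ^ i : ℂ[X]).degree < (m : WithBot ℕ) := by
    refine (degree_sum_le _ _).trans_lt ((Finset.sup_lt_iff (WithBot.bot_lt_coe m)).2 ?_)
    intro i hi
    refine (degree_C_mul_X_pow_le _ _).trans_lt ?_
    exact WithBot.coe_lt_coe.2 (mem_range.1 hi)
  have hQm : Q.Monic := monic_X_pow_add hlow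
  have hQd : Q.natDegree = m := by
    rw [hQ, natDegree_eq_of_degree_eq_some]
    rw [degree_add_eq_left_of_degree_lt, degree_X_pow]
    rwa [degree_X_pow]
  have hQc : ∀ i ≤ m, Q.coeff (m - i) = a i := by
    intro i hi
    rw [hQ, coeff_add, coeff_X_pow, finsetSum_coeff]
    simp only [coeff_C_mul, coeff_X_pow]
    rcases Nat.eq_zero_or_pos i with rfl | h0
    · simp only [Nat.sub_zero, if_true, ha0]
      rw [sum_eq_zero, add_zero]
      intro j hj
      rw [if_neg (by have := mem_range.1 hj; omega), mul_zero]
    · rw [if_neg (by omega), zero_add, sum_eq_single (m - i)]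
      · rw [if_pos rfl, mul_one, Nat.sub_sub_self hi]
      · intro j _ hj; rw [if_neg (Ne.symm hj), mul_zero]
      · intro hj; exact absurd (mem_range.2 (by omega)) hj
  have hcard : Q.roots.card = m := by
    rw [← hQd]; exact (IsAlgClosed.splits Q).natDegree_eq_card_roots.symm
  have hex : ∃ w : Fin m → ℂ, Multiset.map w univ.val = Q.roots := by
    obtain ⟨l, hl⟩ := Quot.exists_rep Q.roots
    have hl' : (l : Multiset ℂ) = Q.roots := hl
    have hlm : l.length = m := by rw [← hcard, ← hl']; rfl
    subst hlm
    refine ⟨l.get, ?_⟩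
    rw [← hl']
    simp [Fin.univ_val_map]
  obtain ⟨w, hw⟩ := hex
  have hes : ∀ n, MvPolynomial.aeval w (MvPolynomial.esymm (Fin m) ℂ n) = (-1) ^ n * a n := by
    intro n
    rw [MvPolynomial.aeval_esymm_eq_multiset_esymm, hw]
    by_cases hn : n ≤ m
    · have h := coeff_eq_esymm_roots_of_card (hcard.trans hQd.symm) (k := m - n) (by omega)
      rw [hQc n hn, hQd, hQm.leadingCoeff, Nat.sub_sub_self hn, one_mul] at h
      rw [h, ← mul_assoc, ← mul_pow]
      simp
    · rw [ham n (by omega), mul_zero, Multiset.esymm, Multiset.powersetCard_eq_empty]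
      · simp
      · omega
  refine ⟨w, fun n => ?_⟩
  induction n using Nat.strong_induction_on with
  | _ n ih =>
    intro hn
    have h1 := hrec n hn
    have h2 := congrArg (MvPolynomial.aeval w) (MvPolynomial.mul_esymm_eq_sum (Fin m) ℂ n)
    simp only [map_mul, map_sum, map_pow, map_neg, map_one, map_natCast, hes,
      MvPolynomial.psum, MvPolynomial.aeval_X] at h2
    have h3 : (n : ℂ) * a n =
        -∑ x ∈ antidiagonal n with x.1 < n, a x.1 * ∑ i, w i ^ x.2 := by
      have h4 : ((-1 : ℂ) ^ n) * (-1) ^ n = 1 := by rw [← mul_pow]; simp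
      have h5 : (n : ℂ) * a n = (-1) ^ n * (n * ((-1) ^ n * a n)) := by
        linear_combination (-(n : ℂ) * a n) * h4
      rw [h5, h2, ← mul_assoc, pow_succ, ← mul_assoc, h4, one_mul, neg_one_mul]
      congr 1
      refine sum_congr rfl fun x _ => ?_
      rw [← mul_assoc, ← mul_pow]
      simp
    have hmem : ((0, n) : ℕ × ℕ) ∈ {x ∈ antidiagonal n | x.1 < n} := by simp [hn]
    rw [h3, ← sum_neg_distrib, ← add_sum_erase _ _ hmem, ← add_sum_erase _ _ hmem] at h1
    have h7 : ∑ x ∈ {x ∈ antidiagonal n | x.1 < n}.erase (0, n),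
        -(a x.1 * ∑ i, w i ^ x.2) =
        ∑ x ∈ {x ∈ antidiagonal n | x.1 < n}.erase (0, n), a x.1 * S x.2 := by
      refine sum_congr rfl fun x hx => ?_
      obtain ⟨hx1, hx2⟩ := mem_erase.1 hx
      obtain ⟨hx3, hx4⟩ := mem_filter.1 hx2
      rw [HasAntidiagonal.mem_antidiagonal] at hx3
      have hx5 : x.1 ≠ 0 := fun h0 => hx1 (Prod.ext h0 (by simp; omega))
      rw [ih x.2 (by omega) (by omega)]
      ring
    rw [h7] at h1
    have h6 := add_right_cancel h1
    simp only [ha0, one_mul] at h6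
    exact h6.symm

end PowerSums

section LFunction

variable {p : ℕ} [Fact p.Prime]

variable (p) in
theorem finite_degree_lt (n : ℕ) : {g : (ZMod p)[X] | g.degree < n}.Finite := by
  have : Finite (degreeLT (ZMod p) n) :=
    (degreeLTEquiv (ZMod p) n).toEquiv.finite_iff.2 inferInstance
  refine (Set.toFinite (degreeLT (ZMod p) n : Set (ZMod p)[X])).subset fun g hg => ?_
  exact mem_degreeLT.2 hg

variable (p) in
theorem finite_monic_natDegree_eq (n : ℕ) :
    {g : (ZMod p)[X] | g.Monic ∧ g.natDegree = n}.Finite := by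
  refine (finite_degree_lt p (n + 1)).subset fun g hg => ?_
  refine lt_of_le_of_lt degree_le_natDegree ?_
  rw [hg.2]
  exact_mod_cast Nat.lt_succ_self n

variable (p) in
/-- The monic polynomials of degree `n`. -/
noncomputable def monics (n : ℕ) : Finset (ZMod p)[X] := (finite_monic_natDegree_eq p n).toFinset

theorem mem_monics {n : ℕ} {g : (ZMod p)[X]} : g ∈ monics p n ↔ g.Monic ∧ g.natDegree = n := by
  rw [monics, Set.Finite.mem_toFinset]; rfl

theorem monics_zero : monics p 0 = {1} := by
  ext g
  rw [mem_monics, mem_singleton]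
  constructor
  · rintro ⟨h1, h2⟩; exact h1.natDegree_eq_zero.1 h2
  · rintro rfl; exact ⟨monic_one, natDegree_one⟩

theorem monic_conjPoly (n : ℕ) (x : Kbar p) : (conjPoly n x).Monic := (monic_minpoly x).pow _

theorem natDegree_conjPoly {n : ℕ} (hn : n ≠ 0) {x : Kbar p} (hx : x ∈ fixedSet p n) :
    (conjPoly n x).natDegree = n := by
  rw [conjPoly, natDegree_pow]
  exact Nat.div_mul_cancel (minpoly_pow_spec ((mem_fixedSet hn).1 hx)).1

open scoped Classical in
theorem sum_card_conjPoly_dvd {n : ℕ} {g : (ZMod p)[X]} (hg : g ∈ monics p n) :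
    ∑ i ∈ Icc 1 n, #{x ∈ fixedSet p i | conjPoly i x ∣ g} = n := by
  obtain ⟨hgm, hgn⟩ := mem_monics.1 hg
  set s := g.aroots (Kbar p) with hs
  have hcard : s.card = n := by
    rw [hs, aroots_def, ← (IsAlgClosed.splits _).natDegree_eq_card_roots, natDegree_map, hgn]
  have h1 : ∀ i ∈ Icc 1 n, #{x ∈ fixedSet p i | conjPoly i x ∣ g} =
      ∑ x ∈ s.toFinset, if x ∈ fixedSet p i ∧ conjPoly i x ∣ g then 1 else 0 := by
    intro i hi
    have hi0 : i ≠ 0 := by have := (mem_Icc.1 hi).1; omega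
    rw [← card_filter]
    congr 1
    ext x
    simp only [mem_filter, Multiset.mem_toFinset]
    refine ⟨fun h => ⟨?_, h⟩, fun h => h.2⟩
    obtain ⟨q, hq⟩ := h.2
    refine mem_aroots.2 ⟨hgm.ne_zero, ?_⟩
    have h0 : 0 < i / (minpoly (ZMod p) x).natDegree :=
      Nat.div_pos (Nat.le_of_dvd (Nat.pos_of_ne_zero hi0)
        (minpoly_pow_spec ((mem_fixedSet hi0).1 h.1)).1)
        (minpoly.natDegree_pos (Algebra.IsIntegral.isIntegral x))
    rw [hq, map_mul, conjPoly, map_pow, minpoly.aeval, zero_pow h0.ne', zero_mul]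
  rw [← Multiset.toFinset_sum_count_eq] at hcard
  rw [sum_congr rfl h1, sum_comm]
  conv_rhs => rw [← hcard]
  refine sum_congr rfl fun x hx => ?_
  have hint : IsIntegral (ZMod p) x := Algebra.IsIntegral.isIntegral x
  have hirr := minpoly.irreducible hint
  set e := (minpoly (ZMod p) x).natDegree with he
  have he0 : 0 < e := minpoly.natDegree_pos hint
  obtain ⟨t, h, hgt, hndvd⟩ : ∃ t h, g = minpoly (ZMod p) x ^ t * h ∧ ¬ minpoly (ZMod p) x ∣ h := by
    obtain ⟨h, h1, h2⟩ := (FiniteMultiplicity.of_not_isUnit hirr.not_isUnit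
      hgm.ne_zero).exists_eq_pow_mul_and_not_dvd
    exact ⟨_, h, h1, h2⟩
  have hdvd : ∀ k, minpoly (ZMod p) x ^ k ∣ g ↔ k ≤ t := by
    intro k
    constructor
    · intro hk
      by_contra! hlt
      have h2 : minpoly (ZMod p) x ^ (t + 1) ∣ minpoly (ZMod p) x ^ t * h :=
        hgt ▸ (pow_dvd_pow _ hlt).trans hk
      rw [pow_succ] at h2
      exact hndvd ((mul_dvd_mul_iff_left (pow_ne_zero _ hirr.ne_zero)).1 h2)
    · intro hk
      rw [hgt]
      exact (pow_dvd_pow _ hk).mul_right _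
  have hh0 : h ≠ 0 := fun h0 => hndvd (h0 ▸ dvd_zero _)
  have hcount : s.count x = t := by
    rw [hs, hgt, aroots_mul (mul_ne_zero (pow_ne_zero _ hirr.ne_zero) hh0), aroots_pow,
      Multiset.count_add, Multiset.count_nsmul]
    have h3 : (h.aroots (Kbar p)).count x = 0 := by
      rw [Multiset.count_eq_zero]
      intro hxh
      exact hndvd (minpoly.dvd _ _ (mem_aroots.1 hxh).2)
    have h4 : ((minpoly (ZMod p) x).aroots (Kbar p)).count x = 1 := by
      refine Multiset.count_eq_one_of_mem ?_ (mem_aroots.2 ⟨hirr.ne_zero, minpoly.aeval _ _⟩)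
      exact nodup_roots (separable_minpoly x).map
    rw [h3, h4, mul_one, add_zero]
  have htn : t * e ≤ n := by
    rw [← hgn, he, ← natDegree_pow]
    exact natDegree_le_of_dvd ⟨h, hgt⟩ hgm.ne_zero
  rw [hcount, ← card_filter]
  have h5 : {i ∈ Icc 1 n | x ∈ fixedSet p i ∧ conjPoly i x ∣ g} = (Icc 1 t).image (· * e) := by
    ext i
    simp only [mem_filter, mem_image, mem_Icc]
    constructor
    · rintro ⟨⟨hi1, hi2⟩, hi3, hi4⟩
      obtain ⟨k, hk⟩ := (minpoly_pow_spec ((mem_fixedSet (by omega)).1 hi3)).1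
      rw [conjPoly, hdvd] at hi4
      rw [← he] at hk hi4
      rw [hk, Nat.mul_div_cancel_left _ he0] at hi4
      refine ⟨k, ⟨?_, hi4⟩, by rw [hk, mul_comm]⟩
      exact Nat.pos_of_ne_zero fun h0 => by rw [h0, mul_zero] at hk; omega
    · rintro ⟨k, ⟨hk1, hk2⟩, rfl⟩
      have hke : 0 < k * e := Nat.mul_pos hk1 he0
      refine ⟨⟨hke, (Nat.mul_le_mul_right e hk2).trans htn⟩, ?_, ?_⟩
      · exact (mem_fixedSet hke.ne').2 (pow_char_eq_self_of_natDegree_dvd (dvd_mul_left _ _))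
      · rw [conjPoly, hdvd, ← he, Nat.mul_div_cancel _ he0]
        exact hk2
  rw [h5, card_image_of_injective _ (fun a b hab => Nat.eq_of_mul_eq_mul_right he0 hab)]
  simp

/-- The coefficients of the `L`-function. -/
noncomputable def lCoeff (χ : MulChar (ZMod p) ℂ) (ψ : AddChar (ZMod p) ℂ) (f : (ZMod p)[X])
    (n : ℕ) : ℂ := ∑ g ∈ monics p n, lam χ ψ f g

theorem lCoeff_zero (χ : MulChar (ZMod p) ℂ) (ψ : AddChar (ZMod p) ℂ) {f : (ZMod p)[X]}
    (hf : f.Monic) : lCoeff χ ψ f 0 = 1 := by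
  rw [lCoeff, monics_zero, sum_singleton, lam_one χ ψ hf]

theorem sum_lam_multiples (χ : MulChar (ZMod p) ℂ) (ψ : AddChar (ZMod p) ℂ) {f : (ZMod p)[X]}
    (hf : f.Monic) {c : (ZMod p)[X]} (hc : c.Monic) {i n : ℕ} (hi : c.natDegree = i)
    (hin : i ≤ n) [DecidablePred fun g => c ∣ g] :
    ∑ g ∈ monics p n with c ∣ g, lam χ ψ f g = lam χ ψ f c * lCoeff χ ψ f (n - i) := by
  rw [lCoeff, mul_sum]
  symm
  refine sum_bij (fun h _ => c * h) ?_ ?_ ?_ ?_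
  · intro h hh
    obtain ⟨h1, h2⟩ := mem_monics.1 hh
    refine mem_filter.2 ⟨mem_monics.2 ⟨hc.mul h1, ?_⟩, dvd_mul_right _ _⟩
    rw [hc.natDegree_mul h1, hi, h2]; omega
  · intro a _ b _ hab
    exact mul_left_cancel₀ hc.ne_zero hab
  · intro g hg
    obtain ⟨h1, h, rfl⟩ := mem_filter.1 hg
    obtain ⟨h2, h3⟩ := mem_monics.1 h1
    have h4 := hc.of_mul_monic_left h2
    refine ⟨h, mem_monics.2 ⟨h4, ?_⟩, rfl⟩
    rw [hc.natDegree_mul h4] at h3; omega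
  · intro h hh
    rw [lam_mul χ ψ hf hc (mem_monics.1 hh).1]

theorem natCast_mul_lCoeff (χ : MulChar (ZMod p) ℂ) (ψ : AddChar (ZMod p) ℂ) {f : (ZMod p)[X]}
    (hf : f.Monic) (n : ℕ) :
    n * lCoeff χ ψ f n =
      ∑ x ∈ antidiagonal n with x.1 < n, lCoeff χ ψ f x.1 * fieldSum χ ψ f x.2 := by
  classical
  have h1 : n * lCoeff χ ψ f n = ∑ g ∈ monics p n, ∑ i ∈ Icc 1 n, ∑ x ∈ fixedSet p i,
      if conjPoly i x ∣ g then lam χ ψ f g else 0 := by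
    rw [lCoeff, mul_sum]
    refine sum_congr rfl fun g hg => ?_
    conv_lhs => rw [← sum_card_conjPoly_dvd hg]
    rw [Nat.cast_sum, sum_mul]
    refine sum_congr rfl fun i _ => ?_
    rw [← sum_filter, sum_const, nsmul_eq_mul]
  have h2 : n * lCoeff χ ψ f n = ∑ i ∈ Icc 1 n, lCoeff χ ψ f (n - i) * fieldSum χ ψ f i := by
    rw [h1, sum_comm]
    refine sum_congr rfl fun i hi => ?_
    obtain ⟨hi1, hi2⟩ := mem_Icc.1 hi
    rw [sum_comm, fieldSum, mul_sum]
    refine sum_congr rfl fun x hx => ?_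
    rw [← sum_filter, sum_lam_multiples χ ψ hf (monic_conjPoly i x)
      (natDegree_conjPoly (by omega) hx) hi2, conjPoly, lam_pow χ ψ hf (monic_minpoly x), mul_comm]
  rw [h2]
  refine sum_bij (fun i _ => (n - i, i)) ?_ ?_ ?_ ?_
  · intro i hi
    have := mem_Icc.1 hi
    simp only [mem_filter, HasAntidiagonal.mem_antidiagonal]
    omega
  · intro a _ b _ hab
    exact (Prod.ext_iff.1 hab).2
  · rintro ⟨a, b⟩ hb
    simp only [mem_filter, HasAntidiagonal.mem_antidiagonal] at hb
    refine ⟨b, mem_Icc.2 (by omega), Prod.ext ?_ rfl⟩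
    simp only; omega
  · intro i _
    rfl

theorem exists_nrm_ne {χ : MulChar (ZMod p) ℂ} {f : (ZMod p)[X]} (hf : f.Monic)
    (hχ : ∃ r : Kbar p, χ ^ (f.aroots (Kbar p)).count r ≠ 1) :
    ∃ u, χ (nrm f u) ≠ 0 ∧ χ (nrm f u) ≠ 1 := by
  classical
  by_contra! h
  have hp := (Fact.out : p.Prime)
  obtain ⟨A, M₀, N₀, hM₀, hbd⟩ := fieldSum_bound χ 1 hf hχ
  obtain ⟨T, hT⟩ := exists_nat_gt (A + f.natDegree)
  set j := max N₀ (T + 1) with hj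
  have hjb := hbd j (le_max_left _ _)
  set M := M₀ * j with hM
  have hMj : j ≤ M := Nat.le_mul_of_pos_left _ hM₀
  have hTj : T + 1 ≤ j := le_max_right _ _
  have hM0 : M + M ≠ 0 := by omega
  have h1 : fieldSum χ 1 f (M + M) =
      (#{x ∈ fixedSet p (M + M) | χ (nrm f (conjPoly (M + M) x)) ≠ 0} : ℂ) := by
    rw [fieldSum_eq χ 1 hf, card_filter, Nat.cast_sum]
    refine sum_congr rfl fun x _ => ?_
    rw [AddChar.one_apply, mul_one]
    split_ifs with h0
    · rw [h _ h0, Nat.cast_one]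
    · rw [not_not.1 h0, Nat.cast_zero]
  have h2 : #{x ∈ fixedSet p (M + M) | ¬ χ (nrm f (conjPoly (M + M) x)) ≠ 0} ≤ f.natDegree := by
    have h3 : {x ∈ fixedSet p (M + M) | ¬ χ (nrm f (conjPoly (M + M) x)) ≠ 0} ⊆
        (f.aroots (Kbar p)).toFinset := by
      intro x hx
      obtain ⟨hx1, hx2⟩ := mem_filter.1 hx
      have h4 : nrm f (conjPoly (M + M) x) = 0 := by
        by_contra hne
        exact hx2 (MulChar.apply_ne_zero_iff.2 (isUnit_iff_ne_zero.2 hne))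
      have h' := algebraMap_nrm_conjPoly hf ((mem_fixedSet hM0).1 hx1)
      rw [h4, map_zero] at h'
      exact Multiset.mem_toFinset.2 (mem_aroots.2 ⟨hf.ne_zero, eq_zero_of_pow_eq_zero h'.symm⟩)
    refine (card_le_card h3).trans ((Multiset.toFinset_card_le _).trans ?_)
    rw [aroots_def]
    exact (card_roots' _).trans natDegree_map_le
  have h3 := card_filter_add_card_filter_not (s := fixedSet p (M + M))
    (fun x => χ (nrm f (conjPoly (M + M) x)) ≠ 0)
  rw [card_fixedSet hM0] at h3
  rw [h1, Complex.norm_natCast] at hjb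
  have h4 : ((p : ℝ) ^ M) * (p : ℝ) ^ M ≤ A * (p : ℝ) ^ M + f.natDegree := by
    rw [← pow_add]
    have h5 : (p : ℝ) ^ (M + M) = #{x ∈ fixedSet p (M + M) | χ (nrm f (conjPoly (M + M) x)) ≠ 0} +
        #{x ∈ fixedSet p (M + M) | ¬ χ (nrm f (conjPoly (M + M) x)) ≠ 0} := by
      exact_mod_cast h3.symm
    rw [h5]
    have h6 : (#{x ∈ fixedSet p (M + M) | ¬ χ (nrm f (conjPoly (M + M) x)) ≠ 0} : ℝ) ≤
      f.natDegree := by exact_mod_cast h2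
    linarith
  have h5 : (T : ℝ) ≤ (p : ℝ) ^ M := by
    have : M < p ^ M := Nat.lt_pow_self hp.one_lt
    exact_mod_cast (show T ≤ p ^ M by omega)
  have h6 : (1 : ℝ) ≤ (p : ℝ) ^ M := one_le_pow₀ (by exact_mod_cast hp.one_lt.le)
  have h7 : (0 : ℝ) ≤ f.natDegree := Nat.cast_nonneg _
  nlinarith

end LFunction

section Weil

variable {p : ℕ} [Fact p.Prime]

/-- Multiply the residue of `g` modulo `H` by `u`. -/
noncomputable def twist (H u g : (ZMod p)[X]) : (ZMod p)[X] :=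
  g + ((u * (g %ₘ H)) %ₘ H - g %ₘ H)

theorem twist_degree_lt {H : (ZMod p)[X]} (hH : H.Monic) (u : (ZMod p)[X]) {n : ℕ}
    (hn : H.natDegree < n) (g : (ZMod p)[X]) :
    ((u * (g %ₘ H)) %ₘ H - g %ₘ H).degree < ((n - 1 : ℕ) : WithBot ℕ) := by
  refine lt_of_lt_of_le ((degree_sub_le _ _).trans_lt
    (max_lt (degree_modByMonic_lt _ hH) (degree_modByMonic_lt _ hH))) ?_
  rw [degree_eq_natDegree hH.ne_zero]
  exact_mod_cast (by omega : H.natDegree ≤ n - 1)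

theorem twist_mem_monics {H : (ZMod p)[X]} (hH : H.Monic) (u : (ZMod p)[X]) {n : ℕ}
    (hn : H.natDegree < n) {g : (ZMod p)[X]} (hg : g ∈ monics p n) : twist H u g ∈ monics p n := by
  obtain ⟨h1, h2⟩ := mem_monics.1 hg
  have h3 : ((u * (g %ₘ H)) %ₘ H - g %ₘ H).degree < g.degree := by
    rw [degree_eq_natDegree h1.ne_zero, h2]
    refine (twist_degree_lt hH u hn g).trans_le ?_
    exact_mod_cast Nat.sub_le n 1
  exact mem_monics.2 ⟨h1.add_of_left h3, by rw [twist, natDegree_add_eq_left_of_degree_lt h3, h2]⟩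

theorem twist_nextCoeff {H : (ZMod p)[X]} (hH : H.Monic) (u : (ZMod p)[X]) {n : ℕ}
    (hn : H.natDegree < n) {g : (ZMod p)[X]} (hg : g ∈ monics p n) :
    (twist H u g).nextCoeff = g.nextCoeff := by
  have h1 := (mem_monics.1 (twist_mem_monics hH u hn hg)).2
  have h2 := (mem_monics.1 hg).2
  rw [nextCoeff_of_natDegree_pos (by omega), nextCoeff_of_natDegree_pos (by omega), h1, h2, twist,
    coeff_add, coeff_eq_zero_of_degree_lt (twist_degree_lt hH u hn g), add_zero]

theorem twist_modByMonic {H : (ZMod p)[X]} (hH : H.Monic) (u g : (ZMod p)[X]) :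
    twist H u g %ₘ H = (u * (g %ₘ H)) %ₘ H := by
  have h : ∀ a : (ZMod p)[X], (a %ₘ H) %ₘ H = a %ₘ H := fun a =>
    (modByMonic_eq_self_iff hH).2 (degree_modByMonic_lt a hH)
  rw [twist, add_modByMonic, sub_modByMonic, h, h]
  ring

theorem twist_twist {H : (ZMod p)[X]} (hH : H.Monic) {u v : (ZMod p)[X]}
    (huv : H ∣ v * u - 1) (g : (ZMod p)[X]) : twist H v (twist H u g) = g := by
  have h1 : (v * ((u * (g %ₘ H)) %ₘ H)) %ₘ H = g %ₘ H := by
    rw [← sub_eq_zero, ← modByMonic_eq_self_iff hH |>.2 (degree_modByMonic_lt (g) hH),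
      ← sub_modByMonic, modByMonic_eq_zero_iff_dvd hH]
    have h2 := modByMonic_add_div (u * (g %ₘ H)) H
    obtain ⟨q, hq⟩ := huv
    have h3 : (g %ₘ H) %ₘ H = g %ₘ H :=
      (modByMonic_eq_self_iff hH).2 (degree_modByMonic_lt g hH)
    rw [h3]
    refine ⟨q * (g %ₘ H) - v * (u * (g %ₘ H) /ₘ H), ?_⟩
    linear_combination (g %ₘ H) * hq + v * h2
  rw [twist, twist_modByMonic hH, h1, twist]
  ring

theorem aeval_modByMonic {H : (ZMod p)[X]} (g : (ZMod p)[X]) {r : Kbar p}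
    (hr : aeval r H = 0) : aeval r (g %ₘ H) = aeval r g := by
  conv_rhs => rw [← modByMonic_add_div g H]
  rw [map_add, map_mul, hr, zero_mul, add_zero]

theorem aeval_twist {H : (ZMod p)[X]} (u g : (ZMod p)[X]) {r : Kbar p}
    (hr : aeval r H = 0) : aeval r (twist H u g) = aeval r (u * g) := by
  rw [twist, map_add, map_sub, aeval_modByMonic _ hr, aeval_modByMonic _ hr, map_mul,
    aeval_modByMonic _ hr, map_mul]
  ring

theorem lCoeff_eq_zero {χ : MulChar (ZMod p) ℂ} (ψ : AddChar (ZMod p) ℂ) {f H : (ZMod p)[X]}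
    (hf : f.Monic) (hχ : ∃ r : Kbar p, χ ^ (f.aroots (Kbar p)).count r ≠ 1) (hH : H.Monic)
    (hroots : ∀ r : Kbar p, aeval r f = 0 ↔ aeval r H = 0) {n : ℕ} (hn : H.natDegree < n) :
    lCoeff χ ψ f n = 0 := by
  obtain ⟨u, hu0, hu1⟩ := exists_nrm_ne hf hχ
  have hcop : IsCoprime u H := by
    rw [isCoprime_iff_aeval_ne_zero_of_isAlgClosed _ (Kbar p)]
    intro r
    by_contra! h
    refine hu0 ?_
    have h1 : nrm f u = 0 := by
      apply (algebraMap (ZMod p) (Kbar p)).injective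
      rw [algebraMap_nrm hf, map_zero]
      exact Multiset.prod_eq_zero (Multiset.mem_map.2
        ⟨r, mem_aroots.2 ⟨hf.ne_zero, (hroots r).2 h.2⟩, h.1⟩)
    rw [h1, MulChar.map_zero]
  obtain ⟨v, w, hvw⟩ := hcop
  have huv : H ∣ v * u - 1 := ⟨-w, by linear_combination hvw⟩
  have hvu : H ∣ u * v - 1 := by rwa [mul_comm]
  have h : χ (nrm f u) * lCoeff χ ψ f n = lCoeff χ ψ f n := by
    rw [lCoeff, mul_sum]
    refine sum_nbij' (twist H u) (twist H v) (fun g hg => twist_mem_monics hH u hn hg)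
      (fun g hg => twist_mem_monics hH v hn hg) (fun g _ => twist_twist hH huv g)
      (fun g _ => twist_twist hH hvu g) fun g hg => ?_
    rw [lam, lam, twist_nextCoeff hH u hn hg, ← mul_assoc, ← map_mul, ← nrm_mul hf]
    congr 2
    exact nrm_congr hf fun r hr => (aeval_twist u g ((hroots r).1 hr)).symm
  have h2 : (χ (nrm f u) - 1) * lCoeff χ ψ f n = 0 := by rw [sub_mul, h, one_mul, sub_self]
  exact (mul_eq_zero.1 h2).resolve_left (sub_ne_zero.2 hu1)

theorem fieldSum_one (χ : MulChar (ZMod p) ℂ) (ψ : AddChar (ZMod p) ℂ) {f : (ZMod p)[X]}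
    (hf : f.Monic) :
    fieldSum χ ψ f 1 = χ ((-1) ^ f.natDegree) * ∑ a : ZMod p, χ (f.eval a) * ψ a := by
  have hinj := (algebraMap (ZMod p) (Kbar p)).injective
  rw [fieldSum, mul_sum]
  symm
  refine sum_bij (fun a _ => algebraMap (ZMod p) (Kbar p) a) ?_ ?_ ?_ ?_
  · intro a _
    rw [mem_fixedSet one_ne_zero, pow_one, ← map_pow, ZMod.pow_card]
  · intro a _ b _ hab
    exact hinj hab
  · intro x hx
    rw [mem_fixedSet one_ne_zero, pow_one] at hx
    obtain ⟨a, ha⟩ := exists_algebraMap_eq hx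
    exact ⟨a, mem_univ _, ha⟩
  · intro a _
    have h1 : nrm f (X - C a) = (-1) ^ f.natDegree * f.eval a := by
      apply hinj
      rw [algebraMap_nrm hf, map_mul, map_pow, map_neg, map_one,
        ← aeval_algebraMap_apply_eq_algebraMap_eval,
        ← prod_root_sub hf]
      simp
    rw [minpoly.eq_X_sub_C, natDegree_X_sub_C, Nat.div_one, pow_one, lam, h1, nextCoeff_X_sub_C,
      neg_neg, map_mul]
    ring

theorem weil_bound_monic {χ : MulChar (ZMod p) ℂ} (ψ : AddChar (ZMod p) ℂ) {f H : (ZMod p)[X]}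
    (hf : f.Monic) (hχ : ∃ r : Kbar p, χ ^ (f.aroots (Kbar p)).count r ≠ 1) (hH : H.Monic)
    (hroots : ∀ r : Kbar p, aeval r f = 0 ↔ aeval r H = 0) :
    ‖∑ a : ZMod p, χ (f.eval a) * ψ a‖ ≤ H.natDegree * Real.sqrt p := by
  have hp := (Fact.out : p.Prime)
  obtain ⟨ω, hω⟩ := exists_power_sum (lCoeff χ ψ f) (fieldSum χ ψ f) H.natDegree
    (lCoeff_zero χ ψ hf) (fun n hn => lCoeff_eq_zero ψ hf hχ hH hroots hn)
    (fun n _ => natCast_mul_lCoeff χ ψ hf n)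
  obtain ⟨A, M₀, N₀, hM₀, hbd⟩ := fieldSum_bound χ ψ hf hχ
  have hω2 : ∀ i, ‖ω i‖ ≤ Real.sqrt p := by
    intro i
    have hp0 : (0 : ℝ) < p := by exact_mod_cast hp.pos
    have h := norm_le_of_power_sum_le (fun i => ω i ^ (M₀ + M₀)) (B := (p : ℝ) ^ M₀) (A := A)
      (N := N₀ + 1) (by positivity) (fun j hj => by
        have h1 := hbd j (by omega)
        have h2 : 0 < M₀ * j := Nat.mul_pos hM₀ (by omega)
        rw [hω _ (by omega), norm_neg, ← add_mul, pow_mul] at h1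
        simpa only [← pow_mul] using h1) i
    rw [norm_pow, ← two_mul, pow_mul] at h
    exact Real.le_sqrt_of_sq_le (le_of_pow_le_pow_left₀ hM₀.ne' hp0.le h)
  have h1 := fieldSum_one χ ψ hf
  have h2 : ‖χ ((-1) ^ f.natDegree)‖ = 1 := by
    rw [map_pow, norm_pow]
    have h3 : ‖χ (-1)‖ ^ 2 = 1 := by rw [← norm_pow, ← map_pow]; simp
    rw [(pow_eq_one_iff_of_nonneg (norm_nonneg _) two_ne_zero).1 h3, one_pow]
  have h3 : ‖∑ a : ZMod p, χ (f.eval a) * ψ a‖ = ‖fieldSum χ ψ f 1‖ := by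
    rw [h1, norm_mul, h2, one_mul]
  rw [h3, hω 1 one_pos, norm_neg]
  refine (norm_sum_le _ _).trans ((sum_le_sum fun i _ => (pow_one (ω i)).symm ▸ hω2 i).trans ?_)
  simp

/-- Weil's bound for mixed character sums of a polynomial over a prime field. -/
theorem weil_bound {χ : MulChar (ZMod p) ℂ} (ψ : AddChar (ZMod p) ℂ) {f H : (ZMod p)[X]}
    (hf : f ≠ 0) (hχ : ∃ r : Kbar p, χ ^ (f.aroots (Kbar p)).count r ≠ 1) (hH : H ≠ 0)
    (hroots : ∀ r : Kbar p, aeval r f = 0 ↔ aeval r H = 0) :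
    ‖∑ a : ZMod p, χ (f.eval a) * ψ a‖ ≤ H.natDegree * Real.sqrt p := by
  have hf' : f.leadingCoeff ≠ 0 := leadingCoeff_ne_zero.2 hf
  have hH' : H.leadingCoeff ≠ 0 := leadingCoeff_ne_zero.2 hH
  have h := weil_bound_monic (χ := χ) ψ (monic_mul_leadingCoeff_inv hf) (by
    rwa [mul_comm, aroots_C_mul _ (inv_ne_zero hf')]) (monic_mul_leadingCoeff_inv hH) (by
    intro r
    simp [hf', hH', hroots r])
  rw [natDegree_mul_leadingCoeff_inv _ hH] at h
  refine le_trans (le_of_eq ?_) h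
  simp only [eval_mul, eval_C, map_mul]
  have h3 : ‖χ f.leadingCoeff⁻¹‖ = 1 := by
    obtain ⟨u, hu⟩ := isUnit_iff_ne_zero.2 (inv_ne_zero hf')
    rw [← hu]; exact DirichletCharacter.unit_norm_eq_one χ u
  rw [sum_congr rfl (fun a _ => mul_right_comm (χ (f.eval a)) (χ f.leadingCoeff⁻¹) (ψ a)),
    ← sum_mul,
    norm_mul, h3, mul_one]

end Weil

section UniqueSum

variable {p : ℕ} [Fact p.Prime]

/-- Some element of the sumset of `A` and `B` has a single representation. -/
def HasUniqueSum (A B : Finset (ZMod p)) : Prop :=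
  ∃ a ∈ A, ∃ b ∈ B, ∀ a' ∈ A, ∀ b' ∈ B, a + b = a' + b' → a = a' ∧ b = b'

theorem HasUniqueSum.symm {A B : Finset (ZMod p)} (h : HasUniqueSum A B) : HasUniqueSum B A := by
  obtain ⟨a, ha, b, hb, h⟩ := h
  refine ⟨b, hb, a, ha, fun b' hb' a' ha' hab => (h a' ha' b' hb' ?_).symm⟩
  rw [add_comm, hab, add_comm]

theorem exists_add_notMem {B : Finset (ZMod p)} (hB : B.Nonempty) (hBp : #B < p) {t : ZMod p}
    (ht : t ≠ 0) : ∃ b ∈ B, b + t ∉ B := by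
  by_contra! h
  obtain ⟨b, hb⟩ := hB
  have h1 : ∀ i : ℕ, b + i * t ∈ B := by
    intro i
    induction i with
    | zero => simpa using hb
    | succ i ih =>
      have := h _ ih
      push_cast
      convert this using 1
      ring
  have h2 : (univ : Finset (ZMod p)) ⊆ B := by
    intro y _
    have h3 := h1 ((y - b) / t).val
    rw [ZMod.natCast_zmod_val, div_mul_cancel₀ _ ht] at h3
    simpa using h3
  have h3 := card_le_card h2
  rw [card_univ, ZMod.card] at h3
  omega

theorem hasUniqueSum_of_card_le_two {A B : Finset (ZMod p)} (hA : A.Nonempty) (hB : B.Nonempty)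
    (hA2 : #A ≤ 2) (hBp : #B < p) : HasUniqueSum A B := by
  have hA0 := hA.card_pos
  rcases (by omega : #A = 1 ∨ #A = 2) with h1 | h2
  · obtain ⟨a, rfl⟩ := card_eq_one.1 h1
    obtain ⟨b, hb⟩ := hB
    refine ⟨a, mem_singleton_self a, b, hb, fun a' ha' b' _ h => ?_⟩
    rw [mem_singleton.1 ha'] at h ⊢
    exact ⟨rfl, add_left_cancel h⟩
  · obtain ⟨a, c, hac, rfl⟩ := card_eq_two.1 h2
    obtain ⟨b, hb, hbt⟩ := exists_add_notMem hB hBp (sub_ne_zero.2 hac)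
    refine ⟨a, by simp, b, hb, fun a' ha' b' hb' h => ?_⟩
    rcases mem_insert.1 ha' with rfl | hc
    · exact ⟨rfl, add_left_cancel h⟩
    · rw [mem_singleton.1 hc] at h
      refine absurd ?_ hbt
      have : b + (a - c) = b' := by linear_combination h
      rwa [this]

theorem exists_mul_small {A : Finset (ZMod p)} {k : ℕ} (hk : (4 * k) ^ #A < p) (hk0 : 0 < k) :
    ∃ t : ZMod p, t ≠ 0 ∧ ∃ x : ZMod p → ℤ, ∀ a ∈ A, (x a : ZMod p) = t * a ∧
      4 * k * |x a| < p := by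
  have hp := (Fact.out : p.Prime)
  have hbox : #(Fintype.piFinset fun _ : A => range (4 * k)) < #(univ : Finset (ZMod p)) := by
    rw [Fintype.card_piFinset, card_univ, ZMod.card]
    simpa using hk
  obtain ⟨t₁, -, t₂, -, hne, heq⟩ := exists_ne_map_eq_of_card_lt_of_maps_to hbox
    (f := fun t (a : A) => 4 * k * (t * (a : ZMod p)).val / p) (by
      intro t _
      rw [mem_coe, Fintype.mem_piFinset]
      intro a
      rw [mem_range, Nat.div_lt_iff_lt_mul hp.pos]
      exact Nat.mul_lt_mul_of_pos_left (ZMod.val_lt _) (by omega))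
  refine ⟨t₁ - t₂, sub_ne_zero.2 hne, fun a => (t₁ * a).val - (t₂ * a).val, fun a ha => ⟨?_, ?_⟩⟩
  · push_cast
    rw [ZMod.natCast_zmod_val, ZMod.natCast_zmod_val]
    ring
  · have h1 := congrFun heq ⟨a, ha⟩
    simp only at h1
    set v₁ := (t₁ * a).val
    set v₂ := (t₂ * a).val
    have h2 := Nat.div_add_mod (4 * k * v₁) p
    have h3 := Nat.div_add_mod (4 * k * v₂) p
    have h4 := Nat.mod_lt (4 * k * v₁) hp.pos
    have h5 := Nat.mod_lt (4 * k * v₂) hp.pos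
    rw [h1] at h2
    have h6 : (4 * k * |(v₁ : ℤ) - v₂|) = |4 * k * (v₁ : ℤ) - 4 * k * v₂| := by
      rw [← mul_sub, abs_mul]
      congr 1
      rw [abs_of_nonneg]; positivity
    rw [h6, abs_lt]
    zify at h2 h3 h4 h5
    have h7 := Int.natCast_nonneg (4 * k * v₁ % p)
    have h8 := Int.natCast_nonneg (4 * k * v₂ % p)
    push_cast at h7 h8
    constructor <;> linarith

theorem exists_gap {B : Finset (ZMod p)} (hB : B.Nonempty) {G : ℕ} (hG : #B * G < p) :
    ∃ b ∈ B, ∀ b' ∈ B, ∀ i : ℕ, i ≤ G → b' = b + i → b' = b := by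
  have hp := (Fact.out : p.Prime)
  have hcov : ∃ y, y ∉ (B ×ˢ range G).image (fun x : ZMod p × ℕ => x.1 + (x.2 : ZMod p)) := by
    by_contra! h
    have h1 : #(univ : Finset (ZMod p)) ≤ #B * G := by
      calc #univ ≤ #(B ×ˢ range G) := (card_le_card fun y _ => h y).trans card_image_le
        _ = #B * G := by rw [card_product, card_range]
    rw [card_univ, ZMod.card] at h1
    omega
  obtain ⟨y, hy⟩ := hcov
  obtain ⟨b, hb, hmin⟩ := exists_min_image B (fun b => (y - b).val) hB
  have hGb : G ≤ (y - b).val := by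
    by_contra! hlt
    refine hy (mem_image.2 ⟨(b, (y - b).val), mem_product.2 ⟨hb, mem_range.2 hlt⟩, ?_⟩)
    simp
  refine ⟨b, hb, fun b' hb' i hi hbi => ?_⟩
  have h1 := hmin b' hb'
  have h2 : y - b' = (((y - b).val - i : ℕ) : ZMod p) := by
    rw [Nat.cast_sub (hi.trans hGb), ZMod.natCast_zmod_val, hbi]; ring
  rw [h2, ZMod.val_natCast_of_lt (lt_of_le_of_lt (Nat.sub_le _ _) (ZMod.val_lt _))] at h1
  have hbv := ZMod.val_lt (y - b)
  rcases Nat.eq_zero_or_pos i with h0 | h0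
  · rw [hbi, h0]; simp
  · have h3 : (y - b).val = 0 := by omega
    omega

theorem hasUniqueSum_of_pow_lt {A B : Finset (ZMod p)} (hA : A.Nonempty) (hB : B.Nonempty)
    (h : (4 * #B) ^ #A < p) : HasUniqueSum A B := by
  have hp := (Fact.out : p.Prime)
  have hB0 := hB.card_pos
  obtain ⟨t, ht, x, hx⟩ := exists_mul_small h hB0
  obtain ⟨a, ha, hmax⟩ := exists_max_image A x hA
  have hinj : Function.Injective (t * ·) := mul_right_injective₀ ht
  have hcard : #(B.image (t * ·)) = #B := card_image_of_injective _ hinj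
  obtain ⟨c, hc, hgap⟩ := exists_gap (hB.image (t * ·)) (G := (p - 1) / #B) (by
    rw [hcard]
    have := Nat.mul_div_le (p - 1) #B
    have := hp.pos
    omega)
  obtain ⟨b, hb, rfl⟩ := mem_image.1 hc
  refine ⟨a, ha, b, hb, fun a' ha' b' hb' hab => ?_⟩
  have hle := hmax a' ha'
  obtain ⟨h1, h2⟩ := hx a ha
  obtain ⟨h3, h4⟩ := hx a' ha'
  obtain ⟨i, hi⟩ := Int.eq_ofNat_of_zero_le (sub_nonneg.2 hle)
  have hb'b : t * b' = t * b := by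
    refine hgap _ (mem_image_of_mem _ hb') i ?_ ?_
    · rw [Nat.le_div_iff_mul_le hB0]
      have h5 := le_abs_self (x a)
      have h6 := neg_abs_le (x a')
      have h7 : (4 * #B : ℤ) * i < 2 * p := by rw [← hi]; nlinarith
      have h8 : 4 * #B * i < 2 * p := by exact_mod_cast h7
      have h9 : i * #B = #B * i := mul_comm _ _
      have h10 : 4 * #B * i = 4 * (#B * i) := mul_assoc _ _ _
      omega
    · have h5 : ((i : ℤ) : ZMod p) = t * a - t * a' := by
        rw [← h1, ← h3, ← Int.cast_sub, hi]
      rw [Int.cast_natCast] at h5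
      rw [h5]
      linear_combination (-t) * hab
  have hbb : b' = b := hinj hb'b
  subst hbb
  exact ⟨add_right_cancel hab, rfl⟩

end UniqueSum

section UniqueRoot

variable {p : ℕ} [Fact p.Prime]

open scoped Classical in
/-- The translations by elements of the prime field that carry `r` to a root of `f`. -/
noncomputable def rootShifts (f : (ZMod p)[X]) (r : Kbar p) : Finset (ZMod p) :=
  univ.filter fun a => aeval (r + algebraMap (ZMod p) (Kbar p) a) f = 0

theorem mem_rootShifts {f : (ZMod p)[X]} {r : Kbar p} {a : ZMod p} :
    a ∈ rootShifts f r ↔ aeval (r + algebraMap (ZMod p) (Kbar p) a) f = 0 := by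
  simp [rootShifts]

theorem rootShifts_nonempty {f : (ZMod p)[X]} {r : Kbar p} (hr : aeval r f = 0) :
    (rootShifts f r).Nonempty :=
  ⟨0, mem_rootShifts.2 (by simpa using hr)⟩

theorem card_rootShifts_le {f : (ZMod p)[X]} (hf : f ≠ 0) (r : Kbar p) :
    #(rootShifts f r) ≤ f.natDegree := by
  classical
  calc #(rootShifts f r) = #((rootShifts f r).image fun a => r + algebraMap _ (Kbar p) a) :=
        (card_image_of_injective _ fun a b h =>
          (algebraMap (ZMod p) (Kbar p)).injective (add_left_cancel h)).symm
    _ ≤ #(f.aroots (Kbar p)).toFinset := by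
        refine card_le_card fun x hx => ?_
        obtain ⟨a, ha, rfl⟩ := mem_image.1 hx
        rw [Multiset.mem_toFinset, mem_aroots]
        exact ⟨hf, mem_rootShifts.1 ha⟩
    _ ≤ Multiset.card (f.aroots (Kbar p)) := Multiset.toFinset_card_le _
    _ ≤ f.natDegree := (card_roots' _).trans natDegree_map_le

theorem exists_unique_shift_of_hasUniqueSum {f : (ZMod p)[X]} {r : Kbar p} {k : ℕ}
    {d : Fin k → ZMod p} (hd : Function.Injective d)
    (h : HasUniqueSum (rootShifts f r) (univ.image fun j => -d j)) :
    ∃ ρ : Kbar p, ∃ j, aeval (ρ + algebraMap (ZMod p) (Kbar p) (d j)) f = 0 ∧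
      ∀ j', aeval (ρ + algebraMap (ZMod p) (Kbar p) (d j')) f = 0 → j' = j := by
  obtain ⟨a, ha, b, hb, h⟩ := h
  obtain ⟨j, -, rfl⟩ := mem_image.1 hb
  refine ⟨r + algebraMap (ZMod p) (Kbar p) (a - d j), j, ?_, fun j' hj' => ?_⟩
  · rw [add_assoc, ← map_add, sub_add_cancel]
    exact mem_rootShifts.1 ha
  · rw [add_assoc, ← map_add] at hj'
    have := h _ (mem_rootShifts.2 hj') (-d j') (mem_image_of_mem _ (mem_univ _)) (by ring)
    exact hd (neg_injective this.2.symm)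

theorem eq_zero_of_isConjRoot_add {x : Kbar p} {c : ZMod p}
    (h : IsConjRoot (ZMod p) x (x + algebraMap (ZMod p) (Kbar p) c))
    (hx : (minpoly (ZMod p) x).natDegree < p) : c = 0 := by
  by_contra hc
  have h1 : ∀ i : ℕ, IsConjRoot (ZMod p) x (x + algebraMap (ZMod p) (Kbar p) (i * c)) := by
    intro i
    induction i with
    | zero => simp [IsConjRoot]
    | succ i ih =>
      have h2 := h.trans (ih.add_algebraMap c)
      convert h2 using 1
      push_cast
      ring
  have h2 : rootShifts (minpoly (ZMod p) x) x = univ := by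
    refine eq_univ_of_forall fun y => mem_rootShifts.2 ?_
    have h3 := h1 (y / c).val
    rw [ZMod.natCast_zmod_val, div_mul_cancel₀ _ hc] at h3
    exact h3.aeval_eq_zero
  have h3 := card_rootShifts_le (monic_minpoly x).ne_zero x
  rw [h2, card_univ, ZMod.card] at h3
  omega

theorem card_rootShifts_le_card_factors {f : (ZMod p)[X]} (hf : f ≠ 0) (hfp : f.natDegree < p)
    (r : Kbar p) :
    #(rootShifts f r) ≤ #((UniqueFactorizationMonoid.normalizedFactors f).toFinset.filter
      fun q => q.natDegree = (minpoly (ZMod p) r).natDegree) := by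
  refine card_le_card_of_injOn
    (fun a => minpoly (ZMod p) (r + algebraMap (ZMod p) (Kbar p) a)) (fun a ha => ?_) ?_
  · rw [mem_coe, mem_rootShifts] at ha
    have hint : IsIntegral (ZMod p) (r + algebraMap (ZMod p) (Kbar p) a) :=
      Algebra.IsIntegral.isIntegral _
    rw [mem_coe, mem_filter, Multiset.mem_toFinset,
      UniqueFactorizationMonoid.mem_normalizedFactors_iff' hf]
    refine ⟨⟨minpoly.irreducible hint, (monic_minpoly _).normalize_eq_self, minpoly.dvd _ _ ha⟩, ?_⟩
    simp only
    rw [minpoly.add_algebraMap, natDegree_comp, natDegree_X_sub_C, mul_one]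
  · intro a ha b hb hab
    rw [mem_coe, mem_rootShifts] at ha
    have hconj : IsConjRoot (ZMod p) (r + algebraMap (ZMod p) (Kbar p) a)
        (r + algebraMap (ZMod p) (Kbar p) a + algebraMap (ZMod p) (Kbar p) (b - a)) := by
      rw [isConjRoot_def, add_assoc, ← map_add, add_sub_cancel]
      exact hab
    refine (sub_eq_zero.1 (eq_zero_of_isConjRoot_add hconj ?_)).symm
    exact (natDegree_le_of_dvd (minpoly.dvd _ _ ha) hf).trans_lt hfp

/-- The hypotheses on `f` and `k` give a point at which exactly one of the `k` translates of `f`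
vanishes. -/
theorem exists_unique_shift {f : (ZMod p)[X]} (hf : 1 ≤ f.natDegree) (hfp : f.natDegree < p)
    {k : ℕ} (hk : 0 < k) (hkp : k < p) {d : Fin k → ZMod p} (hd : Function.Injective d)
    (h : Irreducible f ∨
          (∃ β : ℕ,
            (((UniqueFactorizationMonoid.normalizedFactors f).toFinset.filter
                (fun fi => fi.natDegree = β)).card = 1 ∨
              ((UniqueFactorizationMonoid.normalizedFactors f).toFinset.filter
                (fun fi => fi.natDegree = β)).card = 2)) ∨
          k ≤ 2 ∨
          ((4 * k) ^ f.natDegree < p ∨ (4 * f.natDegree) ^ k < p)) :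
    ∃ ρ : Kbar p, ∃ j, aeval (ρ + algebraMap (ZMod p) (Kbar p) (d j)) f = 0 ∧
      ∀ j', aeval (ρ + algebraMap (ZMod p) (Kbar p) (d j')) f = 0 → j' = j := by
  have hf0 : f ≠ 0 := by rintro rfl; simp at hf
  have hB : #(univ.image fun j => -d j) = k := by
    rw [card_image_of_injective _ (fun a b h => hd (neg_injective h)), card_univ, Fintype.card_fin]
  have hBne : (univ.image fun j => -d j).Nonempty := card_pos.1 (by rw [hB]; exact hk)
  obtain ⟨r₀, hr₀⟩ := IsAlgClosed.exists_aeval_eq_zero (Kbar p) f (by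
    rw [degree_eq_natDegree hf0]
    exact_mod_cast (by omega : f.natDegree ≠ 0))
  have hle := card_rootShifts_le hf0 r₀
  have hne := rootShifts_nonempty hr₀
  have key : (∃ β : ℕ, 0 < #((UniqueFactorizationMonoid.normalizedFactors f).toFinset.filter
      fun q => q.natDegree = β) ∧ #((UniqueFactorizationMonoid.normalizedFactors f).toFinset.filter
      fun q => q.natDegree = β) ≤ 2) → ∃ ρ : Kbar p, ∃ j,
      aeval (ρ + algebraMap (ZMod p) (Kbar p) (d j)) f = 0 ∧
      ∀ j', aeval (ρ + algebraMap (ZMod p) (Kbar p) (d j')) f = 0 → j' = j := by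
    rintro ⟨β, h0, h2⟩
    obtain ⟨q, hq⟩ := card_pos.1 h0
    rw [mem_filter, Multiset.mem_toFinset,
      UniqueFactorizationMonoid.mem_normalizedFactors_iff' hf0] at hq
    obtain ⟨⟨hirr, hnorm, hdvd⟩, rfl⟩ := hq
    obtain ⟨r, hr⟩ := IsAlgClosed.exists_aeval_eq_zero (Kbar p) q
      (degree_pos_of_irreducible hirr).ne'
    have hmin : minpoly (ZMod p) r = q := by
      refine (minpoly.eq_of_irreducible_of_monic hirr hr ?_).symm
      rw [← hnorm]
      exact monic_normalize hirr.ne_zero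
    have hrf : aeval r f = 0 := by
      obtain ⟨t, rfl⟩ := hdvd
      rw [map_mul, hr, zero_mul]
    have hc := card_rootShifts_le_card_factors hf0 hfp r
    rw [hmin] at hc
    exact exists_unique_shift_of_hasUniqueSum hd (hasUniqueSum_of_card_le_two
      (rootShifts_nonempty hrf) hBne (hc.trans h2) (by omega))
  rcases h with hirr | ⟨β, hβ⟩ | hk2 | hp1 | hp2
  · refine key ⟨f.natDegree, ?_⟩
    rw [UniqueFactorizationMonoid.normalizedFactors_irreducible hirr, Multiset.toFinset_singleton,
      filter_singleton, natDegree_eq_of_degree_eq degree_normalize]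
    simp
  · exact key ⟨β, by omega, by omega⟩
  · exact exists_unique_shift_of_hasUniqueSum hd (hasUniqueSum_of_card_le_two hBne hne
      (by omega) (by omega)).symm
  · refine exists_unique_shift_of_hasUniqueSum hd (hasUniqueSum_of_pow_lt hne hBne ?_)
    rw [hB]
    exact (Nat.pow_le_pow_right (by omega) hle).trans_lt hp1
  · refine exists_unique_shift_of_hasUniqueSum hd (hasUniqueSum_of_pow_lt hBne hne ?_).symm
    rw [hB]
    exact (Nat.pow_le_pow_left (by omega) k).trans_lt hp2

end UniqueRoot

section ProductWeil

variable {p : ℕ} [Fact p.Prime]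

theorem exists_mulChar_pow_eq : ∃ ω : MulChar (ZMod p) ℂ, ∀ χ : MulChar (ZMod p) ℂ,
    ∃ e : ℕ, ω ^ e = χ := by
  obtain ⟨e⟩ := MulChar.mulEquiv_units (ZMod p) ℂ
  have : IsCyclic (MulChar (ZMod p) ℂ) := isCyclic_of_surjective e.symm e.symm.surjective
  obtain ⟨ω, hω⟩ := IsCyclic.exists_generator (α := MulChar (ZMod p) ℂ)
  refine ⟨ω, fun χ => ?_⟩
  have h := hω χ
  rw [← mem_powers_iff_mem_zpowers] at h
  exact h

theorem count_aroots_comp (f : (ZMod p)[X]) (ρ : Kbar p) (c : ZMod p) :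
    ((f.comp (X + C c)).aroots (Kbar p)).count ρ =
      (f.aroots (Kbar p)).count (ρ + algebraMap (ZMod p) (Kbar p) c) := by
  rw [aroots_def, aroots_def, count_roots, count_roots, Polynomial.map_comp,
    rootMultiplicity_eq_rootMultiplicity (t := ρ),
    rootMultiplicity_eq_rootMultiplicity (t := ρ + algebraMap (ZMod p) (Kbar p) c), comp_assoc]
  congr 2
  simp only [Polynomial.map_add, map_X, map_C, add_comp, X_comp, C_comp, C_add]
  ring

theorem count_aroots_prod_pow {ι : Type*} [Fintype ι] {F : ι → (ZMod p)[X]} (hF : ∀ i, F i ≠ 0)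
    (e : ι → ℕ) (ρ : Kbar p) :
    ((∏ i, F i ^ e i).aroots (Kbar p)).count ρ =
      ∑ i, e i * ((F i).aroots (Kbar p)).count ρ := by
  have hne : ∏ i, ((F i ^ e i).map (algebraMap (ZMod p) (Kbar p))) ≠ 0 :=
    prod_ne_zero_iff.2 fun i _ => (Polynomial.map_ne_zero_iff
      (algebraMap (ZMod p) (Kbar p)).injective).2 (pow_ne_zero _ (hF i))
  rw [aroots_def, Polynomial.map_prod, roots_prod _ _ hne, Multiset.count_bind]
  refine sum_congr rfl fun i _ => ?_
  rw [Polynomial.map_pow, roots_pow, Multiset.count_nsmul]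

/-- The Weil bound for a product of several characters at translates of a polynomial. -/
theorem weil_bound_prod {k : ℕ} {d : Fin k → ZMod p} {f : (ZMod p)[X]} (hf : f ≠ 0)
    {χ : Fin k → MulChar (ZMod p) ℂ} (hχ : ∀ j, χ j ≠ 1)
    (hns : ∀ j, ∀ r ∈ f.aroots (Kbar p), χ j ^ (f.aroots (Kbar p)).count r ≠ 1)
    (huniq : ∃ ρ : Kbar p, ∃ j, aeval (ρ + algebraMap (ZMod p) (Kbar p) (d j)) f = 0 ∧
      ∀ j', aeval (ρ + algebraMap (ZMod p) (Kbar p) (d j')) f = 0 → j' = j)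
    (ψ : AddChar (ZMod p) ℂ) :
    ‖∑ x : ZMod p, (∏ j, χ j (f.eval (x + d j))) * ψ x‖ ≤ k * f.natDegree * Real.sqrt p := by
  obtain ⟨ω, hω⟩ := exists_mulChar_pow_eq (p := p)
  choose e he using fun j => hω (χ j)
  have he0 : ∀ j, e j ≠ 0 := fun j h0 => hχ j (by rw [← he j, h0, pow_zero])
  have hcomp : ∀ j, f.comp (X + C (d j)) ≠ 0 := fun j => (comp_X_add_C_ne_zero_iff).2 hf
  have hev : ∀ x, ω ((∏ j, f.comp (X + C (d j)) ^ e j).eval x) =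
      ∏ j, χ j (f.eval (x + d j)) := by
    intro x
    rw [eval_prod, map_prod]
    refine prod_congr rfl fun j _ => ?_
    rw [eval_pow, map_pow, ← MulChar.pow_apply' _ (he0 j), he j, eval_comp]
    simp
  obtain ⟨ρ, j₀, hρ, hρu⟩ := huniq
  have hmain := weil_bound (χ := ω) ψ (f := ∏ j, f.comp (X + C (d j)) ^ e j)
    (H := ∏ j, f.comp (X + C (d j)))
    (prod_ne_zero_iff.2 fun j _ => pow_ne_zero _ (hcomp j))
    ⟨ρ, by
      rw [count_aroots_prod_pow hcomp, sum_eq_single j₀ (fun j _ hj => ?_) (by simp),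
        count_aroots_comp, pow_mul, he j₀]
      · exact hns j₀ _ (mem_aroots.2 ⟨hf, hρ⟩)
      · rw [count_aroots_comp, Multiset.count_eq_zero_of_notMem, mul_zero]
        exact fun h => hj (hρu j (mem_aroots.1 h).2)⟩
    (prod_ne_zero_iff.2 fun j _ => hcomp j)
    (fun r => by
      simp only [map_prod, map_pow, prod_eq_zero_iff]
      refine exists_congr fun j => and_congr_right fun _ => ?_
      exact pow_eq_zero_iff (he0 j))
  simp only [hev] at hmain
  refine hmain.trans_eq ?_
  rw [natDegree_prod _ _ fun j _ => hcomp j]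
  simp [natDegree_comp]

end ProductWeil

section RootsOfUnity

theorem two_div_norm_one_sub_pow_le {N j : ℕ} (hj : 0 < j) (hjN : j < N) :
    2 / ‖1 - Complex.exp (2 * Real.pi * Complex.I / N) ^ j‖ ≤
      N / 2 * ((j : ℝ)⁻¹ + ((N - j : ℕ) : ℝ)⁻¹) := by
  have hN : (0 : ℝ) < N := by exact_mod_cast hj.trans hjN
  have hj0 : (0 : ℝ) < j := by exact_mod_cast hj
  have hjN' : (0 : ℝ) < (N - j : ℕ) := by exact_mod_cast Nat.sub_pos_of_lt hjN
  have hcast : ((N - j : ℕ) : ℝ) = N - j := Nat.cast_sub hjN.le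
  have hpi := Real.pi_pos
  have hnorm : ‖1 - Complex.exp (2 * Real.pi * Complex.I / N) ^ j‖ =
      2 * |Real.sin (Real.pi * j / N)| := by
    rw [norm_sub_rev, ← Complex.exp_nat_mul]
    have h := Complex.norm_exp_I_mul_ofReal_sub_one (2 * (Real.pi * j / N))
    rw [mul_div_cancel_left₀ _ (two_ne_zero' ℝ), norm_mul, Real.norm_eq_abs, Real.norm_eq_abs,
      abs_two] at h
    rw [← h]
    congr 3
    push_cast
    ring
  have key : ∀ i : ℝ, 0 < i → i ≤ N / 2 → 2 * i / N ≤ Real.sin (Real.pi * i / N) := by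
    intro i h0 h2
    have h := Real.mul_le_sin (x := Real.pi * i / N) (by positivity) (by
      rw [div_le_iff₀ hN]
      nlinarith)
    refine le_trans (le_of_eq ?_) h
    field_simp
  have hfin : ∀ i : ℝ, 0 < i → 2 * i / N ≤ |Real.sin (Real.pi * j / N)| →
      2 / ‖1 - Complex.exp (2 * Real.pi * Complex.I / N) ^ j‖ ≤ N / 2 * i⁻¹ := by
    intro i hi h
    rw [hnorm, div_mul_eq_div_div, div_self (two_ne_zero' ℝ)]
    calc 1 / |Real.sin (Real.pi * j / N)| ≤ 1 / (2 * i / N) :=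
          one_div_le_one_div_of_le (by positivity) h
      _ = N / 2 * i⁻¹ := by field_simp
  rcases le_total (j : ℝ) (N / 2) with h | h
  · refine (hfin j hj0 ((key j hj0 h).trans (le_abs_self _))).trans ?_
    gcongr
    linarith [inv_pos.2 hjN']
  · refine (hfin (N - j : ℕ) hjN' ?_).trans ?_
    · have h1 := key (N - j : ℕ) hjN' (by rw [hcast]; linarith)
      refine h1.trans (le_trans (le_of_eq ?_) (le_abs_self _))
      rw [← Real.sin_pi_sub, hcast]
      congr 1
      field_simp
      ring
    · gcongr
      linarith [inv_pos.2 hj0]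

theorem sum_two_div_norm_one_sub_le {N : ℕ} (hN : 0 < N) {Z : Finset ℂ}
    (hZ : ∀ z ∈ Z, z ^ N = 1 ∧ z ≠ 1) :
    ∑ z ∈ Z, 2 / ‖1 - z‖ ≤ N * (1 + Real.log N) := by
  have : NeZero N := ⟨hN.ne'⟩
  have hζ := Complex.isPrimitiveRoot_exp N hN.ne'
  set ζ := Complex.exp (2 * Real.pi * Complex.I / N) with hζdef
  have hsub : Z ⊆ (range (N - 1)).image fun i => ζ ^ (i + 1) := by
    intro z hz
    obtain ⟨h1, h2⟩ := hZ z hz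
    obtain ⟨j, hj, rfl⟩ := hζ.eq_pow_of_pow_eq_one h1
    have hj0 : j ≠ 0 := by rintro rfl; simp at h2
    exact mem_image.2 ⟨j - 1, mem_range.2 (by omega), by rw [Nat.sub_add_cancel (by omega)]⟩
  have hinj : Set.InjOn (fun i => ζ ^ (i + 1)) (range (N - 1) : Set ℕ) := by
    intro i hi j hj hij
    rw [mem_coe, mem_range] at hi hj
    have := hζ.pow_inj (by omega) (by omega) hij
    omega
  calc ∑ z ∈ Z, 2 / ‖1 - z‖
      ≤ ∑ z ∈ (range (N - 1)).image fun i => ζ ^ (i + 1), 2 / ‖1 - z‖ :=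
        sum_le_sum_of_subset_of_nonneg hsub fun _ _ _ => by positivity
    _ = ∑ i ∈ range (N - 1), 2 / ‖1 - ζ ^ (i + 1)‖ := sum_image hinj
    _ ≤ ∑ i ∈ range (N - 1),
          (N / 2 * ((i + 1 : ℕ) : ℝ)⁻¹ + N / 2 * (((N - 1 - 1 - i) + 1 : ℕ) : ℝ)⁻¹) := by
        refine sum_le_sum fun i hi => ?_
        rw [mem_range] at hi
        have h := two_div_norm_one_sub_pow_le (N := N) (j := i + 1) (by omega) (by omega)
        rw [mul_add, (by omega : N - (i + 1) = N - 1 - 1 - i + 1)] at h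
        exact h
    _ = N * ∑ i ∈ range (N - 1), ((i + 1 : ℕ) : ℝ)⁻¹ := by
        rw [sum_add_distrib, sum_range_reflect (fun i => (N : ℝ) / 2 * ((i + 1 : ℕ) : ℝ)⁻¹),
          ← mul_sum]
        ring
    _ = N * (harmonic (N - 1) : ℝ) := by simp [harmonic]
    _ ≤ N * (1 + Real.log N) := by
        gcongr
        refine (harmonic_le_one_add_log _).trans ?_
        rcases Nat.eq_zero_or_pos (N - 1) with h0 | h0
        · rw [h0, Nat.cast_zero, Real.log_zero]
          linarith [Real.log_natCast_nonneg N]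
        · gcongr
          omega

theorem norm_geom_sum_le {z : ℂ} (hz : ‖z‖ = 1) (hz1 : z ≠ 1) (n : ℕ) :
    ‖∑ i ∈ range n, z ^ i‖ ≤ 2 / ‖1 - z‖ := by
  have h0 : 0 < ‖1 - z‖ := norm_pos_iff.2 (sub_ne_zero.2 hz1.symm)
  rw [le_div_iff₀ h0, mul_comm, ← norm_mul, mul_neg_geom_sum]
  refine (norm_sub_le _ _).trans ?_
  rw [norm_one, norm_pow, hz, one_pow]
  norm_num

/-- Geometric sums over distinct nontrivial roots of unity are small on average. -/
theorem sum_norm_geom_sum_le {ι : Type*} {N : ℕ} (hN : 0 < N) (S : Finset ι) (z : ι → ℂ)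
    (hinj : Set.InjOn z S) (hz : ∀ i ∈ S, z i ^ N = 1 ∧ z i ≠ 1) (n : ℕ) :
    ∑ i ∈ S, ‖∑ j ∈ range n, z i ^ j‖ ≤ N * (1 + Real.log N) := by
  classical
  calc ∑ i ∈ S, ‖∑ j ∈ range n, z i ^ j‖ ≤ ∑ i ∈ S, 2 / ‖1 - z i‖ :=
        sum_le_sum fun i hi => norm_geom_sum_le
          (Complex.norm_eq_one_of_pow_eq_one (hz i hi).1 hN.ne') (hz i hi).2 n
    _ = ∑ w ∈ S.image z, 2 / ‖1 - w‖ := (sum_image (f := fun w : ℂ => 2 / ‖1 - w‖) hinj).symm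
    _ ≤ N * (1 + Real.log N) := sum_two_div_norm_one_sub_le hN fun w hw => by
        obtain ⟨i, hi, rfl⟩ := mem_image.1 hw
        exact hz i hi

end RootsOfUnity

section Completing

variable {p : ℕ} [Fact p.Prime]

theorem addChar_apply_natCast (ψ : AddChar (ZMod p) ℂ) (a : ZMod p) (n : ℕ) :
    ψ (n * a) = ψ a ^ n := by
  rw [← nsmul_eq_mul, AddChar.map_nsmul_eq_pow]

theorem addChar_pow_char (ψ : AddChar (ZMod p) ℂ) (a : ZMod p) : ψ a ^ p = 1 := by
  rw [← addChar_apply_natCast]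
  simp

theorem addChar_eq_of_apply_neg_one {ψ φ : AddChar (ZMod p) ℂ} (h : ψ (-1) = φ (-1)) : ψ = φ := by
  ext x
  have hx : x = ((-x).val : ℕ) * (-1 : ZMod p) := by
    rw [ZMod.natCast_zmod_val]; ring
  rw [hx, addChar_apply_natCast, addChar_apply_natCast, h]

/-- An incomplete sum is controlled by the complete sums twisted by additive characters. -/
theorem norm_incomplete_sum_le (F : ZMod p → ℂ) {B : ℝ}
    (hB : ∀ ψ : AddChar (ZMod p) ℂ, ‖∑ x, F x * ψ x‖ ≤ B) {M : ℕ} (hM : M ≤ p) :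
    ‖∑ n ∈ range M, F n‖ ≤ (2 + Real.log p) * B := by
  have hp0 : (0 : ℝ) < p := by exact_mod_cast (Fact.out : p.Prime).pos
  have hB0 : 0 ≤ B := (norm_nonneg _).trans (hB 0)
  have hid : (p : ℂ) * ∑ n ∈ range M, F n =
      ∑ ψ : AddChar (ZMod p) ℂ, (∑ n ∈ range M, ψ (-1) ^ n) * ∑ x, F x * ψ x := by
    have h1 : ∀ n : ℕ, (p : ℂ) * F n = ∑ x, F x * ∑ ψ : AddChar (ZMod p) ℂ, ψ (x - n) := by
      intro n
      simp_rw [AddChar.sum_apply_eq_ite, sub_eq_zero, ZMod.card]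
      simp [mul_comm]
    rw [mul_sum]
    simp_rw [h1, mul_sum, sum_mul]
    rw [sum_congr rfl fun n _ => sum_comm, sum_comm]
    refine sum_congr rfl fun ψ _ => ?_
    rw [sum_comm]
    refine sum_congr rfl fun x _ => sum_congr rfl fun n _ => ?_
    rw [sub_eq_add_neg, AddChar.map_add_eq_mul, ← mul_neg_one (n : ZMod p), addChar_apply_natCast]
    ring
  have hsum : ∑ ψ : AddChar (ZMod p) ℂ, ‖∑ n ∈ range M, ψ (-1) ^ n‖ ≤ p * (2 + Real.log p) := by
    rw [← add_sum_erase univ _ (mem_univ (0 : AddChar (ZMod p) ℂ))]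
    have h1 := sum_norm_geom_sum_le (Fact.out : p.Prime).pos
      (univ.erase (0 : AddChar (ZMod p) ℂ)) (fun ψ => ψ (-1))
      (fun ψ _ φ _ h => addChar_eq_of_apply_neg_one h)
      (fun ψ hψ => ⟨addChar_pow_char _ _, fun h => (mem_erase.1 hψ).1
        (addChar_eq_of_apply_neg_one (by rw [h, AddChar.zero_apply]))⟩) M
    have h2 : ‖∑ n ∈ range M, (0 : AddChar (ZMod p) ℂ) (-1) ^ n‖ ≤ p := by
      simpa using hM
    linarith
  have h3 : (p : ℝ) * ‖∑ n ∈ range M, F n‖ ≤ p * (2 + Real.log p) * B := by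
    have h4 := congrArg norm hid
    rw [norm_mul, Complex.norm_natCast] at h4
    rw [h4]
    refine (norm_sum_le _ _).trans ?_
    calc _ ≤ ∑ ψ : AddChar (ZMod p) ℂ, ‖∑ n ∈ range M, ψ (-1) ^ n‖ * B :=
          sum_le_sum fun ψ _ => by
            rw [norm_mul]
            exact mul_le_mul_of_nonneg_left (hB ψ) (norm_nonneg _)
      _ ≤ _ := by
          rw [← sum_mul]
          exact mul_le_mul_of_nonneg_right hsum hB0
  rw [mul_assoc] at h3
  exact le_of_mul_le_mul_left h3 hp0

end Completing

section Coefficients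

variable {p : ℕ} [Fact p.Prime]

/-- The elements whose index to the base `g` has a representative in `[r, r + s)`. -/
def HasIndexIn (g : (ZMod p)ˣ) (r : ℤ) (s : ℕ) (y : ZMod p) : Prop :=
  ∃ h : ℤ, r ≤ h ∧ h < r + s ∧ ((g ^ h : (ZMod p)ˣ) : ZMod p) = y

/-- The coefficients of the expansion of the indicator of `HasIndexIn` into characters. -/
noncomputable def idxCoeff (g : (ZMod p)ˣ) (r : ℤ) (s : ℕ) (χ : MulChar (ZMod p) ℂ) : ℂ :=
  (∑ i ∈ range s, χ⁻¹ ((g ^ (r + i) : (ZMod p)ˣ) : ZMod p)) / (p - 1 : ℕ)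

theorem natCast_sub_one_pos : (0 : ℝ) < (p - 1 : ℕ) := by
  have := (Fact.out : p.Prime).two_le
  exact_mod_cast (by omega : 0 < p - 1)

open scoped Classical in
theorem sum_idxCoeff_mul {g : (ZMod p)ˣ} (hg : orderOf g = p - 1) (r : ℤ) {s : ℕ} (hs : s < p)
    (y : ZMod p) :
    ∑ χ : MulChar (ZMod p) ℂ, idxCoeff g r s χ * χ y = if HasIndexIn g r s y then 1 else 0 := by
  have hp1 : ((p - 1 : ℕ) : ℂ) ≠ 0 := by
    have := natCast_sub_one_pos (p := p)
    exact_mod_cast this.ne'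
  have h1 : ∀ i : ℕ, ∑ χ : MulChar (ZMod p) ℂ, χ⁻¹ ((g ^ (r + i) : (ZMod p)ˣ) : ZMod p) * χ y =
      if ((g ^ (r + i) : (ZMod p)ˣ) : ZMod p) = y then ((p - 1 : ℕ) : ℂ) else 0 := by
    intro i
    have h := DirichletCharacter.sum_char_inv_mul_char_eq ℂ (g ^ (r + i)).isUnit y
    rw [Nat.totient_prime Fact.out] at h
    rw [← h]
    exact Fintype.sum_congr _ _ fun χ => by rw [MulChar.inv_apply']
  have h2 : ∑ χ : MulChar (ZMod p) ℂ, idxCoeff g r s χ * χ y =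
      ∑ i ∈ range s, if ((g ^ (r + i) : (ZMod p)ˣ) : ZMod p) = y then (1 : ℂ) else 0 := by
    calc ∑ χ : MulChar (ZMod p) ℂ, idxCoeff g r s χ * χ y
        = (∑ i ∈ range s, ∑ χ : MulChar (ZMod p) ℂ,
            χ⁻¹ ((g ^ (r + i) : (ZMod p)ˣ) : ZMod p) * χ y) / (p - 1 : ℕ) := by
          rw [sum_comm, sum_div]
          refine sum_congr rfl fun χ _ => ?_
          rw [idxCoeff, ← sum_mul]
          ring
      _ = _ := by
          rw [sum_div]
          refine sum_congr rfl fun i _ => ?_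
          rw [h1]
          split_ifs
          · exact div_self hp1
          · exact zero_div _
  rw [h2]
  split_ifs with h
  · obtain ⟨h, hr, hrs, rfl⟩ := h
    obtain ⟨i, hi⟩ := Int.eq_ofNat_of_zero_le (sub_nonneg.2 hr)
    have hh : h = r + i := by linarith
    subst hh
    rw [sum_eq_single i]
    · simp
    · intro j hj hji
      rw [if_neg]
      intro heq
      rw [Units.val_inj, zpow_add, zpow_add, mul_right_inj, zpow_natCast, zpow_natCast] at heq
      rw [mem_range] at hj
      exact hji (pow_injOn_Iio_orderOf (by rw [hg]; simp only [Set.mem_Iio]; omega)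
        (by rw [hg]; simp only [Set.mem_Iio]; omega) heq)
    · intro hi'
      exact absurd (mem_range.2 (by omega)) hi'
  · refine sum_eq_zero fun i hi => if_neg fun hi' => h ⟨r + i, by omega, ?_, hi'⟩
    have := mem_range.1 hi
    omega

theorem idxCoeff_one (g : (ZMod p)ˣ) (r : ℤ) (s : ℕ) :
    idxCoeff g r s 1 = s / (p - 1 : ℕ) := by
  rw [idxCoeff, inv_one]
  simp_rw [MulChar.one_apply_coe]
  simp

theorem mem_zpowers_of_orderOf {g : (ZMod p)ˣ} (hg : orderOf g = p - 1) (x : (ZMod p)ˣ) :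
    x ∈ Subgroup.zpowers g := by
  rw [Subgroup.eq_top_of_card_eq (Subgroup.zpowers g)
    (by rw [Nat.card_zpowers, hg, Nat.card_eq_fintype_card, ZMod.card_units])]
  exact Subgroup.mem_top x

theorem sum_norm_idxCoeff_le {g : (ZMod p)ˣ} (hg : orderOf g = p - 1) (r : ℤ) (s : ℕ) {N : ℕ}
    (hN : 0 < N) {S : Finset (MulChar (ZMod p) ℂ)} (hS : ∀ χ ∈ S, χ ^ N = 1 ∧ χ ≠ 1) :
    ∑ χ ∈ S, ‖idxCoeff g r s χ‖ ≤ N * (1 + Real.log N) / (p - 1 : ℕ) := by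
  have hgen := mem_zpowers_of_orderOf hg
  have heq : ∀ χ : MulChar (ZMod p) ℂ, ‖idxCoeff g r s χ‖ =
      ‖∑ i ∈ range s, χ⁻¹ (g : ZMod p) ^ i‖ / (p - 1 : ℕ) := by
    intro χ
    rw [idxCoeff, norm_div, Complex.norm_natCast]
    congr 1
    have : ∀ i : ℕ, χ⁻¹ ((g ^ (r + i) : (ZMod p)ˣ) : ZMod p) =
        χ⁻¹ ((g ^ r : (ZMod p)ˣ) : ZMod p) * χ⁻¹ (g : ZMod p) ^ i := by
      intro i
      rw [zpow_add, zpow_natCast, Units.val_mul, map_mul, Units.val_pow_eq_pow_val, map_pow]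
    simp_rw [this]
    rw [← mul_sum, norm_mul]
    erw [DirichletCharacter.unit_norm_eq_one]
    rw [one_mul]
  simp_rw [heq]
  rw [← sum_div]
  refine div_le_div_of_nonneg_right ?_ (Nat.cast_nonneg _)
  refine sum_norm_geom_sum_le hN S (fun χ => χ⁻¹ (g : ZMod p)) (fun χ _ η _ h => ?_)
    (fun χ hχ => ⟨?_, fun h => (hS χ hχ).2 ?_⟩) s
  · exact inv_injective ((MulChar.eq_iff hgen _ _).2 h)
  · rw [← MulChar.pow_apply' _ hN.ne', inv_pow, (hS χ hχ).1, inv_one, MulChar.one_apply_coe]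
  · rw [← inv_eq_one, MulChar.eq_iff hgen, MulChar.one_apply_coe]
    exact h

theorem sum_norm_idxCoeff_ne_one_le {g : (ZMod p)ˣ} (hg : orderOf g = p - 1) (r : ℤ) (s : ℕ)
    {S : Finset (MulChar (ZMod p) ℂ)} (hS : ∀ χ ∈ S, χ ≠ 1) :
    ∑ χ ∈ S, ‖idxCoeff g r s χ‖ ≤ 1 + Real.log p := by
  have hp := (Fact.out : p.Prime).two_le
  have hp1 := natCast_sub_one_pos (p := p)
  refine (sum_norm_idxCoeff_le hg r s (N := p - 1) (by omega)
    fun χ hχ => ⟨?_, hS χ hχ⟩).trans ?_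
  · rw [← ZMod.card_units]
    exact MulChar.pow_card_eq_one χ
  · rw [mul_div_cancel_left₀ _ hp1.ne']
    gcongr
    omega

open scoped Classical in
/-- The nontrivial characters for which the Weil bound at `f` may fail. -/
noncomputable def specialChars (f : (ZMod p)[X]) : Finset (MulChar (ZMod p) ℂ) :=
  univ.filter fun χ => χ ≠ 1 ∧ ∃ r ∈ f.aroots (Kbar p), χ ^ (f.aroots (Kbar p)).count r = 1

theorem sum_norm_idxCoeff_special_le {g : (ZMod p)ˣ} (hg : orderOf g = p - 1) (r : ℤ) (s : ℕ)
    {f : (ZMod p)[X]} (hfp : f.natDegree < p) :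
    ∑ χ ∈ specialChars f, ‖idxCoeff g r s χ‖ ≤
      f.natDegree * (1 + Real.log p) / (p - 1 : ℕ) := by
  classical
  have hp1 := natCast_sub_one_pos (p := p)
  set m := f.aroots (Kbar p) with hm
  have hcard : Multiset.card m ≤ f.natDegree := (card_roots' _).trans natDegree_map_le
  calc ∑ χ ∈ specialChars f, ‖idxCoeff g r s χ‖
      ≤ ∑ χ ∈ specialChars f, ∑ x ∈ m.toFinset,
          if χ ^ m.count x = 1 then ‖idxCoeff g r s χ‖ else 0 := by
        refine sum_le_sum fun χ hχ => ?_
        obtain ⟨-, x, hx, hχx⟩ := (mem_filter.1 hχ).2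
        refine le_trans (by rw [if_pos hχx]) (single_le_sum
          (f := fun x => if χ ^ m.count x = 1 then ‖idxCoeff g r s χ‖ else 0) (fun y _ => ?_)
          (Multiset.mem_toFinset.2 hx))
        split_ifs
        · exact norm_nonneg _
        · exact le_rfl
    _ = ∑ x ∈ m.toFinset, ∑ χ ∈ (specialChars f).filter (fun χ => χ ^ m.count x = 1),
          ‖idxCoeff g r s χ‖ := by
        rw [sum_comm]
        exact sum_congr rfl fun x _ => (sum_filter _ _).symm
    _ ≤ ∑ x ∈ m.toFinset, m.count x * (1 + Real.log p) / (p - 1 : ℕ) := by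
        refine sum_le_sum fun x hx => ?_
        have hpos := Multiset.count_pos.2 (Multiset.mem_toFinset.1 hx)
        refine (sum_norm_idxCoeff_le hg r s hpos fun χ hχ =>
          ⟨(mem_filter.1 hχ).2, (mem_filter.1 (mem_filter.1 hχ).1).2.1⟩).trans ?_
        gcongr
        exact ((Multiset.count_le_card x m).trans hcard).trans hfp.le
    _ = Multiset.card m * (1 + Real.log p) / (p - 1 : ℕ) := by
        rw [← sum_div, ← sum_mul, ← Nat.cast_sum, Multiset.toFinset_sum_count_eq]
    _ ≤ f.natDegree * (1 + Real.log p) / (p - 1 : ℕ) := by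
        have := Real.log_natCast_nonneg p
        gcongr

end Coefficients

section CardBound

variable {p : ℕ} [Fact p.Prime]

theorem notMem_specialChars {f : (ZMod p)[X]} {χ : MulChar (ZMod p) ℂ} (hχ : χ ≠ 1) :
    χ ∉ specialChars f ↔ ∀ r ∈ f.aroots (Kbar p), χ ^ (f.aroots (Kbar p)).count r ≠ 1 := by
  simp [specialChars, hχ]

theorem norm_sum_mulChar_le {f : (ZMod p)[X]} (hf : 1 ≤ f.natDegree) {χ : MulChar (ZMod p) ℂ}
    (hχ : χ ≠ 1) (hns : χ ∉ specialChars f) :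
    ‖∑ x : ZMod p, χ (f.eval x)‖ ≤ f.natDegree * Real.sqrt p := by
  have hf0 : f ≠ 0 := by rintro rfl; simp at hf
  obtain ⟨r, hr⟩ := IsAlgClosed.exists_aeval_eq_zero (Kbar p) f
    (natDegree_pos_iff_degree_pos.1 hf).ne'
  have h := weil_bound (χ := χ) (0 : AddChar (ZMod p) ℂ) hf0
    ⟨r, (notMem_specialChars hχ).1 hns r (mem_aroots.2 ⟨hf0, hr⟩)⟩ hf0 fun _ => Iff.rfl
  simpa [AddChar.zero_apply] using h

theorem norm_sum_mulChar_le_card (f : (ZMod p)[X]) (χ : MulChar (ZMod p) ℂ) :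
    ‖∑ x : ZMod p, χ (f.eval x)‖ ≤ p :=
  (norm_sum_le_of_le _ fun x _ => DirichletCharacter.norm_le_one χ (f.eval x)).trans
    (by simp [ZMod.card])

open scoped Classical in
theorem sum_ne_one_idxCoeff_mul {g : (ZMod p)ˣ} (hg : orderOf g = p - 1) (r : ℤ) {s : ℕ}
    (hs : s < p) (y : ZMod p) :
    ∑ χ ∈ univ.erase (1 : MulChar (ZMod p) ℂ), idxCoeff g r s χ * χ y =
      (((if HasIndexIn g r s y then 1 else 0) -
        (if y = 0 then 0 else (s : ℝ) / (p - 1 : ℕ)) : ℝ) : ℂ) := by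
  have h := sum_idxCoeff_mul hg r hs y
  rw [← add_sum_erase univ _ (mem_univ (1 : MulChar (ZMod p) ℂ)), idxCoeff_one] at h
  have h1 : (1 : MulChar (ZMod p) ℂ) y = if y = 0 then 0 else 1 := by
    split_ifs with hy
    · rw [hy]
      exact MulChar.map_zero 1
    · exact MulChar.one_apply (isUnit_iff_ne_zero.2 hy)
  rw [h1] at h
  rw [← sub_eq_iff_eq_add'.2 h.symm]
  split_ifs <;> push_cast <;> simp

theorem card_zeros_le {f : (ZMod p)[X]} (hf : 1 ≤ f.natDegree) :
    #(univ.filter fun x : ZMod p => f.eval x = 0) ≤ f.natDegree := by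
  have hf0 : f ≠ 0 := by rintro rfl; simp at hf
  refine le_trans (card_le_card fun x hx => ?_)
    ((Multiset.toFinset_card_le f.roots).trans (card_roots' f))
  rw [Multiset.mem_toFinset, mem_roots hf0]
  exact (mem_filter.1 hx).2

theorem sum_norm_idxCoeff_mul_le {g : (ZMod p)ˣ} (hg : orderOf g = p - 1) (r : ℤ) (s : ℕ)
    {f : (ZMod p)[X]} (hf : 1 ≤ f.natDegree) (hfp : f.natDegree < p) :
    ∑ χ ∈ univ.erase (1 : MulChar (ZMod p) ℂ),
        ‖idxCoeff g r s χ‖ * ‖∑ x : ZMod p, χ (f.eval x)‖ ≤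
      3 * f.natDegree * Real.sqrt p * (1 + Real.log p) := by
  classical
  have hp2 := (Fact.out : p.Prime).two_le
  have hp1 := natCast_sub_one_pos (p := p)
  have hcast : ((p - 1 : ℕ) : ℝ) = p - 1 := by rw [Nat.cast_sub (by omega), Nat.cast_one]
  have hsqrt : 1 ≤ Real.sqrt p := Real.one_le_sqrt.2 (by exact_mod_cast (by omega : 1 ≤ p))
  have hL : 0 ≤ 1 + Real.log p := by linarith [Real.log_natCast_nonneg p]
  have hpt : ∀ χ ∈ univ.erase (1 : MulChar (ZMod p) ℂ),
      ‖idxCoeff g r s χ‖ * ‖∑ x : ZMod p, χ (f.eval x)‖ ≤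
        ‖idxCoeff g r s χ‖ * (f.natDegree * Real.sqrt p) +
          if χ ∈ specialChars f then ‖idxCoeff g r s χ‖ * p else 0 := by
    intro χ hχ
    split_ifs with h
    · have := mul_le_mul_of_nonneg_left (norm_sum_mulChar_le_card f χ)
        (norm_nonneg (idxCoeff g r s χ))
      have : 0 ≤ ‖idxCoeff g r s χ‖ * (f.natDegree * Real.sqrt p) := by positivity
      linarith
    · rw [add_zero]
      exact mul_le_mul_of_nonneg_left (norm_sum_mulChar_le hf (mem_erase.1 hχ).1 h) (norm_nonneg _)
  refine (sum_le_sum hpt).trans ?_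
  rw [sum_add_distrib, ← sum_mul, ← sum_filter, ← sum_mul]
  have h1 := sum_norm_idxCoeff_ne_one_le hg r s (S := univ.erase (1 : MulChar (ZMod p) ℂ))
    fun χ hχ => (mem_erase.1 hχ).1
  have h2 : ∑ χ ∈ (univ.erase (1 : MulChar (ZMod p) ℂ)).filter (· ∈ specialChars f),
      ‖idxCoeff g r s χ‖ ≤ f.natDegree * (1 + Real.log p) / (p - 1 : ℕ) :=
    (sum_le_sum_of_subset_of_nonneg (fun χ hχ => (mem_filter.1 hχ).2)
      fun _ _ _ => norm_nonneg _).trans (sum_norm_idxCoeff_special_le hg r s hfp)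
  have h3 : f.natDegree * (1 + Real.log p) / (p - 1 : ℕ) * p ≤
      2 * (f.natDegree * (1 + Real.log p)) := by
    rw [div_mul_eq_mul_div, div_le_iff₀ hp1, hcast]
    have : (2 : ℝ) ≤ p := by exact_mod_cast hp2
    have : 0 ≤ f.natDegree * (1 + Real.log p) := by positivity
    nlinarith
  have h4 := mul_le_mul_of_nonneg_right h1
    (by positivity : 0 ≤ (f.natDegree : ℝ) * Real.sqrt p)
  have h5 := mul_le_mul_of_nonneg_right h2 (Nat.cast_nonneg (α := ℝ) p)
  have h6 : (f.natDegree : ℝ) * (1 + Real.log p) ≤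
      f.natDegree * (1 + Real.log p) * Real.sqrt p :=
    le_mul_of_one_le_right (by positivity) hsqrt
  linarith

open scoped Classical in
theorem abs_card_hasIndexIn_sub_le {g : (ZMod p)ˣ} (hg : orderOf g = p - 1) (r : ℤ) {s : ℕ}
    (hs : s < p) {f : (ZMod p)[X]} (hf : 1 ≤ f.natDegree) (hfp : f.natDegree < p) :
    |(#(univ.filter fun x : ZMod p => HasIndexIn g r s (f.eval x)) : ℝ) - s| ≤
      4 * f.natDegree * Real.sqrt p * (1 + Real.log p) := by
  have hp2 := (Fact.out : p.Prime).two_le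
  have hp1 := natCast_sub_one_pos (p := p)
  have hcast : ((p - 1 : ℕ) : ℝ) = p - 1 := by rw [Nat.cast_sub (by omega), Nat.cast_one]
  have hsqrt : 1 ≤ Real.sqrt p := Real.one_le_sqrt.2 (by exact_mod_cast (by omega : 1 ≤ p))
  have hlog := Real.log_natCast_nonneg p
  set R := univ.filter fun x : ZMod p => HasIndexIn g r s (f.eval x)
  set Z := univ.filter fun x : ZMod p => f.eval x = 0 with hZ
  have hz : ∀ c : ℝ, ∑ x : ZMod p, (if f.eval x = 0 then 0 else c) = (p - #Z) * c := by
    intro c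
    have h : ∀ x : ZMod p, (if f.eval x = 0 then 0 else c) =
        c - c * if f.eval x = 0 then 1 else 0 := by
      intro x
      split_ifs <;> simp
    simp_rw [h]
    rw [sum_sub_distrib, ← mul_sum, sum_boole, sum_const, card_univ, ZMod.card, nsmul_eq_mul, hZ]
    ring
  have hid : ∑ χ ∈ univ.erase (1 : MulChar (ZMod p) ℂ),
      idxCoeff g r s χ * ∑ x : ZMod p, χ (f.eval x) =
      ((#R - (p - #Z) * (s / (p - 1 : ℕ)) : ℝ) : ℂ) := by
    simp_rw [mul_sum]
    rw [sum_comm]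
    simp_rw [sum_ne_one_idxCoeff_mul hg r hs]
    rw [← Complex.ofReal_sum]
    congr 1
    rw [sum_sub_distrib, sum_boole, hz]
  have hmain : |(#R : ℝ) - (p - #Z) * (s / (p - 1 : ℕ))| ≤
      3 * f.natDegree * Real.sqrt p * (1 + Real.log p) := by
    rw [← Real.norm_eq_abs, ← Complex.norm_real, ← hid]
    refine (norm_sum_le _ _).trans ?_
    simp_rw [norm_mul]
    exact sum_norm_idxCoeff_mul_le hg r s hf hfp
  have hrest : |(p - #Z) * ((s : ℝ) / (p - 1 : ℕ)) - s| ≤ f.natDegree := by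
    have h1 : (p - #Z) * ((s : ℝ) / (p - 1 : ℕ)) - s = (1 - #Z) * (s / (p - 1 : ℕ)) := by
      rw [hcast] at hp1 ⊢
      field_simp
      ring
    have h2 : (s : ℝ) / (p - 1 : ℕ) ≤ 1 := by
      rw [div_le_one hp1]
      exact_mod_cast (by omega : s ≤ p - 1)
    have h3 : |1 - (#Z : ℝ)| ≤ f.natDegree := by
      have h4 : (#Z : ℝ) ≤ f.natDegree := by exact_mod_cast card_zeros_le hf
      have h5 : (1 : ℝ) ≤ f.natDegree := by exact_mod_cast hf
      rw [abs_le]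
      constructor <;> linarith [Nat.cast_nonneg (α := ℝ) #Z]
    rw [h1, abs_mul, abs_of_nonneg (by positivity : 0 ≤ (s : ℝ) / (p - 1 : ℕ))]
    exact (mul_le_of_le_one_right (abs_nonneg _) h2).trans h3
  have htri := abs_sub_le (#R : ℝ) ((p - #Z) * (s / (p - 1 : ℕ))) s
  have hDs : (f.natDegree : ℝ) ≤ f.natDegree * Real.sqrt p * (1 + Real.log p) := by
    rw [mul_assoc]
    refine le_mul_of_one_le_right (by positivity) ?_
    nlinarith
  linarith

end CardBound

section Products

theorem sum_piFinset_prod_mul_le {ι : Type*} [DecidableEq ι] {k : ℕ} {N S : Finset ι} {w : ι → ℝ}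
    (hw : ∀ i, 0 ≤ w i) {T : (Fin k → ι) → ℝ} {A P : ℝ} (hA : 0 ≤ A) (hP : 0 ≤ P)
    (hTA : ∀ x, (∀ j, x j ∈ N) → (∀ j, x j ∉ S) → T x ≤ A) (hTP : ∀ x, T x ≤ P) :
    ∑ x ∈ Fintype.piFinset fun _ : Fin k => N, (∏ j, w (x j)) * T x ≤
      A * (∑ i ∈ N, w i) ^ k + k * (P * ((∑ i ∈ S, w i) * (∑ i ∈ N, w i) ^ (k - 1))) := by
  have hT : ∀ x ∈ Fintype.piFinset fun _ : Fin k => N,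
      T x ≤ A + ∑ j, if x j ∈ S then P else 0 := by
    intro x hx
    have hnn : ∀ j ∈ univ, 0 ≤ if x j ∈ S then P else 0 := fun j _ => by split_ifs <;> simp [hP]
    by_cases h : ∀ j, x j ∉ S
    · exact (hTA x (Fintype.mem_piFinset.1 hx) h).trans (le_add_of_nonneg_right (sum_nonneg hnn))
    · push Not at h
      obtain ⟨j, hj⟩ := h
      have h1 := single_le_sum hnn (mem_univ j)
      rw [if_pos hj] at h1
      linarith [hTP x]
  have hprod : ∀ x : Fin k → ι, 0 ≤ ∏ j, w (x j) := fun x => prod_nonneg fun _ _ => hw _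
  have hj : ∀ j : Fin k, ∑ x ∈ Fintype.piFinset fun _ : Fin k => N,
      (∏ i, w (x i)) * (if x j ∈ S then P else 0) ≤
        P * ((∑ i ∈ S, w i) * (∑ i ∈ N, w i) ^ (k - 1)) := by
    intro j
    calc ∑ x ∈ Fintype.piFinset fun _ : Fin k => N, (∏ i, w (x i)) * (if x j ∈ S then P else 0)
        = P * ∑ x ∈ (Fintype.piFinset fun _ : Fin k => N).filter (fun x => x j ∈ S),
            ∏ i, w (x i) := by
          rw [sum_filter, mul_sum]
          refine sum_congr rfl fun x _ => ?_
          split_ifs <;> ring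
      _ ≤ P * ∑ x ∈ Fintype.piFinset fun i : Fin k => if i = j then S else N, ∏ i, w (x i) := by
          refine mul_le_mul_of_nonneg_left
            (sum_le_sum_of_subset_of_nonneg (fun x hx => ?_) fun x _ _ => hprod x) hP
          rw [mem_filter, Fintype.mem_piFinset] at hx
          refine Fintype.mem_piFinset.2 fun i => ?_
          split_ifs with hij
          · exact hij ▸ hx.2
          · exact hx.1 i
      _ = P * ((∑ i ∈ S, w i) * (∑ i ∈ N, w i) ^ (k - 1)) := by
          rw [← prod_univ_sum (fun i : Fin k => if i = j then S else N) fun _ => w,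
            ← mul_prod_erase univ _ (mem_univ j), if_pos rfl,
            prod_congr rfl fun i hi => by rw [if_neg (mem_erase.1 hi).1], prod_const,
            card_erase_of_mem (mem_univ j), card_univ, Fintype.card_fin]
  calc ∑ x ∈ Fintype.piFinset fun _ : Fin k => N, (∏ j, w (x j)) * T x
      ≤ ∑ x ∈ Fintype.piFinset fun _ : Fin k => N,
          (∏ j, w (x j)) * (A + ∑ j, if x j ∈ S then P else 0) :=
        sum_le_sum fun x hx => mul_le_mul_of_nonneg_left (hT x hx) (hprod x)
    _ = A * (∑ i ∈ N, w i) ^ k + ∑ j : Fin k, ∑ x ∈ Fintype.piFinset fun _ : Fin k => N,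
          (∏ i, w (x i)) * (if x j ∈ S then P else 0) := by
        simp_rw [mul_add, sum_add_distrib, mul_sum]
        congr 1
        · rw [← sum_mul, ← prod_univ_sum (fun _ : Fin k => N) fun _ => w, prod_const, card_univ,
            Fintype.card_fin, mul_comm]
        · exact sum_comm
    _ ≤ _ := by
        gcongr
        refine (sum_le_sum fun j _ => hj j).trans ?_
        rw [sum_const, card_univ, Fintype.card_fin, nsmul_eq_mul]

theorem abs_prod_le_one {ι : Type*} (s : Finset ι) {a : ι → ℝ} (ha : ∀ i, |a i| ≤ 1) :
    |∏ i ∈ s, a i| ≤ 1 := by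
  rw [abs_prod]
  exact prod_le_one (fun _ _ => abs_nonneg _) fun i _ => ha i

theorem abs_prod_sub_prod_le {ι : Type*} (s : Finset ι) {a b : ι → ℝ}
    (ha : ∀ i, |a i| ≤ 1) (hb : ∀ i, |b i| ≤ 1) :
    |∏ i ∈ s, a i - ∏ i ∈ s, b i| ≤ ∑ i ∈ s, |a i - b i| := by
  classical
  induction s using Finset.induction_on with
  | empty => simp
  | insert i s hi ih =>
    rw [prod_insert hi, prod_insert hi, sum_insert hi]
    have h : a i * ∏ j ∈ s, a j - b i * ∏ j ∈ s, b j =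
        (a i - b i) * ∏ j ∈ s, a j + b i * (∏ j ∈ s, a j - ∏ j ∈ s, b j) := by ring
    rw [h]
    refine (abs_add_le _ _).trans (add_le_add ?_ ?_)
    · rw [abs_mul]
      exact mul_le_of_le_one_right (abs_nonneg _) (abs_prod_le_one s ha)
    · rw [abs_mul]
      exact (mul_le_of_le_one_left (abs_nonneg _) (hb i)).trans ih

end Products

section Correlation

variable {p : ℕ} [Fact p.Prime]

theorem one_le_log_of_three_le {n : ℕ} (hn : 3 ≤ n) : 1 ≤ Real.log n := by
  have h3 : (3 : ℝ) ≤ n := by exact_mod_cast hn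
  rw [Real.le_log_iff_exp_le (by linarith)]
  linarith [Real.exp_one_lt_d9]

/-- The oscillating part of the indicator of the points where `f` has index in `[r, r + s)`. -/
noncomputable def oscPart (g : (ZMod p)ˣ) (r : ℤ) (s : ℕ) (f : (ZMod p)[X]) (x : ZMod p) : ℂ :=
  ∑ χ ∈ univ.erase (1 : MulChar (ZMod p) ℂ), idxCoeff g r s χ * χ (f.eval x)

theorem norm_sum_prod_oscPart_le {g : (ZMod p)ˣ} (hg : orderOf g = p - 1) (r : ℤ) {s : ℕ}
    {f : (ZMod p)[X]} (hf : 1 ≤ f.natDegree) (hfp : f.natDegree < p) (hp3 : 3 ≤ p)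
    {k : ℕ} (hk : 0 < k) {d : Fin k → ZMod p}
    (huniq : ∃ ρ : Kbar p, ∃ j, aeval (ρ + algebraMap (ZMod p) (Kbar p) (d j)) f = 0 ∧
      ∀ j', aeval (ρ + algebraMap (ZMod p) (Kbar p) (d j')) f = 0 → j' = j)
    {M : ℕ} (hM : M ≤ p) :
    ‖∑ n ∈ range M, ∏ j, oscPart g r s f (n + d j)‖ ≤
      5 * (f.natDegree * k * 2 ^ k * Real.sqrt p * Real.log p ^ (k + 1)) := by
  classical
  have hf0 : f ≠ 0 := by rintro rfl; simp at hf
  have hp1 := natCast_sub_one_pos (p := p)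
  have hcast : ((p - 1 : ℕ) : ℝ) = p - 1 := by rw [Nat.cast_sub (by omega), Nat.cast_one]
  have hp3' : (3 : ℝ) ≤ p := by exact_mod_cast hp3
  have hlog := one_le_log_of_three_le hp3
  have hsqrt : 1 ≤ Real.sqrt p := Real.one_le_sqrt.2 (by linarith)
  set N := univ.erase (1 : MulChar (ZMod p) ℂ)
  set T : (Fin k → MulChar (ZMod p) ℂ) → ℝ := fun χ =>
    ‖∑ n ∈ range M, ∏ j, χ j (f.eval (n + d j))‖ with hT
  have hid : ∑ n ∈ range M, ∏ j, oscPart g r s f (n + d j) =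
      ∑ χ ∈ Fintype.piFinset fun _ : Fin k => N, (∏ j, idxCoeff g r s (χ j)) *
        ∑ n ∈ range M, ∏ j, χ j (f.eval (n + d j)) := by
    simp_rw [oscPart, prod_univ_sum, mul_sum, prod_mul_distrib]
    exact sum_comm
  have h1 : ‖∑ n ∈ range M, ∏ j, oscPart g r s f (n + d j)‖ ≤
      ∑ χ ∈ Fintype.piFinset fun _ : Fin k => N, (∏ j, ‖idxCoeff g r s (χ j)‖) * T χ := by
    rw [hid]
    refine (norm_sum_le _ _).trans_eq ?_
    simp_rw [norm_mul, norm_prod, hT]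
  have hTP : ∀ χ, T χ ≤ p := by
    intro χ
    refine (norm_sum_le_of_le (range M) (f := fun n : ℕ => ∏ j, χ j (f.eval (n + d j)))
      (n := fun _ => 1) fun n _ => ?_).trans ?_
    · rw [norm_prod]
      exact prod_le_one (fun _ _ => norm_nonneg _) fun j _ => DirichletCharacter.norm_le_one _ _
    · simpa using hM
  have hTA : ∀ χ, (∀ j, χ j ∈ N) → (∀ j, χ j ∉ specialChars f) →
      T χ ≤ (2 + Real.log p) * (k * f.natDegree * Real.sqrt p) := by
    intro χ hχN hχS
    exact norm_incomplete_sum_le (fun x => ∏ j, χ j (f.eval (x + d j)))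
      (weil_bound_prod hf0 (fun j => (mem_erase.1 (hχN j)).1)
        (fun j => (notMem_specialChars (mem_erase.1 (hχN j)).1).1 (hχS j)) huniq) hM
  have h2 := sum_piFinset_prod_mul_le (N := N) (S := specialChars f)
    (fun χ => norm_nonneg (idxCoeff g r s χ)) (by positivity) (Nat.cast_nonneg p) hTA hTP
  have hN : ∑ χ ∈ N, ‖idxCoeff g r s χ‖ ≤ 2 * Real.log p :=
    (sum_norm_idxCoeff_ne_one_le hg r s fun χ hχ => (mem_erase.1 hχ).1).trans (by linarith)
  have hN0 : 0 ≤ ∑ χ ∈ N, ‖idxCoeff g r s χ‖ := sum_nonneg fun _ _ => norm_nonneg _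
  have hS : p * ∑ χ ∈ specialChars f, ‖idxCoeff g r s χ‖ ≤ 2 * f.natDegree * (2 * Real.log p) := by
    have h3 := mul_le_mul_of_nonneg_left (sum_norm_idxCoeff_special_le hg r s hfp)
      (Nat.cast_nonneg (α := ℝ) p)
    refine h3.trans ?_
    rw [mul_div_assoc', div_le_iff₀ hp1, hcast]
    calc (p : ℝ) * (f.natDegree * (1 + Real.log p))
        ≤ (2 * (p - 1)) * (f.natDegree * (2 * Real.log p)) := by gcongr <;> linarith
      _ = _ := by ring
  have hpow : (2 * Real.log p) * (2 * Real.log p) ^ (k - 1) = 2 ^ k * Real.log p ^ k := by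
    rw [← pow_succ', Nat.sub_add_cancel hk, mul_pow]
  have hsl : 1 ≤ Real.sqrt p * Real.log p := by nlinarith
  refine h1.trans (h2.trans ?_)
  calc _ ≤ (3 * Real.log p) * (k * f.natDegree * Real.sqrt p) * (2 * Real.log p) ^ k +
        k * (2 * f.natDegree * (2 * Real.log p) * (2 * Real.log p) ^ (k - 1)) := by
        rw [← mul_assoc (p : ℝ)]
        gcongr
        linarith
    _ = 3 * (f.natDegree * k * 2 ^ k * Real.sqrt p * Real.log p ^ (k + 1)) +
        2 * (f.natDegree * k * 2 ^ k * Real.log p ^ k) := by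
        rw [mul_assoc (2 * (f.natDegree : ℝ)), hpow, mul_pow]
        ring
    _ ≤ 3 * (f.natDegree * k * 2 ^ k * Real.sqrt p * Real.log p ^ (k + 1)) +
        2 * (f.natDegree * k * 2 ^ k * Real.log p ^ k * (Real.sqrt p * Real.log p)) := by
        have hlog0 : 0 ≤ Real.log p := by linarith
        linarith [le_mul_of_one_le_right
          (by positivity : 0 ≤ (f.natDegree : ℝ) * k * 2 ^ k * Real.log p ^ k) hsl]
    _ = _ := by ring

/-- The number of points of `ZMod p` where `f` has index in `[r, r + s)`. -/
noncomputable def indexCount (g : (ZMod p)ˣ) (r : ℤ) (s : ℕ) (f : (ZMod p)[X]) : ℕ :=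
  Nat.card {x : ZMod p // HasIndexIn g r s (f.eval x)}

open scoped Classical in
theorem indexCount_eq_card_filter (g : (ZMod p)ˣ) (r : ℤ) (s : ℕ) (f : (ZMod p)[X]) :
    indexCount g r s f = #(univ.filter fun x : ZMod p => HasIndexIn g r s (f.eval x)) := by
  rw [indexCount, Nat.card_eq_fintype_card, Fintype.card_subtype]

theorem indexCount_le (g : (ZMod p)ˣ) (r : ℤ) (s : ℕ) (f : (ZMod p)[X]) :
    indexCount g r s f ≤ p := by
  classical
  rw [indexCount_eq_card_filter]
  exact (card_le_univ _).trans_eq (ZMod.card p)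

open scoped Classical in
/-- The indicator of the points where `f` has index in `[r, r + s)`, minus its mean. -/
noncomputable def balanced (g : (ZMod p)ˣ) (r : ℤ) (s : ℕ) (f : (ZMod p)[X]) (x : ZMod p) : ℝ :=
  (if HasIndexIn g r s (f.eval x) then 1 else 0) - (indexCount g r s f : ℝ) / p

open scoped Classical in
/-- The real-valued form of `oscPart`. -/
noncomputable def oscReal (g : (ZMod p)ˣ) (r : ℤ) (s : ℕ) (f : (ZMod p)[X]) (x : ZMod p) : ℝ :=
  (if HasIndexIn g r s (f.eval x) then 1 else 0) -
    (if f.eval x = 0 then 0 else (s : ℝ) / (p - 1 : ℕ))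

theorem abs_balanced_le_one (g : (ZMod p)ˣ) (r : ℤ) (s : ℕ) (f : (ZMod p)[X]) (x : ZMod p) :
    |balanced g r s f x| ≤ 1 := by
  have hp : (0 : ℝ) < p := by exact_mod_cast (Fact.out : p.Prime).pos
  have h0 : 0 ≤ (indexCount g r s f : ℝ) / p := by positivity
  have h1 : (indexCount g r s f : ℝ) / p ≤ 1 :=
    (div_le_one hp).2 (by exact_mod_cast indexCount_le g r s f)
  rw [balanced, abs_le]
  split_ifs <;> constructor <;> linarith

theorem abs_oscReal_le_one (g : (ZMod p)ˣ) (r : ℤ) {s : ℕ} (hs : s < p) (f : (ZMod p)[X])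
    (x : ZMod p) : |oscReal g r s f x| ≤ 1 := by
  have hp1 := natCast_sub_one_pos (p := p)
  have h0 : 0 ≤ (s : ℝ) / (p - 1 : ℕ) := by positivity
  have h1 : (s : ℝ) / (p - 1 : ℕ) ≤ 1 :=
    (div_le_one hp1).2 (by exact_mod_cast Nat.le_sub_one_of_lt hs)
  rw [oscReal, abs_le]
  split_ifs <;> constructor <;> linarith

theorem sum_abs_balanced_sub_oscReal_le {g : (ZMod p)ˣ} (hg : orderOf g = p - 1) (r : ℤ) {s : ℕ}
    (hs : s < p) {f : (ZMod p)[X]} (hf : 1 ≤ f.natDegree) (hfp : f.natDegree < p)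
    (hp3 : 3 ≤ p) :
    ∑ x, |balanced g r s f x - oscReal g r s f x| ≤
      10 * f.natDegree * Real.sqrt p * Real.log p := by
  classical
  have hp1 := natCast_sub_one_pos (p := p)
  have hcast : ((p - 1 : ℕ) : ℝ) = p - 1 := by
    rw [Nat.cast_sub (by omega), Nat.cast_one]
  have hp : (0 : ℝ) < p := by linarith
  have hp3' : (3 : ℝ) ≤ p := by exact_mod_cast hp3
  have hlog := one_le_log_of_three_le hp3
  have hsqrt : 1 ≤ Real.sqrt p := Real.one_le_sqrt.2 (by linarith)
  have hD : (1 : ℝ) ≤ f.natDegree := by exact_mod_cast hf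
  have hN := abs_card_hasIndexIn_sub_le hg r hs hf hfp
  rw [← indexCount_eq_card_filter] at hN
  have hsp : (s : ℝ) ≤ (p - 1 : ℕ) := by exact_mod_cast Nat.le_sub_one_of_lt hs
  set κ := (indexCount g r s f : ℝ) / p with hκ
  have h0 : 0 ≤ (s : ℝ) / (p - 1 : ℕ) := by positivity
  have h1 : (s : ℝ) / (p - 1 : ℕ) ≤ 1 := (div_le_one hp1).2 hsp
  have hdiff : p * |(s : ℝ) / (p - 1 : ℕ) - κ| ≤ 1 + |(indexCount g r s f : ℝ) - s| := by
    nth_rewrite 1 [← abs_of_pos hp]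
    rw [← abs_mul]
    have h2 : p * ((s : ℝ) / (p - 1 : ℕ) - κ) =
        (s : ℝ) / (p - 1 : ℕ) + -((indexCount g r s f : ℝ) - s) := by
      rw [hκ]
      field_simp
      rw [hcast]
      ring
    rw [h2]
    refine (abs_add_le _ _).trans ?_
    rw [abs_neg, abs_of_nonneg h0]
    linarith
  have hpt : ∀ x, |balanced g r s f x - oscReal g r s f x| ≤
      (if f.eval x = 0 then 1 else 0) + |(s : ℝ) / (p - 1 : ℕ) - κ| := by
    intro x
    have h2 : balanced g r s f x - oscReal g r s f x =
        -(if f.eval x = 0 then (s : ℝ) / (p - 1 : ℕ) else 0) + ((s : ℝ) / (p - 1 : ℕ) - κ) := by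
      simp only [balanced, oscReal, ← hκ]
      split_ifs <;> ring
    rw [h2]
    refine (abs_add_le _ _).trans (add_le_add ?_ le_rfl)
    split_ifs
    · rwa [abs_neg, abs_of_nonneg h0]
    · simp
  have hz : (#(univ.filter fun x : ZMod p => f.eval x = 0) : ℝ) ≤ f.natDegree := by
    exact_mod_cast card_zeros_le hf
  have hDs : (f.natDegree : ℝ) ≤ f.natDegree * Real.sqrt p * Real.log p := by
    rw [mul_assoc]
    exact le_mul_of_one_le_right (by linarith) (by nlinarith)
  have hDl : (f.natDegree : ℝ) * Real.sqrt p * (1 + Real.log p) ≤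
      2 * (f.natDegree * Real.sqrt p * Real.log p) := by
    calc (f.natDegree : ℝ) * Real.sqrt p * (1 + Real.log p)
        ≤ f.natDegree * Real.sqrt p * (2 * Real.log p) := by gcongr; linarith
      _ = _ := by ring
  calc ∑ x, |balanced g r s f x - oscReal g r s f x|
      ≤ ∑ x : ZMod p, ((if f.eval x = 0 then 1 else 0) + |(s : ℝ) / (p - 1 : ℕ) - κ|) :=
        sum_le_sum fun x _ => hpt x
    _ = #(univ.filter fun x : ZMod p => f.eval x = 0) + p * |(s : ℝ) / (p - 1 : ℕ) - κ| := by
        rw [sum_add_distrib, sum_boole, sum_const, card_univ, ZMod.card, nsmul_eq_mul]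
    _ ≤ _ := by linarith

theorem abs_sum_prod_balanced_le {g : (ZMod p)ˣ} (hg : orderOf g = p - 1) (r : ℤ) {s : ℕ}
    (hs : s < p) {f : (ZMod p)[X]} (hf : 1 ≤ f.natDegree) (hfp : f.natDegree < p) (hp3 : 3 ≤ p)
    {k : ℕ} (hk : 0 < k) {d : Fin k → ZMod p}
    (huniq : ∃ ρ : Kbar p, ∃ j, aeval (ρ + algebraMap (ZMod p) (Kbar p) (d j)) f = 0 ∧
      ∀ j', aeval (ρ + algebraMap (ZMod p) (Kbar p) (d j')) f = 0 → j' = j)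
    {M : ℕ} (hM : M ≤ p) :
    |∑ n ∈ range M, ∏ j, balanced g r s f (n + d j)| ≤
      15 * (f.natDegree * k * 2 ^ k * Real.sqrt p * Real.log p ^ (k + 1)) := by
  have hlog := one_le_log_of_three_le hp3
  have hlog0 : 0 ≤ Real.log p := by linarith
  have hosc : |∑ n ∈ range M, ∏ j, oscReal g r s f (n + d j)| ≤
      5 * (f.natDegree * k * 2 ^ k * Real.sqrt p * Real.log p ^ (k + 1)) := by
    refine le_of_eq_of_le ?_ (norm_sum_prod_oscPart_le hg r (s := s) hf hfp hp3 hk huniq hM)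
    rw [← Real.norm_eq_abs, ← Complex.norm_real]
    congr 1
    push_cast
    refine sum_congr rfl fun n _ => prod_congr rfl fun j _ => ?_
    rw [oscPart, sum_ne_one_idxCoeff_mul hg r hs, oscReal]
  have hinj : ∀ j, Set.InjOn (fun n : ℕ => (n : ZMod p) + d j) (range M) := by
    intro j m hm n hn hmn
    have hmn' := (ZMod.natCast_eq_natCast_iff' m n p).1 (add_right_cancel hmn)
    rwa [Nat.mod_eq_of_lt ((mem_range.1 hm).trans_le hM),
      Nat.mod_eq_of_lt ((mem_range.1 hn).trans_le hM)] at hmn'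
  have hshift : ∀ j, ∑ n ∈ range M, |balanced g r s f (n + d j) - oscReal g r s f (n + d j)| ≤
      10 * f.natDegree * Real.sqrt p * Real.log p := by
    intro j
    refine le_trans ?_ (sum_abs_balanced_sub_oscReal_le hg r hs hf hfp hp3)
    rw [← sum_image (f := fun x => |balanced g r s f x - oscReal g r s f x|) (hinj j)]
    exact sum_le_sum_of_subset_of_nonneg (subset_univ _) fun _ _ _ => abs_nonneg _
  have hdiff : |∑ n ∈ range M, ∏ j, balanced g r s f (n + d j) -
      ∑ n ∈ range M, ∏ j, oscReal g r s f (n + d j)| ≤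
      k * (10 * f.natDegree * Real.sqrt p * Real.log p) := by
    rw [← sum_sub_distrib]
    refine (abs_sum_le_sum_abs _ _).trans ((sum_le_sum fun n _ => abs_prod_sub_prod_le univ
      (fun j => abs_balanced_le_one g r s f _) fun j => abs_oscReal_le_one g r hs f _).trans ?_)
    rw [sum_comm]
    refine (sum_le_sum fun j _ => hshift j).trans_eq ?_
    rw [sum_const, card_univ, Fintype.card_fin, nsmul_eq_mul]
  have hpow : 1 ≤ 2 ^ k * Real.log p ^ k :=
    one_le_mul_of_one_le_of_one_le (one_le_pow₀ one_le_two) (one_le_pow₀ hlog)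
  have hW : k * (10 * f.natDegree * Real.sqrt p * Real.log p) ≤
      10 * (f.natDegree * k * 2 ^ k * Real.sqrt p * Real.log p ^ (k + 1)) := by
    calc k * (10 * f.natDegree * Real.sqrt p * Real.log p)
        ≤ k * (10 * f.natDegree * Real.sqrt p * Real.log p) * (2 ^ k * Real.log p ^ k) :=
          le_mul_of_one_le_right (by positivity) hpow
      _ = _ := by ring
  have htri := abs_sub_abs_le_abs_sub (∑ n ∈ range M, ∏ j, balanced g r s f (n + d j))
    (∑ n ∈ range M, ∏ j, oscReal g r s f (n + d j))
  linarith

end Correlation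

section IndexSet

variable {p : ℕ} [Fact p.Prime]

open scoped Classical in
theorem mod_mem_indexSet {g : (ZMod p)ˣ} {r : ℤ} {s : ℕ} {f : (ZMod p)[X]} (n : ℕ) :
    n % p ∈ indexSet p g f r s ↔ HasIndexIn g r s (f.eval (n : ZMod p)) := by
  rw [indexSet, mem_filter, mem_range, ZMod.natCast_mod,
    and_iff_right (Nat.mod_lt n (Fact.out : p.Prime).pos)]
  rfl

theorem card_indexSet (g : (ZMod p)ˣ) (r : ℤ) (s : ℕ) (f : (ZMod p)[X]) :
    #(indexSet p g f r s) = indexCount g r s f := by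
  classical
  rw [indexCount_eq_card_filter]
  have hlt : ∀ n ∈ indexSet p g f r s, n < p := fun n hn => mem_range.1 (mem_filter.1 hn).1
  refine card_bij' (fun n _ => (n : ZMod p)) (fun x _ => x.val) (fun n hn => ?_) (fun x hx => ?_)
    (fun n hn => ?_) fun x hx => ?_
  · rw [mem_filter, ← mod_mem_indexSet, Nat.mod_eq_of_lt (hlt n hn)]
    exact ⟨mem_univ _, hn⟩
  · rw [← Nat.mod_eq_of_lt x.val_lt, mod_mem_indexSet, ZMod.natCast_zmod_val]
    exact (mem_filter.1 hx).2
  · exact ZMod.val_cast_of_lt (hlt n hn)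
  · exact ZMod.natCast_zmod_val x

theorem fsub_indexSet (g : (ZMod p)ˣ) (r : ℤ) (s : ℕ) (f : (ZMod p)[X]) (n : ℕ) :
    fsub p (indexSet p g f r s) n = balanced g r s f n := by
  rw [fsub, balanced, card_indexSet]
  by_cases h : HasIndexIn g r s (f.eval (n : ZMod p))
  · rw [if_pos ((mod_mem_indexSet n).2 h), if_pos h]
  · rw [if_neg (mt (mod_mem_indexSet n).1 h), if_neg h, zero_sub]

theorem abs_card_indexSet_sub_le {g : (ZMod p)ˣ} (hg : orderOf g = p - 1) (r : ℤ) {s : ℕ}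
    (hs : s < p) {f : (ZMod p)[X]} (hf : 1 ≤ f.natDegree) :
    |(#(indexSet p g f r s) : ℝ) - s| ≤ 20 * f.natDegree * Real.sqrt p * Real.log p := by
  have hp2 := (Fact.out : p.Prime).two_le
  have hp2' : (2 : ℝ) ≤ p := by exact_mod_cast hp2
  have hsqrt : 1 ≤ Real.sqrt p := Real.one_le_sqrt.2 (by linarith)
  have hlog : 1 / 2 ≤ Real.log p := by
    linarith [Real.log_two_gt_d9, Real.log_le_log two_pos hp2']
  rw [card_indexSet]
  rcases lt_or_ge f.natDegree p with hfp | hfp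
  · classical
    have h := abs_card_hasIndexIn_sub_le hg r hs hf hfp
    rw [← indexCount_eq_card_filter] at h
    calc _ ≤ 4 * f.natDegree * Real.sqrt p * (1 + Real.log p) := h
      _ ≤ 4 * f.natDegree * Real.sqrt p * (5 * Real.log p) := by gcongr; linarith
      _ = _ := by ring
  · have h1 : (indexCount g r s f : ℝ) ≤ p := by exact_mod_cast indexCount_le g r s f
    have h2 : (s : ℝ) ≤ p := by exact_mod_cast hs.le
    have h3 : (p : ℝ) ≤ f.natDegree := by exact_mod_cast hfp
    have h4 : |(indexCount g r s f : ℝ) - s| ≤ p := by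
      rw [abs_le]
      constructor <;> linarith [Nat.cast_nonneg (α := ℝ) s,
        Nat.cast_nonneg (α := ℝ) (indexCount g r s f)]
    calc _ ≤ (f.natDegree : ℝ) := h4.trans h3
      _ ≤ f.natDegree * (20 * (Real.sqrt p * Real.log p)) :=
        le_mul_of_one_le_right (Nat.cast_nonneg _) (by nlinarith)
      _ = _ := by ring

theorem abs_sum_prod_fsub_le {g : (ZMod p)ˣ} (hg : orderOf g = p - 1) (r : ℤ) {s : ℕ}
    (hs : s < p) {f : (ZMod p)[X]} (hf : 1 ≤ f.natDegree) (hp3 : 3 ≤ p) {k : ℕ} (hk : 0 < k)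
    (h : Irreducible f ∨
          (∃ β : ℕ,
            (((UniqueFactorizationMonoid.normalizedFactors f).toFinset.filter
                (fun fi => fi.natDegree = β)).card = 1 ∨
              ((UniqueFactorizationMonoid.normalizedFactors f).toFinset.filter
                (fun fi => fi.natDegree = β)).card = 2)) ∨
          k ≤ 2 ∨
          ((4 * k) ^ f.natDegree < p ∨ (4 * f.natDegree) ^ k < p))
    {M : ℕ} (hM : M ≤ p) {d : Fin k → ℕ} (hd : StrictMono d) (hdp : ∀ i, d i ≤ p - 1) :
    |∑ n ∈ range M, ∏ i, fsub p (indexSet p g f r s) (n + d i)| ≤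
      15 * (f.natDegree * k * 2 ^ k * Real.sqrt p * Real.log p ^ (k + 1)) := by
  simp only [fsub_indexSet, Nat.cast_add]
  by_cases hsmall : f.natDegree < p ∧ k < p
  · refine abs_sum_prod_balanced_le hg r hs hf hsmall.1 hp3 hk
      (exists_unique_shift hf hsmall.1 hk hsmall.2 (fun i j hij => hd.injective ?_) h) hM
    have hlt : ∀ i, d i < p := fun i => (hdp i).trans_lt (by omega)
    have hij' := (ZMod.natCast_eq_natCast_iff' _ _ p).1 hij
    rwa [Nat.mod_eq_of_lt (hlt i), Nat.mod_eq_of_lt (hlt j)] at hij'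
  · have hlog := one_le_log_of_three_le hp3
    have hp3' : (3 : ℝ) ≤ p := by exact_mod_cast hp3
    have hsqrt : 1 ≤ Real.sqrt p := Real.one_le_sqrt.2 (by linarith)
    have hpDk : (p : ℝ) ≤ f.natDegree * k := by
      rw [not_and_or, not_lt, not_lt] at hsmall
      exact_mod_cast hsmall.elim (fun h => h.trans (Nat.le_mul_of_pos_right _ hk))
        fun h => h.trans (Nat.le_mul_of_pos_left _ hf)
    have hfac : 1 ≤ 15 * (2 ^ k * (Real.sqrt p * Real.log p ^ (k + 1))) := by
      have := one_le_mul_of_one_le_of_one_le (one_le_pow₀ (n := k) (one_le_two (α := ℝ)))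
        (one_le_mul_of_one_le_of_one_le hsqrt (one_le_pow₀ (n := k + 1) hlog))
      linarith
    calc |∑ n ∈ range M, ∏ i, balanced g r s f ((n : ZMod p) + (d i : ZMod p))|
        ≤ ∑ n ∈ range M, (1 : ℝ) := (abs_sum_le_sum_abs _ _).trans
          (sum_le_sum fun n _ => abs_prod_le_one univ fun _ => abs_balanced_le_one g r s f _)
      _ = M := by simp
      _ ≤ f.natDegree * k := (by exact_mod_cast hM : (M : ℝ) ≤ p).trans hpDk
      _ ≤ f.natDegree * k * (15 * (2 ^ k * (Real.sqrt p * Real.log p ^ (k + 1)))) :=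
        le_mul_of_one_le_right (by positivity) hfac
      _ = _ := by ring

end IndexSet

end WeilBound

theorem statement15 :
    ∃ c > (0 : ℝ),
      (∀ p : ℕ, p.Prime →
        ∀ g : (ZMod p)ˣ, orderOf g = p - 1 →
        ∀ f : Polynomial (ZMod p), 1 ≤ f.natDegree →
        ∀ r : ℤ, ∀ s : ℕ, 0 < s → s < p →
        |((indexSet p g f r s).card : ℝ) - s| ≤
          c * f.natDegree * Real.sqrt p * Real.log p) ∧
      (∀ ε > (0 : ℝ), ∃ p₀ : ℕ, ∀ p : ℕ, p₀ ≤ p → ∀ [Fact p.Prime],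
        ∀ g : (ZMod p)ˣ, orderOf g = p - 1 →
        ∀ f : Polynomial (ZMod p), 1 ≤ f.natDegree →
        ∀ r : ℤ, ∀ s : ℕ, 0 < s → s < p → ∀ k : ℕ, 0 < k →
        (Irreducible f ∨
          (∃ β : ℕ,
            (((UniqueFactorizationMonoid.normalizedFactors f).toFinset.filter
                (fun fi => fi.natDegree = β)).card = 1 ∨
              ((UniqueFactorizationMonoid.normalizedFactors f).toFinset.filter
                (fun fi => fi.natDegree = β)).card = 2)) ∨
          k ≤ 2 ∨
          ((4 * k) ^ f.natDegree < p ∨ (4 * f.natDegree) ^ k < p)) →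
        corrK (indexSet p g f r s) p k ≤
          c * (1 + ε) ^ k * f.natDegree * k * 2 ^ k * Real.sqrt p *
            Real.log p ^ (k + 1)) := by
  refine ⟨20, by norm_num, fun p hp g hg f hf r s _ hs => ?_, fun ε hε => ⟨3, ?_⟩⟩
  · have : Fact p.Prime := ⟨hp⟩
    exact WeilBound.abs_card_indexSet_sub_le hg r hs hf
  · intro p hp3 _ g hg f hf r s _ hs k hk h
    have hW : 0 ≤ f.natDegree * k * 2 ^ k * Real.sqrt p * Real.log p ^ (k + 1) := by
      have := Real.log_natCast_nonneg p
      positivity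
    have hεk : 1 ≤ (1 + ε) ^ k := one_le_pow₀ (by linarith)
    have hbound : 15 * (f.natDegree * k * 2 ^ k * Real.sqrt p * Real.log p ^ (k + 1)) ≤
        20 * (1 + ε) ^ k * f.natDegree * k * 2 ^ k * Real.sqrt p * Real.log p ^ (k + 1) := by
      linarith [le_mul_of_one_le_left hW hεk]
    refine Real.sSup_le ?_ (le_trans (by linarith) hbound)
    rintro x ⟨M, d, -, hM, hd, hdp, rfl⟩
    exact (WeilBound.abs_sum_prod_fsub_le hg r hs hf hp3 hk h hM hd hdp).trans hbound
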